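/- For n ≥ 3, the quotient B_{n+1}/Z(B_{n+1}) of the braid group on n+1 strands by its center is co-Hopfian: every injective group endomorphism of B_{n+1}/Z(B_{n+1}) is surjective. -/

import Mathlib

/-- The braid relations on `n` generators `σ_1, …, σ_n` (indexed by `Fin n`):
`σ_i σ_j σ_i = σ_j σ_i σ_j` when `j = i + 1`, and `σ_i σ_j = σ_j σ_i` when `j ≥ i + 2`.
The resulting presented group is the braid group `B_{n+1}` on `n+1` strands. -/
def braidRels (n : ℕ) : Set (FreeGroup (Fin n)) :=
  {r | (∃ i j : Fin n, (i : ℕ) + 1 = (j : ℕ) ∧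
          r = .of i * .of j * .of i * (.of j * .of i * .of j)⁻¹) ∨
       (∃ i j : Fin n, (i : ℕ) + 2 ≤ (j : ℕ) ∧
          r = .of i * .of j * (.of j * .of i)⁻¹)}

/-- The braid group `B_{n+1}` on `n+1` strands, presented with `n` generators. -/
abbrev BraidGroup (n : ℕ) : Type := PresentedGroup (braidRels n)

/-- The standard generator `σ_{i+1}` of the braid group. -/
def braidGen {n : ℕ} (i : Fin n) : BraidGroup n := PresentedGroup.of i

/-- The full twist `z = (σ_1 σ_2 ⋯ σ_n)^{n+1}`, which generates the center of `B_{n+1}`. -/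
def fullTwist (n : ℕ) : BraidGroup n :=
  ((List.ofFn fun i : Fin n => braidGen i).prod) ^ (n + 1)

namespace BraidGroup

variable {m : ℕ} {G : Type*} [Group G]

/-! ### Generators and homomorphisms out of the braid group -/

/-- The generators of the braid group, indexed by natural numbers from `0`; out of range
indices give `1`. -/
def σ (m i : ℕ) : BraidGroup m := if h : i < m then braidGen ⟨i, h⟩ else 1

theorem σ_of_lt {i : ℕ} (h : i < m) : σ m i = braidGen ⟨i, h⟩ := dif_pos h

theorem σ_of_le {i : ℕ} (h : m ≤ i) : σ m i = 1 := dif_neg (by omega)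

theorem σ_braid {i : ℕ} (h : i + 1 < m) :
    σ m i * σ m (i + 1) * σ m i = σ m (i + 1) * σ m i * σ m (i + 1) := by
  rw [σ_of_lt h, σ_of_lt (by omega : i < m)]
  exact PresentedGroup.mk_eq_mk_of_mul_inv_mem (Or.inl ⟨⟨i, by omega⟩, ⟨i + 1, h⟩, rfl, rfl⟩)

theorem σ_comm {i j : ℕ} (h : i + 2 ≤ j) : Commute (σ m i) (σ m j) := by
  rcases lt_or_ge j m with hj | hj
  · rw [σ_of_lt hj, σ_of_lt (by omega : i < m)]
    exact PresentedGroup.mk_eq_mk_of_mul_inv_mem (Or.inr ⟨⟨i, by omega⟩, ⟨j, hj⟩, h, rfl⟩)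
  · rw [σ_of_le hj]
    exact Commute.one_right _

/-- The universal property of the braid group. -/
def lift (s : ℕ → G) (hb : ∀ i, i + 1 < m → s i * s (i + 1) * s i = s (i + 1) * s i * s (i + 1))
    (hc : ∀ i j, i + 2 ≤ j → j < m → s i * s j = s j * s i) : BraidGroup m →* G :=
  PresentedGroup.toGroup (f := fun i : Fin m => s i) (by
    rintro r (⟨i, j, hij, rfl⟩ | ⟨i, j, hij, rfl⟩)
    · simp only [map_mul, map_inv, FreeGroup.lift_apply_of, ← hij, mul_inv_eq_one]
      exact hb i (by omega)
    · simp only [map_mul, map_inv, FreeGroup.lift_apply_of, mul_inv_eq_one]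
      exact hc i j hij j.2)

theorem lift_σ {s : ℕ → G} {hb hc} {i : ℕ} (hi : i < m) :
    lift (m := m) s hb hc (σ m i) = s i := by
  rw [σ_of_lt hi]
  exact PresentedGroup.toGroup.of _

theorem hom_ext {f g : BraidGroup m →* G} (h : ∀ i < m, f (σ m i) = g (σ m i)) : f = g :=
  PresentedGroup.ext fun i => by
    have := h i i.2
    rwa [σ_of_lt i.2] at this

theorem closure_σ : Subgroup.closure {g | ∃ i < m, g = σ m i} = ⊤ := by
  rw [← PresentedGroup.closure_range_of (braidRels m)]
  congr 1
  ext g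
  constructor
  · rintro ⟨i, hi, rfl⟩
    exact ⟨⟨i, hi⟩, (σ_of_lt hi).symm⟩
  · rintro ⟨i, rfl⟩
    exact ⟨i, i.2, (σ_of_lt i.2).symm⟩

theorem mem_of_σ_mem {S : Subgroup (BraidGroup m)} (h : ∀ i < m, σ m i ∈ S)
    (g : BraidGroup m) : g ∈ S := by
  have : (⊤ : Subgroup (BraidGroup m)) ≤ S := by
    rw [← closure_σ, Subgroup.closure_le]
    rintro _ ⟨i, hi, rfl⟩
    exact h i hi
  exact this trivial

theorem commute_of_σ {f : BraidGroup m →* G} {g : G} (h : ∀ i < m, Commute g (f (σ m i)))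
    (w : BraidGroup m) : Commute g (f w) :=
  Subgroup.mem_centralizer_singleton_iff.1 (mem_of_σ_mem (S := (Subgroup.centralizer {g}).comap f)
    (fun i hi => Subgroup.mem_centralizer_singleton_iff.2 (h i hi).eq.symm) w) |>.symm

theorem σ_succ_conj {i : ℕ} (h : i + 1 < m) :
    σ m (i + 1) = σ m i * σ m (i + 1) * σ m i * (σ m i * σ m (i + 1))⁻¹ := by
  rw [σ_braid h]
  group

theorem σ_isConj {i : ℕ} (h : i < m) : IsConj (σ m 0) (σ m i) := by
  induction i with
  | zero => exact IsConj.refl _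
  | succ i ih =>
    refine (ih (by omega)).trans (isConj_iff.2 ⟨σ m i * σ m (i + 1), ?_⟩)
    exact (σ_succ_conj h).symm

/-- The inclusion of braid groups adding a strand. -/
def incl (m : ℕ) : BraidGroup m →* BraidGroup (m + 1) :=
  lift (σ (m + 1)) (fun _ h => σ_braid (by omega)) (fun _ _ h _ => (σ_comm h).eq)

theorem incl_σ {i : ℕ} (h : i < m) : incl m (σ m i) = σ (m + 1) i := lift_σ h

/-- The exponent sum, as a homomorphism. -/
def expHom (m : ℕ) : BraidGroup m →* Multiplicative ℤ :=
  lift (fun _ => Multiplicative.ofAdd 1) (fun _ _ => rfl) (fun _ _ _ _ => rfl)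

/-- The exponent sum. -/
def exp (g : BraidGroup m) : ℤ := (expHom m g).toAdd

@[simp] theorem exp_one : exp (1 : BraidGroup m) = 0 := by simp [exp]
@[simp] theorem exp_mul (g h : BraidGroup m) : exp (g * h) = exp g + exp h := by simp [exp]
@[simp] theorem exp_inv (g : BraidGroup m) : exp g⁻¹ = -exp g := by simp [exp]
@[simp] theorem exp_zpow (g : BraidGroup m) (k : ℤ) : exp (g ^ k) = k * exp g := by simp [exp]
@[simp] theorem exp_pow (g : BraidGroup m) (k : ℕ) : exp (g ^ k) = k * exp g := by simp [exp]
theorem exp_σ {i : ℕ} (h : i < m) : exp (σ m i) = 1 := by simp [exp, expHom, lift_σ h]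

/-- The permutation of the strands `0, …, m` underlying a braid, extended by the identity. -/
def perm (m : ℕ) : BraidGroup m →* Equiv.Perm ℕ :=
  lift (fun i => Equiv.swap i (i + 1))
    (fun i _ => by
      ext k
      simp only [Equiv.Perm.mul_apply, Equiv.swap_apply_def]
      split_ifs <;> omega)
    (fun i j h _ => by
      ext k
      simp only [Equiv.Perm.mul_apply, Equiv.swap_apply_def]
      split_ifs <;> omega)

theorem perm_σ {i : ℕ} (h : i < m) : perm m (σ m i) = Equiv.swap i (i + 1) := lift_σ h

theorem perm_incl (g : BraidGroup m) : perm (m + 1) (incl m g) = perm m g := by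
  have : (perm (m + 1)).comp (incl m) = perm m := hom_ext fun i hi => by
    simp [incl_σ hi, perm_σ hi, perm_σ (show i < m + 1 by omega)]
  exact DFunLike.congr_fun this g

theorem exp_incl (g : BraidGroup m) : exp (incl m g) = exp g := by
  have : (expHom (m + 1)).comp (incl m) = expHom m := hom_ext fun i hi => by
    simp [incl_σ hi, expHom, lift_σ hi, lift_σ (show i < m + 1 by omega)]
  exact congrArg Multiplicative.toAdd (DFunLike.congr_fun this g)

theorem perm_of_gt (g : BraidGroup m) {k : ℕ} (hk : m < k) : perm m g k = k := by
  have := mem_of_σ_mem (S := (MulAction.stabilizer (Equiv.Perm ℕ) k).comap (perm m))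
    (fun i hi => by
      simp only [Subgroup.mem_comap, MulAction.mem_stabilizer_iff, perm_σ hi,
        Equiv.Perm.smul_def]
      exact Equiv.swap_apply_of_ne_of_ne (by omega) (by omega)) g
  exact this

theorem perm_le (g : BraidGroup m) {k : ℕ} (hk : k ≤ m) : perm m g k ≤ m := by
  by_contra! h
  have := (perm m g).injective (perm_of_gt g h)
  omega

/-- A braid is pure if it does not permute the strands. -/
def IsPure (g : BraidGroup m) : Prop := perm m g = 1

/-! ### Functions twisted by permutations -/

end BraidGroup

/-- The unrestricted wreath product, acting on `X × G` on the left. -/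
@[ext] structure Wreath (X G : Type*) where
  /-- The label of the arrow starting at a point. -/
  fn : X → G
  /-- The underlying permutation. -/
  pm : Equiv.Perm X

namespace Wreath

variable {X G : Type*} [Group G]

instance : Mul (Wreath X G) := ⟨fun a b => ⟨fun j => a.fn (b.pm j) * b.fn j, a.pm * b.pm⟩⟩
instance : One (Wreath X G) := ⟨⟨fun _ => 1, 1⟩⟩
instance : Inv (Wreath X G) := ⟨fun a => ⟨fun j => (a.fn (a.pm⁻¹ j))⁻¹, a.pm⁻¹⟩⟩

@[simp] theorem mul_fn (a b : Wreath X G) (j : X) : (a * b).fn j = a.fn (b.pm j) * b.fn j := rfl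
@[simp] theorem mul_pm (a b : Wreath X G) : (a * b).pm = a.pm * b.pm := rfl
@[simp] theorem one_fn (j : X) : (1 : Wreath X G).fn j = 1 := rfl
@[simp] theorem one_pm : (1 : Wreath X G).pm = 1 := rfl
@[simp] theorem inv_fn (a : Wreath X G) (j : X) : a⁻¹.fn j = (a.fn (a.pm⁻¹ j))⁻¹ := rfl
@[simp] theorem inv_pm (a : Wreath X G) : a⁻¹.pm = a.pm⁻¹ := rfl

instance : Group (Wreath X G) :=
  Group.ofLeftAxioms
    (fun a b c => by ext <;> simp [mul_assoc])
    (fun a => by ext <;> simp)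
    (fun a => by ext <;> simp)

/-- The underlying permutation, as a homomorphism. -/
def pmHom : Wreath X G →* Equiv.Perm X where
  toFun := pm
  map_one' := rfl
  map_mul' _ _ := rfl

end Wreath

/-! ### Free groups with generators indexed by natural numbers -/

namespace BraidGroup

/-- The free group of rank `k`. -/
abbrev F (k : ℕ) : Type := FreeGroup (Fin k)

section Free

variable {k : ℕ} {G : Type*} [Group G]

/-- The generators of the free group; out of range indices give `1`. -/
def X (k j : ℕ) : F k := if h : j < k then FreeGroup.of ⟨j, h⟩ else 1

theorem X_of_lt {j : ℕ} (h : j < k) : X k j = FreeGroup.of ⟨j, h⟩ := dif_pos h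

/-- The universal property of the free group. -/
def flift (s : ℕ → G) : F k →* G := FreeGroup.lift fun j => s j

theorem flift_X {s : ℕ → G} {j : ℕ} (h : j < k) : flift s (X k j) = s j := by
  rw [X_of_lt h]
  exact FreeGroup.lift_apply_of

theorem fhom_ext {f g : F k →* G} (h : ∀ j < k, f (X k j) = g (X k j)) : f = g :=
  FreeGroup.ext_hom _ _ fun j => by
    have := h j j.2
    rwa [X_of_lt j.2] at this

theorem mem_of_X_mem {S : Subgroup (F k)} (h : ∀ j < k, X k j ∈ S) (w : F k) : w ∈ S := by
  have : (⊤ : Subgroup (F k)) ≤ S := by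
    rw [← FreeGroup.closure_range_of, Subgroup.closure_le]
    rintro _ ⟨j, rfl⟩
    have := h j j.2
    rwa [X_of_lt j.2] at this
  exact this trivial

end Free

/-! ### The Artin representation -/

/-- The action of `σ_j` on the free group. -/
def artinHom (m j : ℕ) : F (m + 1) →* F (m + 1) :=
  flift fun k => if k = j then X (m + 1) (j + 1) else
    if k = j + 1 then (X (m + 1) (j + 1))⁻¹ * X (m + 1) j * X (m + 1) (j + 1) else X (m + 1) k

/-- The action of `σ_j⁻¹` on the free group. -/
def artinHomInv (m j : ℕ) : F (m + 1) →* F (m + 1) :=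
  flift fun k => if k = j then X (m + 1) j * X (m + 1) (j + 1) * (X (m + 1) j)⁻¹ else
    if k = j + 1 then X (m + 1) j else X (m + 1) k

/-- The action of `σ_j` on the free group, as an automorphism. -/
def artinAut (m j : ℕ) (h : j < m) : MulAut (F (m + 1)) :=
  MonoidHom.toMulEquiv (artinHom m j) (artinHomInv m j)
    (fhom_ext fun k hk => by
      simp only [MonoidHom.comp_apply, artinHom, flift_X hk, MonoidHom.id_apply]
      split_ifs with h1 h2
      · simp [artinHomInv, flift_X (show j + 1 < m + 1 by omega), h1]
      · simp [artinHomInv, flift_X (show j + 1 < m + 1 by omega),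
          flift_X (show j < m + 1 by omega), h2, mul_assoc]
      · simp [artinHomInv, flift_X hk, h1, h2])
    (fhom_ext fun k hk => by
      simp only [MonoidHom.comp_apply, artinHomInv, flift_X hk, MonoidHom.id_apply]
      split_ifs with h1 h2
      · simp [artinHom, flift_X (show j + 1 < m + 1 by omega),
          flift_X (show j < m + 1 by omega), h1, mul_assoc]
      · simp [artinHom, flift_X (show j < m + 1 by omega), h2]
      · simp [artinHom, flift_X hk, h1, h2])

theorem artinAut_X_self {m j : ℕ} (h : j < m) :
    artinAut m j h (X (m + 1) j) = X (m + 1) (j + 1) :=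
  show artinHom m j _ = _ by rw [artinHom, flift_X (by omega), if_pos rfl]

theorem artinAut_X_succ {m j : ℕ} (h : j < m) : artinAut m j h (X (m + 1) (j + 1)) =
    (X (m + 1) (j + 1))⁻¹ * X (m + 1) j * X (m + 1) (j + 1) :=
  show artinHom m j _ = _ by rw [artinHom, flift_X (by omega), if_neg (by omega), if_pos rfl]

theorem artinAut_X_ne {m j k : ℕ} (h : j < m) (hk : k ≤ m) (h1 : k ≠ j) (h2 : k ≠ j + 1) :
    artinAut m j h (X (m + 1) k) = X (m + 1) k :=
  show artinHom m j _ = _ by rw [artinHom, flift_X (by omega), if_neg h1, if_neg h2]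

theorem mulAut_ext {k : ℕ} {f g : MulAut (F k)} (h : ∀ j < k, f (X k j) = g (X k j)) : f = g := by
  have := fhom_ext (f := f.toMonoidHom) (g := g.toMonoidHom) h
  ext x
  exact DFunLike.congr_fun this x

/-- The Artin representation of the braid group on a free group. -/
def artin (m : ℕ) : BraidGroup m →* MulAut (F (m + 1)) :=
  lift (fun j => if h : j < m then artinAut m j h else 1)
    (fun i hi => by
      have hi' : i < m := by omega
      simp only [hi, hi', dif_pos]
      refine mulAut_ext fun k hk => ?_
      simp only [MulAut.mul_apply]
      rcases eq_or_ne k i with rfl | h1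
      · simp (disch := omega) [artinAut_X_self, artinAut_X_ne]
      rcases eq_or_ne k (i + 1) with rfl | h2
      · simp (disch := omega) [artinAut_X_self, artinAut_X_succ, artinAut_X_ne]
      rcases eq_or_ne k (i + 1 + 1) with rfl | h3
      · simp (disch := omega) [artinAut_X_self, artinAut_X_succ, artinAut_X_ne, mul_assoc]
      simp (disch := omega) [artinAut_X_ne])
    (fun i j hij hj => by
      have hi : i < m := by omega
      simp only [hi, hj, dif_pos]
      refine mulAut_ext fun k hk => ?_
      simp only [MulAut.mul_apply]
      rcases eq_or_ne k i with rfl | h1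
      · simp (disch := omega) [artinAut_X_self, artinAut_X_ne]
      rcases eq_or_ne k (i + 1) with rfl | h2
      · simp (disch := omega) [artinAut_X_self, artinAut_X_succ, artinAut_X_ne]
      rcases eq_or_ne k j with rfl | h3
      · simp (disch := omega) [artinAut_X_self, artinAut_X_ne]
      rcases eq_or_ne k (j + 1) with rfl | h4
      · simp (disch := omega) [artinAut_X_self, artinAut_X_succ, artinAut_X_ne]
      simp (disch := omega) [artinAut_X_ne])

theorem artin_σ {m j : ℕ} (h : j < m) : artin m (σ m j) = artinAut m j h := by
  rw [artin, lift_σ h, dif_pos h]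

theorem artin_X_self {m j : ℕ} (h : j < m) :
    artin m (σ m j) (X (m + 1) j) = X (m + 1) (j + 1) := by
  rw [artin_σ h, artinAut_X_self]

theorem artin_X_succ {m j : ℕ} (h : j < m) : artin m (σ m j) (X (m + 1) (j + 1)) =
    (X (m + 1) (j + 1))⁻¹ * X (m + 1) j * X (m + 1) (j + 1) := by
  rw [artin_σ h, artinAut_X_succ]

theorem artin_X_ne {m j k : ℕ} (h : j < m) (hk : k ≤ m) (h1 : k ≠ j) (h2 : k ≠ j + 1) :
    artin m (σ m j) (X (m + 1) k) = X (m + 1) k := by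
  rw [artin_σ h, artinAut_X_ne h hk h1 h2]

/-- The semidirect product of the free group and the braid group: the stabiliser of the last
strand in the braid group with one more strand. -/
abbrev A (m : ℕ) : Type := F (m + 1) ⋊[artin m] BraidGroup m

open SemidirectProduct

section

variable {m : ℕ}

/-- The generators of the braid group inside `A m`. -/
abbrev τ (m i : ℕ) : A m := inr (σ m i)

/-- The generators of the free group inside `A m`. -/
abbrev ξ (m j : ℕ) : A m := inl (X (m + 1) j)

theorem inr_mul_inl (g : BraidGroup m) (f : F (m + 1)) :
    (inr g * inl f : A m) = inl (artin m g f) * inr g := by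
  rw [inl_aut]
  simp [mul_assoc]

theorem τ_ξ_self {j : ℕ} (h : j < m) : τ m j * ξ m j = ξ m (j + 1) * τ m j := by
  rw [inr_mul_inl, artin_X_self h]

theorem τ_ξ_succ {j : ℕ} (h : j < m) :
    τ m j * ξ m (j + 1) = (ξ m (j + 1))⁻¹ * ξ m j * ξ m (j + 1) * τ m j := by
  rw [inr_mul_inl, artin_X_succ h]
  simp

theorem τ_ξ_ne {j k : ℕ} (hk : k ≤ m) (h1 : k ≠ j) (h2 : k ≠ j + 1) :
    τ m j * ξ m k = ξ m k * τ m j := by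
  rcases lt_or_ge j m with h | h
  · rw [inr_mul_inl, artin_X_ne h hk h1 h2]
  · simp [τ, σ_of_le h]

theorem τ_braid {i : ℕ} (h : i + 1 < m) :
    τ m i * τ m (i + 1) * τ m i = τ m (i + 1) * τ m i * τ m (i + 1) := by
  simpa using congrArg (inr : _ →* A m) (σ_braid h)

theorem τ_comm {i j : ℕ} (h : i + 2 ≤ j) : τ m i * τ m j = τ m j * τ m i := by
  simpa using congrArg (inr : _ →* A m) (σ_comm h).eq

theorem A_mem_of_mem {S : Subgroup (A m)} (h : ∀ i < m, τ m i ∈ S) (h' : ∀ j ≤ m, ξ m j ∈ S)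
    (v : A m) : v ∈ S := by
  rw [← inl_left_mul_inr_right v]
  exact S.mul_mem (mem_of_X_mem (S := S.comap inl) (fun j hj => h' j (by omega)) v.left)
    (mem_of_σ_mem (S := S.comap inr) h v.right)

/-! ### The cocycle describing strand-removal -/

/-- The label given by the cocycle to the strand `j` of `σ_i`. -/
def cocGen (m i j : ℕ) : A m :=
  if j = i then 1 else if j = i + 1 then ξ m i else if m + 2 ≤ j then 1 else
  if j < i then τ m (i - 1) else τ m i

theorem cocGen_self {i : ℕ} : cocGen m i i = 1 := by simp [cocGen]
theorem cocGen_succ {i : ℕ} : cocGen m i (i + 1) = ξ m i := by simp [cocGen]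
theorem cocGen_large {i j : ℕ} (hi : i ≤ m) (h : m + 2 ≤ j) : cocGen m i j = 1 := by
  rw [cocGen, if_neg (by omega), if_neg (by omega), if_pos h]
theorem cocGen_lt {i j : ℕ} (hi : i ≤ m) (h : j < i) : cocGen m i j = τ m (i - 1) := by
  rw [cocGen, if_neg (by omega), if_neg (by omega), if_neg (by omega), if_pos h]
theorem cocGen_gt {i j : ℕ} (hj : j ≤ m + 1) (h : i + 2 ≤ j) : cocGen m i j = τ m i := by
  rw [cocGen, if_neg (by omega), if_neg (by omega), if_neg (by omega), if_neg (by omega)]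

/-- The cocycle of the braid group on `m + 2` strands with values in `A m`, the stabiliser of
the last strand. -/
def cocHom (m : ℕ) : BraidGroup (m + 1) →* Wreath ℕ (A m) :=
  lift (fun i => ⟨cocGen m i, Equiv.swap i (i + 1)⟩)
    (fun i hi => by
      refine Wreath.ext (funext fun j => ?_) (Equiv.ext fun j => ?_)
      · simp only [Wreath.mul_fn, Wreath.mul_pm, Equiv.Perm.mul_apply]
        rcases eq_or_ne j i with rfl | h1
        · simp (disch := omega) [Equiv.swap_apply_of_ne_of_ne, cocGen_self, cocGen_lt, cocGen_gt]
        rcases eq_or_ne j (i + 1) with rfl | h2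
        · simp (disch := omega) [Equiv.swap_apply_of_ne_of_ne, cocGen_self, cocGen_lt, cocGen_gt,
            cocGen_succ]
          exact τ_ξ_self (by omega)
        rcases eq_or_ne j (i + 1 + 1) with rfl | h3
        · simp (disch := omega) [Equiv.swap_apply_of_ne_of_ne, cocGen_self, cocGen_lt, cocGen_gt,
            cocGen_succ]
          rw [τ_ξ_self (by omega), mul_assoc (ξ m (i + 1)), τ_ξ_succ (by omega)]
          simp only [mul_assoc, mul_inv_cancel_left]
        have e1 : Equiv.swap i (i + 1) j = j := Equiv.swap_apply_of_ne_of_ne h1 h2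
        have e2 : Equiv.swap (i + 1) (i + 1 + 1) j = j := Equiv.swap_apply_of_ne_of_ne h2 h3
        simp only [e1, e2]
        rcases le_or_gt (m + 2) j with h4 | h4
        · simp only [cocGen_large (show i ≤ m by omega) h4,
            cocGen_large (show i + 1 ≤ m by omega) h4]
        rcases lt_or_ge j i with h5 | h5
        · obtain ⟨i, rfl⟩ : ∃ k, i = k + 1 := ⟨i - 1, by omega⟩
          simp only [cocGen_lt (show i + 1 ≤ m by omega) h5,
            cocGen_lt (show i + 1 + 1 ≤ m by omega) (show j < i + 1 + 1 by omega),
            add_tsub_cancel_right]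
          exact τ_braid (by omega)
        · simp only [cocGen_gt (show j ≤ m + 1 by omega) (show i + 2 ≤ j by omega),
            cocGen_gt (show j ≤ m + 1 by omega) (show i + 1 + 2 ≤ j by omega)]
          exact τ_braid (by omega)
      · simp only [Wreath.mul_pm, Equiv.Perm.mul_apply, Equiv.swap_apply_def]
        split_ifs <;> omega)
    (fun i k hik hk => by
      refine Wreath.ext (funext fun j => ?_) (Equiv.ext fun j => ?_)
      · simp only [Wreath.mul_fn]
        rcases eq_or_ne j i with rfl | h1
        · simp (disch := omega) [Equiv.swap_apply_of_ne_of_ne, cocGen_self, cocGen_lt]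
        rcases eq_or_ne j (i + 1) with rfl | h2
        · simp (disch := omega) only [Equiv.swap_apply_of_ne_of_ne, Equiv.swap_apply_right,
            cocGen_succ, cocGen_lt]
          exact (τ_ξ_ne (by omega) (by omega) (by omega)).symm
        rw [Equiv.swap_apply_of_ne_of_ne h1 h2]
        rcases eq_or_ne j k with rfl | h3
        · simp (disch := omega) [cocGen_self, cocGen_gt]
        rcases eq_or_ne j (k + 1) with rfl | h4
        · simp (disch := omega) only [Equiv.swap_apply_right, cocGen_succ, cocGen_gt]
          exact τ_ξ_ne (by omega) (by omega) (by omega)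
        rw [Equiv.swap_apply_of_ne_of_ne h3 h4]
        rcases le_or_gt (m + 2) j with h4 | h4
        · simp only [cocGen_large (show i ≤ m by omega) h4, cocGen_large (show k ≤ m by omega) h4]
        rcases lt_or_ge j i with h5 | h5
        · simp (disch := omega) only [cocGen_lt]
          exact τ_comm (by omega)
        rcases lt_or_ge j k with h6 | h6
        · simp (disch := omega) only [cocGen_gt, cocGen_lt]
          exact τ_comm (by omega)
        · simp (disch := omega) only [cocGen_gt]
          exact τ_comm (by omega)
      · simp only [Wreath.mul_pm, Equiv.Perm.mul_apply, Equiv.swap_apply_def]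
        split_ifs <;> omega)

theorem cocHom_pm (g : BraidGroup (m + 1)) : (cocHom m g).pm = perm (m + 1) g := by
  have : Wreath.pmHom.comp (cocHom m) = perm (m + 1) := hom_ext fun i hi => by
    rw [perm_σ hi, MonoidHom.comp_apply, cocHom, lift_σ hi]
    rfl
  exact DFunLike.congr_fun this g

/-- The cocycle describing the removal of the strand starting at `j`. -/
def coc (g : BraidGroup (m + 1)) (j : ℕ) : A m := (cocHom m g).fn j

theorem coc_mul (g h : BraidGroup (m + 1)) (j : ℕ) :
    coc (g * h) j = coc g (perm _ h j) * coc h j := by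
  simp [coc, ← cocHom_pm]

@[simp] theorem coc_one (j : ℕ) : coc (1 : BraidGroup (m + 1)) j = 1 := by simp [coc]

theorem coc_inv (g : BraidGroup (m + 1)) (j : ℕ) :
    coc g⁻¹ j = (coc g ((perm _ g)⁻¹ j))⁻¹ := by
  simp [coc, ← cocHom_pm]

theorem coc_σ {i : ℕ} (h : i ≤ m) (j : ℕ) : coc (σ (m + 1) i) j = cocGen m i j := by
  rw [coc, cocHom, lift_σ (show i < m + 1 by omega)]

end

end BraidGroup

namespace BraidGroup

section BraidIdentities

variable {G : Type*} [Group G] {a b : G}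

theorem commute_of_braid (h : a * b * a = b * a * b) : Commute a (b * a ^ 2 * b) :=
  calc a * (b * a ^ 2 * b) = (a * b * a) * (a * b) := by simp only [pow_two, mul_assoc]
    _ = (b * a) * (b * a * b) := by rw [h]; simp only [mul_assoc]
    _ = b * a ^ 2 * b * a := by rw [← h]; simp only [pow_two, mul_assoc]

theorem braid_conj (h : a * b * a = b * a * b) : a * b * a * (a * b)⁻¹ = b := by
  rw [h]
  group

theorem braid_mul_inv (h : a * b * a = b * a * b) : b * (a⁻¹ * b⁻¹) = a⁻¹ * b⁻¹ * a :=
  calc _ = a⁻¹ * b⁻¹ * (b * a * b) * (a⁻¹ * b⁻¹) := by group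
    _ = _ := by rw [← h]; group

theorem braid_conj_sq (h : a * b * a = b * a * b) : a * (b * a ^ 2 * b⁻¹) * a⁻¹ = b ^ 2 := by
  have := braid_conj h
  calc _ = (a * b * a * (a * b)⁻¹) ^ 2 := by simp only [pow_two]; group
    _ = _ := by rw [this]

end BraidIdentities

variable {m : ℕ}

/-! ### The free group inside the braid group -/

/-- The pure braids generating the kernel of the removal of strand `m + 1`. -/
def bX (N : ℕ) : ℕ → ℕ → BraidGroup N
  | 0, _ => σ N 0 ^ 2
  | m + 1, j => if j = m + 1 then σ N (m + 1) ^ 2 else σ N (m + 1) * bX N m j * (σ N (m + 1))⁻¹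

theorem bX_self {N : ℕ} : bX N m m = σ N m ^ 2 := by
  cases m <;> simp [bX]

theorem bX_lt {N j : ℕ} (h : j ≤ m) :
    bX N (m + 1) j = σ N (m + 1) * bX N m j * (σ N (m + 1))⁻¹ := by
  rw [bX, if_neg (by omega)]

theorem σ_comm_bX {N j k : ℕ} (h : m + 2 ≤ k) : Commute (σ N k) (bX N m j) := by
  induction m with
  | zero => exact (σ_comm h).symm.pow_right _
  | succ m ih =>
    have h1 : Commute (σ N k) (σ N (m + 1)) := (σ_comm (by omega)).symm
    rw [bX]
    split_ifs
    · exact h1.pow_right _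
    · exact (h1.mul_right (ih (by omega))).mul_right h1.inv_right

theorem bX_conj {N : ℕ} (hN : m < N) {k : ℕ} (hk : k < m) :
    (∀ j ≤ m, j ≠ k → j ≠ k + 1 → Commute (σ N k) (bX N m j)) ∧
    σ N k * bX N m k * (σ N k)⁻¹ = bX N m (k + 1) ∧
    Commute (σ N k) (bX N m k * bX N m (k + 1)) := by
  induction m with
  | zero => omega
  | succ m ih =>
    rcases Nat.lt_succ_iff_lt_or_eq.1 hk with hk | rfl
    · obtain ⟨h1, h2, h3⟩ := ih (by omega) hk
      have hc : Commute (σ N k) (σ N (m + 1)) := σ_comm (by omega)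
      refine ⟨fun j hj h4 h5 => ?_, ?_, ?_⟩
      · rcases Nat.le_succ_iff.1 hj with hj | rfl
        · rw [bX_lt hj]
          exact (hc.mul_right (h1 j hj h4 h5)).mul_right hc.inv_right
        · rw [bX_self]
          exact hc.pow_right _
      · rw [bX_lt (by omega), bX_lt (by omega), ← h2]
        have : σ N k * (σ N (m + 1)) = (σ N (m + 1)) * σ N k := hc.eq
        calc _ = (σ N k * σ N (m + 1)) * bX N m k * (σ N k * σ N (m + 1))⁻¹ := by group
          _ = _ := by rw [hc.eq]; group
      · rw [bX_lt (by omega), bX_lt (by omega)]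
        have := (hc.mul_right h3).mul_right hc.inv_right
        have e : σ N (m + 1) * bX N m k * (σ N (m + 1))⁻¹ *
            (σ N (m + 1) * bX N m (k + 1) * (σ N (m + 1))⁻¹) =
            σ N (m + 1) * (bX N m k * bX N m (k + 1)) * (σ N (m + 1))⁻¹ := by group
        rwa [e]
    · have hb : σ N k * σ N (k + 1) * σ N k = σ N (k + 1) * σ N k * σ N (k + 1) :=
        σ_braid (by omega)
      refine ⟨fun j hj h4 h5 => ?_, ?_, ?_⟩
      · obtain ⟨i, rfl⟩ : ∃ i, k = i + 1 := ⟨k - 1, by omega⟩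
        rw [bX_lt (by omega), bX_lt (by omega)]
        set Y := bX N i j
        have hY : Commute (σ N (i + 1 + 1)) Y := σ_comm_bX le_rfl
        set a := σ N (i + 1)
        set b := σ N (i + 1 + 1)
        have e : b * (a * Y * a⁻¹) * b⁻¹ = (b * a) * Y * (b * a)⁻¹ := by group
        rw [e]
        have h6 : a * (b * a) = (b * a) * b := by rw [← mul_assoc, hb]
        rw [Commute, SemiconjBy, ← mul_assoc, ← mul_assoc, h6, mul_assoc (b * a), hY.eq]
        have h7 : (b * a)⁻¹ * a = b * (b * a)⁻¹ := by
          rw [inv_mul_eq_iff_eq_mul, ← mul_assoc, eq_mul_inv_iff_mul_eq, h6]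
        simp only [mul_assoc, h7]
      · rw [bX_lt le_rfl, bX_self, bX_self]
        exact braid_conj_sq hb
      · rw [bX_lt le_rfl, bX_self, bX_self]
        convert commute_of_braid hb using 1
        group

theorem incl_bX {j : ℕ} {N : ℕ} (hm : m < N) : incl N (bX N m j) = bX (N + 1) m j := by
  induction m with
  | zero => simp [bX, incl_σ hm]
  | succ m ih =>
    rw [bX, bX]
    split_ifs <;> simp [incl_σ hm, ih (by omega)]

/-- The free group of pure braids, as a homomorphism. -/
def ιF (m : ℕ) : F (m + 1) →* BraidGroup (m + 1) := flift (bX (m + 1) m)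

theorem ιF_X {j : ℕ} (h : j ≤ m) : ιF m (X (m + 1) j) = bX (m + 1) m j :=
  flift_X (by omega)

theorem ιF_artin (g : BraidGroup m) (f : F (m + 1)) :
    ιF m (artin m g f) = incl m g * ιF m f * (incl m g)⁻¹ := by
  let S : Subgroup (BraidGroup m) :=
    { carrier := {g | ∀ f, ιF m (artin m g f) = incl m g * ιF m f * (incl m g)⁻¹}
      one_mem' := fun f => by simp
      mul_mem' := fun {a b} ha hb f => by
        rw [map_mul, MulAut.mul_apply, ha, hb]
        simp [mul_assoc]
      inv_mem' := fun {a} ha f => by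
        have := ha (artin m a⁻¹ f)
        rw [← MulAut.mul_apply, ← map_mul, mul_inv_cancel, map_one, MulAut.one_apply] at this
        rw [this]
        simp [mul_assoc] }
  refine mem_of_σ_mem (S := S) (fun i hi f => ?_) g f
  have : (ιF m).comp (artin m (σ m i)).toMonoidHom =
      (MulAut.conj (incl m (σ m i))).toMonoidHom.comp (ιF m) := by
    obtain ⟨h1, h2, h3⟩ := bX_conj (N := m + 1) (by omega) hi
    refine fhom_ext fun j hj => ?_
    simp only [MonoidHom.comp_apply, MulEquiv.coe_toMonoidHom, MulAut.conj_apply, incl_σ hi]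
    rcases eq_or_ne j i with rfl | hji
    · rw [artin_X_self hi, ιF_X (by omega), ιF_X (by omega), h2]
    rcases eq_or_ne j (i + 1) with rfl | hji'
    · rw [artin_X_succ hi, map_mul, map_mul, map_inv, ιF_X (by omega), ιF_X (by omega)]
      rw [eq_mul_inv_iff_mul_eq, mul_assoc, mul_assoc, inv_mul_eq_iff_eq_mul, ← mul_assoc,
        ← h3.eq, ← mul_assoc, ← h2]
      group
    · rw [artin_X_ne hi (by omega) hji hji', ιF_X (by omega), (h1 j (by omega) hji hji').eq]
      simp
  exact DFunLike.congr_fun this f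

open SemidirectProduct

/-- The isomorphism of `A m` with the stabiliser of the last strand. -/
def ι (m : ℕ) : A m →* BraidGroup (m + 1) :=
  SemidirectProduct.lift (ιF m) (incl m) fun g => by
    ext1
    simp [ιF_artin]

@[simp] theorem ι_inl (f : F (m + 1)) : ι m (inl f) = ιF m f := by simp [ι]
@[simp] theorem ι_inr (g : BraidGroup m) : ι m (inr g) = incl m g := by simp [ι]
theorem ι_ξ {j : ℕ} (h : j ≤ m) : ι m (ξ m j) = bX (m + 1) m j := by rw [ι_inl, ιF_X h]
theorem ι_τ {j : ℕ} (h : j < m) : ι m (τ m j) = σ (m + 1) j := by rw [ι_inr, incl_σ h]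

/-- To generate `A m` the braid generators and the last free generator suffice. -/
theorem A_mem_of_mem_last {S : Subgroup (A m)} (h : ∀ i < m, τ m i ∈ S) (h' : ξ m m ∈ S)
    (v : A m) : v ∈ S := by
  refine A_mem_of_mem h (fun j hj => ?_) v
  induction hj using Nat.decreasingInduction with
  | self => exact h'
  | of_succ j hj ih =>
    have : ξ m j = (τ m j)⁻¹ * ξ m (j + 1) * τ m j := by
      rw [mul_assoc, ← τ_ξ_self hj, inv_mul_cancel_left]
    rw [this]
    exact S.mul_mem (S.mul_mem (S.inv_mem (h j hj)) ih) (h j hj)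

theorem perm_coc_ι (v : A m) : perm (m + 1) (ι m v) (m + 1) = m + 1 ∧ coc (ι m v) (m + 1) = v := by
  let S : Subgroup (A m) :=
    { carrier := {v | perm (m + 1) (ι m v) (m + 1) = m + 1 ∧ coc (ι m v) (m + 1) = v}
      one_mem' := by simp
      mul_mem' := fun {a b} ha hb => by
        simp only [Set.mem_ofPred_eq, map_mul, coc_mul, Equiv.Perm.mul_apply] at *
        rw [hb.1, ha.1, ha.2, hb.2]
        simp
      inv_mem' := fun {a} ha => by
        have : (perm (m + 1) (ι m a))⁻¹ (m + 1) = m + 1 := by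
          rw [Equiv.Perm.inv_eq_iff_eq, ha.1]
        simp only [Set.mem_ofPred_eq, map_inv, coc_inv, this] at *
        rw [ha.2]
        simp }
  refine A_mem_of_mem_last (S := S) (fun i hi => ?_) ?_ v
  · refine ⟨?_, ?_⟩
    · rw [ι_τ hi, perm_σ (by omega)]
      exact Equiv.swap_apply_of_ne_of_ne (by omega) (by omega)
    · rw [ι_τ hi, coc_σ (by omega), cocGen_gt le_rfl (by omega)]
  · refine ⟨?_, ?_⟩
    · rw [ι_ξ le_rfl, bX_self, map_pow, perm_σ (by omega)]
      simp [pow_two]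
    · rw [ι_ξ le_rfl, bX_self, pow_two, coc_mul, perm_σ (by omega), Equiv.swap_apply_right,
        coc_σ le_rfl, coc_σ le_rfl, cocGen_self, cocGen_succ, one_mul]

theorem perm_ι_last (v : A m) : perm (m + 1) (ι m v) (m + 1) = m + 1 := (perm_coc_ι v).1

@[simp] theorem coc_ι (v : A m) : coc (ι m v) (m + 1) = v := (perm_coc_ι v).2

theorem ι_injective : Function.Injective (ι m) := fun v w h => by
  rw [← coc_ι v, h, coc_ι]

/-- Coset representatives: `tr m l` moves the strand `m + 1` to `m + 1 - l`. -/
def trAux (m : ℕ) : ℕ → BraidGroup (m + 1)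
  | 0 => 1
  | l + 1 => (σ (m + 1) (m - l))⁻¹ * trAux m l

/-- Coset representatives moving the strand `m + 1` to `j`. -/
def tr (m j : ℕ) : BraidGroup (m + 1) := trAux m (m + 1 - j)

theorem tr_last : tr m (m + 1) = 1 := by simp [tr, trAux]

theorem tr_ge {j : ℕ} (h : m + 1 ≤ j) : tr m j = 1 := by
  rw [tr, Nat.sub_eq_zero_of_le h, trAux]

theorem tr_of_le {j : ℕ} (h : j ≤ m) : tr m j = (σ (m + 1) j)⁻¹ * tr m (j + 1) := by
  rw [tr, tr, show m + 1 - j = (m - j) + 1 by omega, trAux, show m - (m - j) = j by omega,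
    show m + 1 - (j + 1) = m - j by omega]

theorem σ_comm_tr {i j : ℕ} (h : i + 2 ≤ j) : Commute (σ (m + 1) i) (tr m j) := by
  rcases le_or_gt (m + 1) j with hj | hj
  · rw [tr_ge hj]
    exact Commute.one_right _
  · induction (show j ≤ m by omega) using Nat.decreasingInduction with
    | self =>
      rw [tr_of_le le_rfl, tr_last]
      exact (σ_comm h).inv_right.mul_right (Commute.one_right _)
    | of_succ j hj' ih =>
      rw [tr_of_le (by omega)]
      exact (σ_comm h).inv_right.mul_right (ih (by omega) (by omega))

theorem σ_mul_tr_lt {i j : ℕ} (h : j < i) (hi : i ≤ m) :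
    σ (m + 1) i * tr m j = tr m j * σ (m + 1) (i - 1) := by
  obtain ⟨i, rfl⟩ : ∃ k, i = k + 1 := ⟨i - 1, by omega⟩
  rw [add_tsub_cancel_right]
  induction (show j ≤ i by omega) using Nat.decreasingInduction with
  | self =>
    rw [tr_of_le (by omega), tr_of_le (by omega)]
    have hb : σ (m + 1) i * σ (m + 1) (i + 1) * σ (m + 1) i =
      σ (m + 1) (i + 1) * σ (m + 1) i * σ (m + 1) (i + 1) := σ_braid (by omega)
    have hc : Commute (σ (m + 1) i) (tr m (i + 1 + 1)) := σ_comm_tr le_rfl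
    set a := σ (m + 1) i
    set b := σ (m + 1) (i + 1)
    have e : b * (a⁻¹ * b⁻¹) = a⁻¹ * b⁻¹ * a := braid_mul_inv hb
    calc _ = b * (a⁻¹ * b⁻¹) * tr m (i + 1 + 1) := by group
      _ = a⁻¹ * b⁻¹ * (a * tr m (i + 1 + 1)) := by rw [e]; group
      _ = _ := by rw [hc.eq]; group
  | of_succ j hj ih =>
    rw [tr_of_le (by omega), ← mul_assoc, ((σ_comm (by omega)).symm.inv_right).eq, mul_assoc,
      ih (by omega), mul_assoc]

theorem bX_eq_tr {j : ℕ} (h : j ≤ m) :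
    bX (m + 1) m j = (tr m (j + 1))⁻¹ * σ (m + 1) j ^ 2 * tr m (j + 1) := by
  induction h using Nat.decreasingInduction with
  | self => simp [bX_self, tr_last]
  | of_succ j hj ih =>
    have e := (bX_conj (N := m + 1) (by omega) hj).2.1
    have hb := σ_braid (show j + 1 < m + 1 by omega)
    have hc : Commute (σ (m + 1) j) (tr m (j + 1 + 1)) := σ_comm_tr le_rfl
    rw [tr_of_le (by omega)]
    rw [ih] at e
    set a := σ (m + 1) j
    set b := σ (m + 1) (j + 1)
    set t := tr m (j + 1 + 1)
    have e1 : bX (m + 1) m j = a⁻¹ * (t⁻¹ * b ^ 2 * t) * a := by rw [← e]; group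
    have e2 := braid_conj_sq hb
    rw [e1, ← e2]
    have e3 : t * a = a * t := hc.eq.symm
    calc _ = (t * a)⁻¹ * (a * (b * a ^ 2 * b⁻¹) * a⁻¹) * (t * a) := by group
      _ = _ := by rw [e3]; group

theorem mul_tr (g : BraidGroup (m + 1)) {j : ℕ} (hj : j ≤ m + 1) :
    g * tr m j = tr m (perm _ g j) * ι m (coc g j) := by
  let S : Subgroup (BraidGroup (m + 1)) :=
    { carrier := {g | ∀ j ≤ m + 1, g * tr m j = tr m (perm _ g j) * ι m (coc g j)}
      one_mem' := by simp
      mul_mem' := fun {a b} ha hb j hj => by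
        rw [mul_assoc, hb j hj, ← mul_assoc, ha _ (perm_le b hj), coc_mul]
        simp [mul_assoc]
      inv_mem' := fun {a} ha j hj => by
        have := ha ((perm _ a)⁻¹ j) (by rw [← map_inv]; exact perm_le _ hj)
        have e : perm _ a ((perm _ a)⁻¹ j) = j := by simp
        rw [e] at this
        rw [coc_inv, map_inv, map_inv, eq_mul_inv_iff_mul_eq, mul_assoc, ← this,
          inv_mul_cancel_left] }
  refine mem_of_σ_mem (S := S) (fun i hi j hj => ?_) g j hj
  rw [perm_σ hi, coc_σ (by omega)]
  rcases eq_or_ne j i with rfl | h1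
  · rw [cocGen_self, Equiv.swap_apply_left, map_one, mul_one, tr_of_le (by omega),
      mul_inv_cancel_left]
  rcases eq_or_ne j (i + 1) with rfl | h2
  · rw [cocGen_succ, Equiv.swap_apply_right, ι_ξ (by omega), bX_eq_tr (by omega),
      tr_of_le (show i ≤ m by omega)]
    group
  rw [Equiv.swap_apply_of_ne_of_ne h1 h2]
  rcases lt_or_ge j i with h3 | h3
  · rw [cocGen_lt (by omega) h3, ι_τ (by omega), σ_mul_tr_lt h3 (by omega)]
  · rw [cocGen_gt hj (by omega), ι_τ (by omega), (σ_comm_tr (by omega)).eq]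

theorem eq_ι_of_perm {g : BraidGroup (m + 1)} (h : perm _ g (m + 1) = m + 1) :
    g = ι m (coc g (m + 1)) := by
  have := mul_tr g le_rfl
  rwa [h, tr_last, mul_one, one_mul] at this

theorem perm_ι (v : A m) : perm (m + 1) (ι m v) = perm m v.right := by
  have : ((perm (m + 1)).comp (ι m)).eqLocus ((perm m).comp SemidirectProduct.rightHom) = ⊤ := by
    refine eq_top_iff.2 fun v _ => A_mem_of_mem_last (fun i hi => ?_) ?_ v
    · change perm (m + 1) (ι m (τ m i)) = perm m (σ m i)
      rw [ι_inr, perm_incl]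
    · change perm (m + 1) (ι m (ξ m m)) = perm m 1
      rw [ι_ξ le_rfl, bX_self, map_pow, perm_σ (by omega)]
      simp [pow_two]
  exact (this.ge trivial : v ∈ ((perm (m + 1)).comp (ι m)).eqLocus _)

end BraidGroup

/-! ### Commuting elements of free groups -/

theorem FreeGroup.subsingleton_of_commute {α : Type*}
    (h : ∀ a b : FreeGroup α, a * b = b * a) : Subsingleton α := by
  classical
  refine ⟨fun a b => by_contra fun hab => ?_⟩
  have := congrArg (FreeGroup.lift fun x => if x = a then Equiv.swap (0 : Fin 3) 1 else
    Equiv.swap 1 2) (h (.of a) (.of b))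
  simp only [_root_.map_mul, FreeGroup.lift_apply_of, if_true, if_neg (Ne.symm hab)] at this
  revert this
  decide

theorem FreeGroup.exists_zpow_of_commute {α : Type*} {u w : FreeGroup α} (h : Commute u w) :
    ∃ (c : FreeGroup α) (a b : ℤ), u = c ^ a ∧ w = c ^ b := by
  let H := Subgroup.closure {u, w}
  have hcomm : ∀ a b : H, a * b = b * a := by
    have := Subgroup.isMulCommutative_closure (k := {u, w}) (by
      rintro x (rfl | rfl) y (rfl | rfl)
      exacts [rfl, h.eq, h.eq.symm, rfl])
    exact fun a b => this.is_comm.comm a b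
  have : IsFreeGroup H := subgroupIsFreeOfIsFree H
  let e := IsFreeGroup.toFreeGroup H
  have hs : Subsingleton (IsFreeGroup.Generators H) :=
    FreeGroup.subsingleton_of_commute fun a b => e.symm.injective (by
      rw [_root_.map_mul, _root_.map_mul, hcomm])
  have hc : IsCyclic (FreeGroup (IsFreeGroup.Generators H)) := by
    rcases isEmpty_or_nonempty (IsFreeGroup.Generators H) with h0 | ⟨⟨x⟩⟩
    · exact inferInstance
    · have : Unique (IsFreeGroup.Generators H) := uniqueOfSubsingleton x
      infer_instance
  have hc' : IsCyclic H := isCyclic_of_surjective e.symm e.symm.surjective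
  obtain ⟨c, hc⟩ := hc'.exists_generator
  obtain ⟨a, ha⟩ := hc ⟨u, Subgroup.subset_closure (by simp)⟩
  obtain ⟨b, hb⟩ := hc ⟨w, Subgroup.subset_closure (by simp)⟩
  exact ⟨c, a, b, by simpa using (congrArg Subtype.val ha).symm,
    by simpa using (congrArg Subtype.val hb).symm⟩

theorem commute_of_commute_zpow {G : Type*} [Group G] [IsMulTorsionFree G] {u w : G} {r : ℤ}
    (hr : r ≠ 0) (h : Commute u (w ^ r)) : Commute u w := by
  have : (u * w * u⁻¹) ^ r = w ^ r := by
    rw [conj_zpow, h.eq, mul_inv_cancel_right]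
  have := zpow_left_injective hr this
  exact mul_inv_eq_iff_eq_mul.1 this

theorem FreeGroup.exists_eq_zpow_of_commute {α : Type*} {u w : FreeGroup α}
    (φ : FreeGroup α →* Multiplicative ℤ) (hφ : φ w = Multiplicative.ofAdd 1)
    (h : Commute u w) : ∃ i : ℤ, u = w ^ i := by
  obtain ⟨c, a, b, rfl, rfl⟩ := FreeGroup.exists_zpow_of_commute h
  have h1 : b * (φ c).toAdd = 1 := by
    simpa using congrArg Multiplicative.toAdd hφ
  rcases Int.isUnit_iff.1 (IsUnit.of_mul_eq_one _ h1) with rfl | rfl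
  · exact ⟨a, by simp⟩
  · exact ⟨-a, by simp⟩

namespace BraidGroup

open SemidirectProduct

variable {m : ℕ}

/-- The exponent sum of the generator `j` in an element of the free group. -/
def abHom (k j : ℕ) : F k →* Multiplicative ℤ :=
  flift fun i => if i = j then Multiplicative.ofAdd 1 else 1

/-- The exponent sum of the generator `j` in an element of the free group. -/
def ab {k : ℕ} (f : F k) (j : ℕ) : ℤ := (abHom k j f).toAdd

section

variable {k : ℕ}
@[simp] theorem ab_one (j : ℕ) : ab (1 : F k) j = 0 := by simp [ab]
@[simp] theorem ab_mul (f g : F k) (j : ℕ) : ab (f * g) j = ab f j + ab g j := by simp [ab]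
@[simp] theorem ab_inv (f : F k) (j : ℕ) : ab f⁻¹ j = -ab f j := by simp [ab]
@[simp] theorem ab_zpow (f : F k) (n : ℤ) (j : ℕ) : ab (f ^ n) j = n * ab f j := by simp [ab]
theorem ab_X {i : ℕ} (h : i < k) (j : ℕ) : ab (X k i) j = if i = j then 1 else 0 := by
  rw [ab, abHom, flift_X h]
  split_ifs <;> rfl

/-- The product of the first `n` generators. -/
def bp (k : ℕ) : ℕ → F k
  | 0 => 1
  | n + 1 => bp k n * X k n

theorem bp_succ (n : ℕ) : bp k (n + 1) = bp k n * X k n := rfl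

theorem ab_bp {n : ℕ} (h : n ≤ k) (j : ℕ) : ab (bp k n) j = if j < n then 1 else 0 := by
  induction n with
  | zero => simp [bp]
  | succ n ih =>
    rw [bp_succ, ab_mul, ih (by omega), ab_X (by omega)]
    split_ifs <;> omega

theorem exists_eq_zpow_of_commute {u w : F k} {j : ℕ} (hw : ab w j = 1) (h : Commute u w) :
    ∃ i : ℤ, u = w ^ i :=
  FreeGroup.exists_eq_zpow_of_commute (abHom k j) (by rw [← hw]; rfl) h

end

/-- The product of all the generators of the free group. -/
def P (m : ℕ) : F (m + 1) := bp (m + 1) (m + 1)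

theorem ab_P {j : ℕ} (h : j ≤ m) : ab (P m) j = 1 := by
  rw [P, ab_bp le_rfl, if_pos (by omega)]

theorem artin_bp_of_le {i n : ℕ} (hi : i < m) (hn : n ≤ i) :
    artin m (σ m i) (bp (m + 1) n) = bp (m + 1) n := by
  induction n with
  | zero => simp [bp]
  | succ n ih => rw [bp_succ, map_mul, ih (by omega), artin_X_ne hi] <;> omega

theorem artin_bp_of_ge {i n : ℕ} (hn : i + 2 ≤ n) (hm : n ≤ m + 1) :
    artin m (σ m i) (bp (m + 1) n) = bp (m + 1) n := by
  have hi : i < m := by omega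
  induction hn with
  | refl =>
    rw [bp_succ, bp_succ, map_mul, map_mul, artin_bp_of_le hi le_rfl, artin_X_self hi,
      artin_X_succ hi]
    group
  | @step n hn ih =>
    have hn : i + 2 ≤ n := hn
    rw [bp_succ, map_mul, ih (by omega), artin_X_ne hi] <;> omega

theorem artin_P (g : BraidGroup m) : artin m g (P m) = P m := by
  let S : Subgroup (BraidGroup m) := (MulAction.stabilizer (MulAut (F (m + 1))) (P m)).comap
    (artin m)
  exact mem_of_σ_mem (S := S) (fun i hi => artin_bp_of_ge (by omega) (by omega)) g

theorem artin_eq_conj {a : BraidGroup m} {k f : F (m + 1)}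
    (h : Commute (inl k * inr a : A m) (inl f)) : artin m a f = k⁻¹ * f * k := by
  have : k * artin m a f = f * k := by
    have := congrArg SemidirectProduct.left h.eq
    simpa using this
  rw [mul_assoc, ← this, inv_mul_cancel_left]

/-! ### The center -/

/-- The full twist, defined inductively. -/
def z : (m : ℕ) → BraidGroup m
  | 0 => 1
  | m + 1 => ι m (inl (P m) * inr (z m))

theorem z_succ : z (m + 1) = ιF m (P m) * incl m (z m) := by simp [z]

theorem ιF_P_succ : ιF (m + 1) (P (m + 1)) =
    σ (m + 2) (m + 1) * incl (m + 1) (ιF m (P m)) * σ (m + 2) (m + 1) := by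
  have : ∀ n ≤ m + 1, ιF (m + 1) (bp (m + 2) n) =
      σ (m + 2) (m + 1) * incl (m + 1) (ιF m (bp (m + 1) n)) * (σ (m + 2) (m + 1))⁻¹ := by
    intro n hn
    induction n with
    | zero => simp [bp]
    | succ n ih =>
      rw [bp_succ, bp_succ, map_mul, ih (by omega), ιF_X (by omega), map_mul, map_mul,
        ιF_X (by omega), incl_bX (by omega), bX_lt (by omega)]
      group
  rw [P, bp_succ, map_mul, this _ le_rfl, ιF_X le_rfl, bX_self, ← P]
  group

theorem incl_comm_ιF_P (g : BraidGroup m) : Commute (incl m g) (ιF m (P m)) := by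
  have := ιF_artin g (P m)
  rw [artin_P] at this
  exact (eq_mul_inv_iff_mul_eq.1 this).symm

theorem σ_last_comm_incl (g : BraidGroup m) :
    Commute (σ (m + 2) (m + 1)) (incl (m + 1) (incl m g)) :=
  commute_of_σ (f := (incl (m + 1)).comp (incl m)) (fun i hi => by
    rw [MonoidHom.comp_apply, incl_σ hi, incl_σ (by omega)]
    exact (σ_comm (by omega)).symm) g

theorem z_comm : ∀ {m : ℕ} (g : BraidGroup m), Commute (z m) g
  | 0, g => Commute.one_left g
  | 1, g => commute_of_σ (f := MonoidHom.id _) (fun i hi => by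
      obtain rfl : i = 0 := by omega
      simp [z, P, bp, ιF_X, bX]) g
  | m + 2, g => commute_of_σ (f := MonoidHom.id _) (fun i hi => by
      rw [MonoidHom.id_apply, z_succ]
      rcases Nat.lt_succ_iff_lt_or_eq.1 hi with hi | rfl
      · rw [← incl_σ hi]
        exact (incl_comm_ιF_P _).symm.mul_left ((z_comm _).map (incl (m + 1)))
      · rw [ιF_P_succ, z_succ, map_mul]
        have h1 := σ_last_comm_incl (z m)
        set s := σ (m + 2) (m + 1)
        set p := incl (m + 1) (ιF m (P m))
        have h2 : Commute (s * p * s) p := by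
          have := incl_comm_ιF_P (m := m + 1) (ιF m (P m))
          rw [ιF_P_succ] at this
          exact this.symm
        have h3 : Commute (s * p * s * p) s := by
          rw [Commute, SemiconjBy, h2.eq]
          have : s * (p * (s * p * s)) = s * (s * p * s * p) := by rw [h2.eq]
          rw [← h2.eq] at *
          simp only [mul_assoc] at h2 this ⊢
          have h2' := h2.eq
          simp only [SemiconjBy, mul_assoc] at h2'
          rw [← h2']
        rw [← mul_assoc]
        exact h3.mul_left h1.symm) g

theorem ι_comm_iff {v w : A m} : Commute (ι m v) (ι m w) ↔ Commute v w :=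
  ⟨fun h => ι_injective (by simpa using h.eq), fun h => h.map (ι m)⟩

theorem artin_z (f : F (m + 1)) : artin m (z m) f = (P m)⁻¹ * f * P m :=
  artin_eq_conj (ι_comm_iff.1 (z_comm (m := m + 1) (ι m (inl f))))

theorem artin_z_zpow (l : ℤ) (f : F (m + 1)) :
    artin m (z m ^ l) f = P m ^ (-l) * f * P m ^ l := by
  have : artin m (z m) = MulAut.conj (P m)⁻¹ := by
    ext1 f
    rw [artin_z, MulAut.conj_apply, inv_inv]
  rw [map_zpow, this, ← map_zpow, MulAut.conj_apply]
  simp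

theorem eq_P_zpow_of_artin_z {f : F (m + 1)} (h : artin m (z m) f = f) : ∃ j : ℤ, f = P m ^ j := by
  rw [artin_z, mul_assoc, inv_mul_eq_iff_eq_mul] at h
  exact exists_eq_zpow_of_commute (ab_P (Nat.zero_le m)) h

theorem isPure_z : ∀ m, IsPure (z m)
  | 0 => by simp [IsPure, z]
  | m + 1 => by
    rw [IsPure, z, perm_ι]
    simpa [IsPure] using isPure_z m

theorem P_zpow_eq_one (hm : 1 ≤ m) {n : ℤ} (h : ∀ f, Commute (P m ^ n) f) : n = 0 := by
  by_contra hn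
  obtain ⟨i, hi⟩ := exists_eq_zpow_of_commute (ab_P (Nat.zero_le m))
    (commute_of_commute_zpow hn (h (X (m + 1) 0)).symm)
  have h0 := congrArg (ab · 0) hi
  have h1 := congrArg (ab · 1) hi
  simp only [ab_zpow, ab_P hm, ab_P (Nat.zero_le m), ab_X (Nat.succ_pos m)] at h0 h1
  simp at h0 h1
  omega

theorem pure_central : ∀ {m : ℕ} {y : BraidGroup m}, IsPure y → (∀ g, Commute y g) →
    ∃ l : ℤ, y = z m ^ l
  | 0, y, _, _ => by
    have : y ∈ (⊥ : Subgroup (BraidGroup 0)) := mem_of_σ_mem (by simp) y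
    exact ⟨0, by simpa using this⟩
  | m + 1, y, hy, hc => by
    obtain ⟨v, rfl⟩ : ∃ v, ι m v = y := ⟨_, (eq_ι_of_perm (by rw [hy]; rfl)).symm⟩
    obtain ⟨k, b, rfl⟩ : ∃ k b, v = inl k * inr b := ⟨_, _, (inl_left_mul_inr_right v).symm⟩
    have hc' : ∀ w, Commute (inl k * inr b) w := fun w => ι_comm_iff.1 (hc (ι m w))
    have hb : IsPure b := by
      rw [IsPure, perm_ι] at hy
      simpa [IsPure] using hy
    have hk : ∀ g, artin m g k = k := fun g => by
      simpa using congrArg SemidirectProduct.left (hc' (inr g)).eq.symm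
    obtain ⟨l, rfl⟩ := pure_central hb fun g => show b * g = g * b by
      simpa using congrArg SemidirectProduct.right (hc' (inr g)).eq
    obtain ⟨j, rfl⟩ := eq_P_zpow_of_artin_z (hk (z m))
    rcases Nat.eq_zero_or_pos m with rfl | hm
    · exact ⟨j, by simp [z]⟩
    obtain rfl : j = l := by
      refine sub_eq_zero.1 (P_zpow_eq_one hm fun f => ?_)
      have := artin_eq_conj (hc' (inl f))
      rw [artin_z_zpow] at this
      rw [Commute, SemiconjBy, zpow_sub]
      calc _ = P m ^ j * (P m ^ (-l) * f * P m ^ l) * P m ^ (-l) := by group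
        _ = _ := by rw [this]; group
    refine ⟨j, ?_⟩
    rw [z, ← map_zpow, Commute.mul_zpow, map_zpow, map_zpow]
    · rw [Commute, SemiconjBy, inr_mul_inl, artin_P]

/-- Pure braids commuting with all the generators but the last. -/
theorem pure_commute_incl {y : BraidGroup (m + 1)} (hy : IsPure y)
    (hc : ∀ g, Commute y (incl m g)) : ∃ j l : ℤ, y = ι m (inl (P m ^ j) * inr (z m ^ l)) := by
  obtain ⟨v, rfl⟩ : ∃ v, ι m v = y := ⟨_, (eq_ι_of_perm (by rw [hy]; rfl)).symm⟩
  obtain ⟨k, b, rfl⟩ : ∃ k b, v = inl k * inr b := ⟨_, _, (inl_left_mul_inr_right v).symm⟩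
  have hc' : ∀ g, Commute (inl k * inr b) (inr g) := fun g => by
    have := hc g
    rw [← ι_inr] at this
    exact ι_comm_iff.1 this
  have hb : IsPure b := by
    rw [IsPure, perm_ι] at hy
    simpa [IsPure] using hy
  have hk : ∀ g, artin m g k = k := fun g => by
    simpa using congrArg SemidirectProduct.left (hc' g).eq.symm
  obtain ⟨l, rfl⟩ := pure_central hb fun g => show b * g = g * b by
    simpa using congrArg SemidirectProduct.right (hc' g).eq
  obtain ⟨j, rfl⟩ := eq_P_zpow_of_artin_z (hk (z m))
  exact ⟨j, l, rfl⟩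

end BraidGroup

/-! ### Conjugacy in free products of two groups -/

namespace FreeProduct

open Monoid CoprodI

variable {G : Type*} [Group G]

/-- The product of a list of syllables. -/
def pr (L : List (Σ _ : Bool, G)) : CoprodI fun _ : Bool => G :=
  (L.map fun s => of (M := fun _ : Bool => G) (i := s.1) s.2).prod

@[simp] theorem pr_nil : pr ([] : List (Σ _ : Bool, G)) = 1 := rfl
@[simp] theorem pr_cons (s) (L : List (Σ _ : Bool, G)) :
    pr (s :: L) = of (M := fun _ : Bool => G) (i := s.1) s.2 * pr L := by simp [pr]
@[simp] theorem pr_append (L L' : List (Σ _ : Bool, G)) : pr (L ++ L') = pr L * pr L' := by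
  simp [pr]

/-- Reduced lists of syllables. -/
def Red (L : List (Σ _ : Bool, G)) : Prop :=
  (∀ s ∈ L, s.2 ≠ 1) ∧ (L.map Sigma.fst).IsChain (· ≠ ·)

/-- Cyclically reduced lists of syllables. -/
def Cyc (L : List (Σ _ : Bool, G)) : Prop := Red (L ++ L)

theorem pr_injective {L L' : List (Σ _ : Bool, G)} (h : Red L) (h' : Red L')
    (e : pr L = pr L') : L = L' := by
  classical
  let w : Word fun _ : Bool => G := ⟨L, h.1, (List.isChain_map _).1 h.2⟩
  let w' : Word fun _ : Bool => G := ⟨L', h'.1, (List.isChain_map _).1 h'.2⟩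
  exact congrArg Word.toList (Word.equiv.symm.injective (show w.prod = w'.prod from e))

theorem exists_red (w : CoprodI fun _ : Bool => G) : ∃ L, Red L ∧ pr L = w := by
  classical
  let v := Word.equiv w
  exact ⟨v.toList, ⟨v.ne_one, (List.isChain_map _).2 v.chain_ne⟩, Word.equiv.symm_apply_apply w⟩

theorem exists_cyc (L : List (Σ _ : Bool, G)) (hL : Red L) : ∃ g,
    (∃ L', Cyc L' ∧ g * pr L * g⁻¹ = pr L') ∨ ∃ (i : Bool) (h : G), g * pr L * g⁻¹ = of (i := i) h := by
  induction hn : L.length using Nat.strong_induction_on generalizing L with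
  | _ n ih =>
  subst hn
  rcases L with _ | ⟨⟨i, a⟩, L⟩
  · exact ⟨1, .inl ⟨[], by simpa [Cyc] using hL, by simp⟩⟩
  rcases L.eq_nil_or_concat' with rfl | ⟨M, ⟨j, b⟩, rfl⟩
  · exact ⟨1, .inr ⟨i, a, by simp⟩⟩
  by_cases hij : j = i
  · subst hij
    obtain ⟨L', hL', hlt, e⟩ : ∃ L' : List (Σ _ : Bool, G), Red L' ∧ L'.length < M.length + 2 ∧
        of (i := j) b * pr (⟨j, a⟩ :: (M ++ [⟨j, b⟩])) * (of (i := j) b)⁻¹ = pr L' := by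
      have hc := hL.2
      simp only [List.map_cons, List.map_append, List.map_nil, ← List.cons_append] at hc
      have hc' := (List.isChain_append.1 hc).1
      by_cases hba : b * a = 1
      · refine ⟨M, ⟨fun s hs => hL.1 s (by simp [hs]), hc'.tail⟩, by omega, ?_⟩
        have : of (M := fun _ : Bool => G) (i := j) b * of (i := j) a = 1 := by
          rw [← map_mul, hba, map_one]
        simp [← mul_assoc, this]
      · refine ⟨⟨j, b * a⟩ :: M, ⟨?_, by simpa using hc'⟩, by simp, by simp [mul_assoc]⟩
        intro s hs
        rcases List.mem_cons.1 hs with rfl | hs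
        · exact hba
        · exact hL.1 s (by simp [hs])
    obtain ⟨g, h⟩ := ih _ (by simp; omega) L' hL' rfl
    refine ⟨g * of (i := j) b, ?_⟩
    rw [← e] at h
    simpa only [mul_assoc, mul_inv_rev] using h
  · refine ⟨1, .inl ⟨⟨i, a⟩ :: (M ++ [⟨j, b⟩]), ⟨?_, ?_⟩, by simp⟩⟩
    · intro s hs
      exact hL.1 s (by simp at hs ⊢; tauto)
    · have hc := hL.2
      simp only [List.map_cons, List.map_append, List.map_nil, List.cons_append,
        List.append_assoc, List.nil_append] at hc ⊢
      rw [← List.cons_append, List.isChain_append_cons_cons]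
      exact ⟨hc, hij, hc⟩

theorem Cyc.rotate_one {a} {L : List (Σ _ : Bool, G)} (h : Cyc (a :: L)) : Cyc (L ++ [a]) := by
  refine ⟨fun s hs => h.1 s (by simp at hs ⊢; tauto), ?_⟩
  have hc := h.2
  simp only [List.map_cons, List.map_append, List.map_nil, List.cons_append,
    List.append_assoc, List.nil_append] at hc ⊢
  have h2 := (List.isChain_split (l₁ := a.1 :: L.map Sigma.fst)).1 (by simpa using hc)
  exact List.isChain_split.2 ⟨h2.1.tail, by simpa using h2.1⟩

theorem Cyc.rotate {L : List (Σ _ : Bool, G)} (h : Cyc L) : ∀ n, Cyc (L.rotate n)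
  | 0 => by simpa
  | n + 1 => by
    rw [← List.rotate_rotate]
    have := h.rotate n
    generalize L.rotate n = M at this ⊢
    rcases M with _ | ⟨a, M⟩
    · simpa using this
    · simpa using this.rotate_one

theorem not_cyc {p q} {L : List (Σ _ : Bool, G)} (h : p.1 = q.1) : ¬ Cyc (p :: (L ++ [q])) := by
  intro hc
  have hc := hc.2
  simp only [List.map_cons, List.map_append, List.map_nil, List.cons_append,
    List.append_assoc, List.nil_append] at hc
  rw [← List.cons_append, List.isChain_append_cons_cons] at hc
  exact hc.2.1 h.symm

/-- Conjugating a cyclically reduced list by a syllable. -/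
theorem Cyc.conj {L : List (Σ _ : Bool, G)} (h : Cyc L) (hL : L ≠ []) (i : Bool) {s : G}
    (hs : s ≠ 1) :
    (∃ n, of (i := i) s * pr L * (of (i := i) s)⁻¹ = pr (L.rotate n)) ∨
    ∃ x y Q, of (i := i) s * pr L * (of (i := i) s)⁻¹ = pr (⟨i, x⟩ :: (Q ++ [⟨i, y⟩])) ∧
      Red (⟨i, x⟩ :: (Q ++ [⟨i, y⟩])) := by
  rcases L with _ | ⟨⟨j, a⟩, T⟩
  · exact absurd rfl hL
  rcases T.eq_nil_or_concat' with rfl | ⟨M, ⟨k, b⟩, rfl⟩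
  · exact absurd h (fun h => by simpa using h.2)
  have hjk : j ≠ k := fun e => not_cyc e h
  by_cases hij : i = j
  · subst hij
    by_cases hsa : s * a = 1
    · left
      refine ⟨1, ?_⟩
      obtain rfl : s = a⁻¹ := eq_inv_of_mul_eq_one_left hsa
      simp [mul_assoc]
    · right
      refine ⟨s * a, s⁻¹, M ++ [⟨k, b⟩], by simp [mul_assoc], ?_, ?_⟩
      · intro t ht
        simp only [List.mem_cons, List.mem_append, List.not_mem_nil, or_false] at ht
        rcases ht with rfl | (ht | rfl) | rfl
        · exact hsa
        · exact h.1 t (by simp [ht])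
        · exact h.1 _ (by simp)
        · simpa using hs
      · have hc := h.2
        simp only [List.map_cons, List.map_append, List.map_nil, List.cons_append,
          List.append_assoc, List.nil_append] at hc ⊢
        rw [← List.cons_append, List.isChain_append_cons_cons] at hc ⊢
        exact ⟨hc.1, hc.2.1, by simp⟩
  · obtain rfl : i = k := by
      revert hij hjk; cases i <;> cases j <;> cases k <;> simp
    by_cases hsb : b * s⁻¹ = 1
    · left
      obtain rfl : s = b := (mul_inv_eq_one.1 hsb).symm
      refine ⟨M.length + 1, ?_⟩
      have : (⟨j, a⟩ :: (M ++ [⟨i, s⟩])).rotate (M.length + 1) = ⟨i, s⟩ :: ⟨j, a⟩ :: M := by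
        simp
      rw [this]
      simp [mul_assoc]
    · right
      refine ⟨s, b * s⁻¹, ⟨j, a⟩ :: M, by simp [mul_assoc], ?_, ?_⟩
      · intro t ht
        simp only [List.mem_cons, List.mem_append, List.not_mem_nil, or_false] at ht
        rcases ht with rfl | (rfl | ht) | rfl
        · exact hs
        · exact h.1 _ (by simp)
        · exact h.1 t (by simp [ht])
        · exact hsb
      · have hc := h.2
        simp only [List.map_cons, List.map_append, List.map_nil, List.cons_append,
          List.append_assoc, List.nil_append] at hc ⊢
        rw [← List.cons_append, List.isChain_append_cons_cons] at hc
        exact List.isChain_cons_cons.2 ⟨hij, by simpa using hc.1⟩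

/-- Conjugate cyclically reduced lists are rotations of each other. -/
theorem Cyc.isRotated {L L' : List (Σ _ : Bool, G)} (h : Cyc L) (h' : Cyc L')
    {g : CoprodI fun _ : Bool => G} (e : g * pr L * g⁻¹ = pr L') : L ~r L' := by
  have hred : ∀ {L : List (Σ _ : Bool, G)}, Cyc L → Red L := fun h =>
    ⟨fun s hs => h.1 s (by simp [hs]), by
      have := h.2
      rw [List.map_append] at this
      exact (List.isChain_append.1 this).1⟩
  by_cases hL : L = []
  · subst hL
    rw [pr_injective (hred h') (hred h) (by simpa using e.symm)]
  obtain ⟨K, hK, rfl⟩ := exists_red g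
  induction K using List.reverseRecOn generalizing L with
  | nil =>
    rw [pr_injective (hred h) (hred h') (by simpa using e)]
  | append_singleton K s ih =>
    obtain ⟨i, s⟩ := s
    have hs : s ≠ 1 := hK.1 ⟨i, s⟩ (by simp)
    have hc := hK.2
    rw [List.map_append] at hc
    have hK' : Red K := ⟨fun t ht => hK.1 t (by simp [ht]), (List.isChain_append.1 hc).1⟩
    have e' : pr K * (of (i := i) s * pr L * (of (i := i) s)⁻¹) * (pr K)⁻¹ = pr L' := by
      rw [← e]
      simp [mul_assoc]
    rcases h.conj hL i hs with ⟨n, hn⟩ | ⟨x, y, Q, hQ, hred'⟩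
    · rw [hn] at e'
      exact (List.IsRotated.forall L n).symm.trans (ih (h.rotate n) (by simpa using hL) hK' e')
    · rw [hQ] at e'
      let inv : List (Σ _ : Bool, G) := (K.map fun t => ⟨t.1, t.2⁻¹⟩).reverse
      have hinv : pr inv = (pr K)⁻¹ := by
        simp only [inv, pr, List.map_reverse, List.map_map, List.prod_inv_reverse]
        congr 3
      have hfst : inv.map Sigma.fst = (K.map Sigma.fst).reverse := by
        simp [inv, Function.comp_def]
      have key : K ++ (⟨i, x⟩ :: (Q ++ [⟨i, y⟩])) ++ inv = L' := by
        refine pr_injective ⟨?_, ?_⟩ (hred h') ?_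
        · intro t ht
          rcases List.mem_append.1 ht with ht | ht
          · rcases List.mem_append.1 ht with ht | ht
            · exact hK'.1 t ht
            · exact hred'.1 t ht
          · obtain ⟨u, hu, rfl⟩ := List.mem_map.1 (List.mem_reverse.1 ht)
            simpa using hK'.1 u hu
        · have h2 := hred'.2
          simp only [List.map_cons, List.map_append, List.map_nil, hfst, List.append_assoc,
            List.cons_append, List.nil_append] at h2 hc ⊢
          rw [List.isChain_split]
          refine ⟨hc, ?_⟩
          rw [← List.cons_append, List.isChain_split]
          refine ⟨h2, ?_⟩
          have : (i :: (K.map Sigma.fst).reverse) = (K.map Sigma.fst ++ [i]).reverse := by simp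
          rw [this, List.isChain_reverse]
          exact hc.imp fun _ _ => Ne.symm
        · rw [pr_append, pr_append, hinv, e']
      exfalso
      rcases K with _ | ⟨k, K⟩
      · exact not_cyc (p := ⟨i, x⟩) (q := ⟨i, y⟩) rfl (by simpa [inv, ← key] using h')
      · refine not_cyc (p := k) (q := ⟨k.1, k.2⁻¹⟩) rfl (L := K ++ (⟨i, x⟩ :: (Q ++ [⟨i, y⟩])) ++
          (K.map fun t => ⟨t.1, t.2⁻¹⟩).reverse) ?_
        simpa [inv, ← key] using h'

/-- The automorphism of the free product induced by automorphisms of the factors. -/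
def act (a : Bool → MulAut G) : (CoprodI fun _ : Bool => G) →* CoprodI fun _ : Bool => G :=
  CoprodI.lift fun i => (of (i := i)).comp (a i).toMonoidHom

/-- The action on syllables. -/
def actS (a : Bool → MulAut G) (s : Σ _ : Bool, G) : Σ _ : Bool, G := ⟨s.1, a s.1 s.2⟩

theorem act_pr (a : Bool → MulAut G) (L : List (Σ _ : Bool, G)) :
    act a (pr L) = pr (L.map (actS a)) := by
  induction L with
  | nil => simp
  | cons s L ih =>
    rw [pr_cons, map_mul, ih, List.map_cons, pr_cons]
    simp [act, actS]

theorem Red.map {L : List (Σ _ : Bool, G)} (h : Red L) (a : Bool → MulAut G) :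
    Red (L.map (actS a)) := by
  refine ⟨fun s hs => ?_, by simpa [actS, Function.comp_def] using h.2⟩
  obtain ⟨t, ht, rfl⟩ := List.mem_map.1 hs
  simpa [actS] using h.1 t ht

theorem fixed_of_act_eq {a : Bool → MulAut G} {L : List (Σ _ : Bool, G)} (h : Red L)
    (e : act a (pr L) = pr L) : ∀ s ∈ L, a s.1 s.2 = s.2 := by
  rw [act_pr] at e
  have := pr_injective (h.map a) h e
  intro s hs
  have := List.map_inj_left.1 (this.trans (List.map_id L).symm) s hs
  exact eq_of_heq (Sigma.mk.inj this).2

/-- If an automorphism preserving the factors maps a cyclically reduced element to a conjugate,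
then a power of it fixes all the syllables. -/
theorem exists_fixed_of_conj {a : Bool → MulAut G} {L : List (Σ _ : Bool, G)} (h : Cyc L)
    {g : CoprodI fun _ : Bool => G} (e : act a (pr L) = g * pr L * g⁻¹) :
    ∀ s ∈ L, (a s.1 ^ L.length) s.2 = s.2 := by
  rw [act_pr] at e
  have h2 : Cyc (L.map (actS a)) := by
    have := Red.map h a
    rwa [List.map_append] at this
  obtain ⟨n, hn⟩ := h.isRotated h2 e.symm
  have h3 : ∀ N, L.map ((actS a)^[N]) = L.rotate (n * N) := by
    intro N
    induction N with
    | zero => simp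
    | succ N ih =>
      rw [Function.iterate_succ', ← List.map_map, ih, List.map_rotate, ← hn,
        List.rotate_rotate, mul_add, mul_one, add_comm]
  have h4 := h3 L.length
  rw [mul_comm, List.rotate_length_mul] at h4
  intro s hs
  have h5 := List.map_inj_left.1 (h4.trans (List.map_id L).symm) s hs
  have h6 : ∀ N, (actS a)^[N] s = ⟨s.1, (a s.1 ^ N) s.2⟩ := by
    intro N
    induction N with
    | zero => rfl
    | succ N ih => rw [Function.iterate_succ_apply', ih, pow_succ']; rfl
  rw [h6] at h5
  exact eq_of_heq (Sigma.mk.inj h5).2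

end FreeProduct

namespace BraidGroup

open SemidirectProduct Monoid

variable {m : ℕ}

/-- The inclusion of the free group on the first `k` generators. -/
def Femb (k : ℕ) : F k →* F (k + 1) := flift fun i => X (k + 1) i

theorem Femb_X {k i : ℕ} (h : i < k) : Femb k (X k i) = X (k + 1) i := flift_X h

theorem Femb_bp {k n : ℕ} (h : n ≤ k) : Femb k (bp k n) = bp (k + 1) n := by
  induction n with
  | zero => simp [bp]
  | succ n ih => rw [bp_succ, map_mul, ih (by omega), Femb_X (by omega), bp_succ]

theorem P_succ : P (m + 1) = Femb (m + 1) (P m) * X (m + 2) (m + 1) := by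
  rw [P, P, Femb_bp le_rfl, bp_succ]

theorem artin_incl_Femb (g : BraidGroup m) (f : F (m + 1)) :
    artin (m + 1) (incl m g) (Femb (m + 1) f) = Femb (m + 1) (artin m g f) := by
  let S : Subgroup (BraidGroup m) :=
    { carrier := {g | ∀ f, artin (m + 1) (incl m g) (Femb (m + 1) f) = Femb (m + 1) (artin m g f)}
      one_mem' := fun f => by simp
      mul_mem' := fun {a b} ha hb f => by
        simp only [Set.mem_ofPred_eq] at ha hb
        simp [ha, hb]
      inv_mem' := fun {a} ha f => by
        simp only [Set.mem_ofPred_eq] at ha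
        rw [map_inv, map_inv, map_inv, MulAut.inv_apply, MulEquiv.symm_apply_eq, ha,
          MulAut.inv_apply, MulEquiv.apply_symm_apply] }
  refine mem_of_σ_mem (S := S) (fun i hi f => ?_) g f
  refine DFunLike.congr_fun
    (f := (artin (m + 1) (incl m (σ m i))).toMonoidHom.comp (Femb (m + 1)))
    (g := (Femb (m + 1)).comp (artin m (σ m i)).toMonoidHom) (fhom_ext fun j hj => ?_) f
  simp only [MonoidHom.comp_apply, MulEquiv.toMonoidHom_eq_coe, MonoidHom.coe_coe, Femb_X hj,
    incl_σ hi]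
  by_cases h1 : j = i
  · subst h1
    rw [artin_X_self hi, artin_X_self (by omega), Femb_X (by omega)]
  by_cases h2 : j = i + 1
  · subst h2
    rw [artin_X_succ hi, artin_X_succ (by omega)]
    simp [Femb_X hj, Femb_X (show i < m + 1 by omega)]
  · rw [artin_X_ne hi (by omega) h1 h2, artin_X_ne (by omega) (by omega) h1 h2, Femb_X hj]

theorem artin_incl_last (g : BraidGroup m) :
    artin (m + 1) (incl m g) (X (m + 2) (m + 1)) = X (m + 2) (m + 1) := by
  let S : Subgroup (BraidGroup m) := (MulAction.stabilizer (MulAut (F (m + 2)))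
    (X (m + 2) (m + 1))).comap ((artin (m + 1)).comp (incl m))
  refine mem_of_σ_mem (S := S) (fun i hi => ?_) g
  show artin (m + 1) (incl m (σ m i)) _ = _
  rw [incl_σ hi, artin_X_ne] <;> omega

/-- The free group generated by the product of the first `m + 1` generators and the last one. -/
def μ (m : ℕ) : F 2 →* F (m + 2) :=
  flift fun i => if i = 0 then Femb (m + 1) (P m) else X (m + 2) (m + 1)

theorem μ_zero : μ m (X 2 0) = Femb (m + 1) (P m) := flift_X (by omega)
theorem μ_one : μ m (X 2 1) = X (m + 2) (m + 1) := flift_X (by omega)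

/-- The embedding into the free product of two copies of the free group. -/
def Θ (m : ℕ) : F (m + 2) →* CoprodI fun _ : Bool => F (m + 2) :=
  flift fun i => CoprodI.of (i := decide (i = m + 1)) (X (m + 2) i)

/-- The retraction of the free group onto one of its two factors. -/
def Rfac (m : ℕ) (i : Bool) : F (m + 2) →* F (m + 2) :=
  flift fun j => if decide (j = m + 1) = i then X (m + 2) j else 1

/-- The retraction of the free product. -/
def Rret (m : ℕ) : (CoprodI fun _ : Bool => F (m + 2)) →* F (m + 2) :=
  CoprodI.lift (Rfac m)

theorem Rret_of (i : Bool) (f : F (m + 2)) : Rret m (CoprodI.of (i := i) f) = Rfac m i f :=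
  CoprodI.lift_of ..

theorem Rret_Θ (f : F (m + 2)) : Rret m (Θ m f) = f := by
  refine DFunLike.congr_fun (f := (Rret m).comp (Θ m)) (g := MonoidHom.id _)
    (fhom_ext fun i hi => ?_) f
  simp [Θ, flift_X hi, Rret_of, Rfac]

theorem Θ_Femb (f : F (m + 1)) : Θ m (Femb (m + 1) f) =
    CoprodI.of (i := false) (Femb (m + 1) f) := by
  refine DFunLike.congr_fun (f := (Θ m).comp (Femb (m + 1)))
    (g := (CoprodI.of (M := fun _ : Bool => F (m + 2)) (i := false)).comp (Femb (m + 1)))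
    (fhom_ext fun i hi => ?_) f
  have : i ≠ m + 1 := by omega
  simp [Θ, Femb_X hi, flift_X (show i < m + 2 by omega), this]

theorem Rfac_Femb (f : F (m + 1)) : Rfac m false (Femb (m + 1) f) = Femb (m + 1) f := by
  refine DFunLike.congr_fun (f := (Rfac m false).comp (Femb (m + 1))) (g := Femb (m + 1))
    (fhom_ext fun i hi => ?_) f
  have : i ≠ m + 1 := by omega
  simp [Rfac, Femb_X hi, flift_X (show i < m + 2 by omega), this]

theorem ab_Rfac_false (f : F (m + 2)) : ab (Rfac m false f) (m + 1) = 0 := by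
  have : (abHom (m + 2) (m + 1)).comp (Rfac m false) = 1 := fhom_ext fun i hi => by
    rw [MonoidHom.comp_apply, Rfac, flift_X hi]
    split_ifs with h
    · have : i ≠ m + 1 := by simpa using h
      rw [abHom, flift_X hi, if_neg this]; rfl
    · simp
  rw [ab]
  exact congrArg Multiplicative.toAdd (DFunLike.congr_fun this f)

theorem Rfac_true_mem (f : F (m + 2)) : Rfac m true f ∈ (μ m).range := by
  refine mem_of_X_mem (S := (μ m).range.comap (Rfac m true)) (fun i hi => ?_) f
  rw [Subgroup.mem_comap, Rfac, flift_X hi]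
  split_ifs with h
  · obtain rfl : i = m + 1 := by simpa using h
    exact ⟨_, μ_one⟩
  · exact one_mem _

/-- The twist on the free product corresponding to the full twist on all strands but the last. -/
def twist (m : ℕ) (i : Bool) : MulAut (F (m + 2)) :=
  if i then 1 else MulAut.conj (Femb (m + 1) (P m))⁻¹

theorem Θ_artin (f : F (m + 2)) :
    Θ m (artin (m + 1) (incl m (z m)) f) = FreeProduct.act (twist m) (Θ m f) := by
  refine DFunLike.congr_fun (f := (Θ m).comp (artin (m + 1) (incl m (z m))).toMonoidHom)
    (g := (FreeProduct.act (twist m)).comp (Θ m)) (fhom_ext fun i hi => ?_) f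
  simp only [MonoidHom.comp_apply, MulEquiv.toMonoidHom_eq_coe, MonoidHom.coe_coe]
  rcases Nat.lt_succ_iff_lt_or_eq.1 hi with hi | rfl
  · rw [← Femb_X hi, artin_incl_Femb, Θ_Femb, Θ_Femb, artin_z]
    simp [FreeProduct.act, twist]
  · rw [artin_incl_last]
    simp [Θ, flift_X, FreeProduct.act, twist]

theorem Rret_pr_mem {L : List (Σ _ : Bool, F (m + 2))} {N : ℕ} (hN : N ≠ 0)
    (h : ∀ s ∈ L, (twist m s.1 ^ N) s.2 = s.2) : Rret m (FreeProduct.pr L) ∈ (μ m).range := by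
  induction L with
  | nil => simp
  | cons s L ih =>
    rw [FreeProduct.pr_cons, map_mul, Rret_of]
    refine mul_mem ?_ (ih fun t ht => h t (by simp [ht]))
    have hs := h s (by simp)
    rcases s with ⟨_ | _, f⟩
    · simp only [twist, if_neg Bool.false_ne_true, ← map_pow, MulAut.conj_apply] at hs
      have : Commute f (Femb (m + 1) (P m)) := by
        refine commute_of_commute_zpow (r := N) (by exact_mod_cast hN) ?_
        rw [inv_pow, inv_inv, mul_assoc, inv_mul_eq_iff_eq_mul] at hs
        rw [zpow_natCast]
        exact hs
      obtain ⟨i, rfl⟩ := exists_eq_zpow_of_commute (j := 0) (by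
        rw [P, Femb_bp le_rfl, ab_bp (by omega)]; simp) this
      rw [map_zpow, Rfac_Femb, ← μ_zero, ← map_zpow]
      exact ⟨_, rfl⟩
    · exact Rfac_true_mem f

/-- The elements fixed by the full twist on all strands but the last. -/
theorem mem_range_μ_of_fixed {f : F (m + 2)} (h : artin (m + 1) (incl m (z m)) f = f) :
    ∃ u, f = μ m u := by
  obtain ⟨L, hL, e⟩ := FreeProduct.exists_red (Θ m f)
  have := FreeProduct.fixed_of_act_eq (a := twist m) hL (by rw [e, ← Θ_artin, h])
  obtain ⟨u, hu⟩ := Rret_pr_mem (m := m) (N := 1) one_ne_zero (L := L) (by simpa using this)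
  exact ⟨u, by rw [hu, e, Rret_Θ]⟩

/-- The elements mapped to a conjugate by the full twist on all strands but the last. -/
theorem conj_mem_range_μ {f g : F (m + 2)} (h : artin (m + 1) (incl m (z m)) f = g * f * g⁻¹)
    (hf : ab f (m + 1) ≠ 0) : ∃ k u, f = k * μ m u * k⁻¹ := by
  obtain ⟨L, hL, e⟩ := FreeProduct.exists_red (Θ m f)
  obtain ⟨k, ⟨M, hM, hk⟩ | ⟨i, a, hk⟩⟩ := FreeProduct.exists_cyc L hL
  · have hE : FreeProduct.act (twist m) (Θ m f) = Θ m (g * f * g⁻¹) := by rw [← Θ_artin, h]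
    have := FreeProduct.exists_fixed_of_conj (a := twist m) hM
      (g := FreeProduct.act (twist m) k * Θ m g * k⁻¹) (by
        rw [← hk, e]
        simp only [map_mul, map_inv, hE]
        group)
    rcases eq_or_ne M.length 0 with h0 | h0
    · rw [List.length_eq_zero_iff.1 h0, e] at hk
      have : f = 1 := by
        rw [← Rret_Θ f, (by simpa using hk : Θ m f = 1), map_one]
      simp [this] at hf
    obtain ⟨u, hu⟩ := Rret_pr_mem h0 this
    refine ⟨(Rret m k)⁻¹, u, ?_⟩
    rw [hu, ← hk, e]
    simp only [map_mul, map_inv, Rret_Θ]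
    group
  · have h1 : f = (Rret m k)⁻¹ * Rfac m i a * Rret m k := by
      rw [← Rret_of, ← hk, e]
      simp only [map_mul, map_inv, Rret_Θ]
      group
    rcases i with _ | _
    · have := ab_Rfac_false a
      rw [h1] at hf
      simp [this] at hf
    · obtain ⟨u, hu⟩ := Rfac_true_mem a
      exact ⟨(Rret m k)⁻¹, u, by rw [hu, inv_inv]; exact h1⟩

end BraidGroup

namespace BraidGroup

open SemidirectProduct

variable {m : ℕ}

/-! ### Crossing numbers -/

/-- The number of crossings of two strands in a generator. -/
def crGen (i : ℕ) (p : ℕ × ℕ) : Multiplicative ℤ :=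
  if (p.1 = i ∧ p.2 = i + 1) ∨ (p.1 = i + 1 ∧ p.2 = i) then Multiplicative.ofAdd 1 else 1

theorem crGen_swap {i j : ℕ} (h : i + 2 ≤ j ∨ j + 2 ≤ i) (a b : ℕ) :
    crGen i (Equiv.swap j (j + 1) a, Equiv.swap j (j + 1) b) = crGen i (a, b) := by
  have key : ∀ c, (Equiv.swap j (j + 1) c = i ↔ c = i) ∧
      (Equiv.swap j (j + 1) c = i + 1 ↔ c = i + 1) := fun c => by
    rw [Equiv.swap_apply_def]; split_ifs <;> constructor <;> omega
  simp only [crGen, (key _).1, (key _).2]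

/-- The cocycle counting the crossings of pairs of strands. -/
def crHom (m : ℕ) : BraidGroup m →* Wreath (ℕ × ℕ) (Multiplicative ℤ) :=
  lift (fun i => ⟨crGen i, (Equiv.swap i (i + 1)).prodCongr (Equiv.swap i (i + 1))⟩)
    (fun i hi => by
      refine Wreath.ext (funext fun ⟨a, b⟩ => ?_) (Equiv.ext fun ⟨a, b⟩ => ?_)
      · simp only [Wreath.mul_fn, Wreath.mul_pm, Equiv.Perm.mul_apply, Equiv.prodCongr_apply,
          Prod.map_apply, crGen, Equiv.swap_apply_def]
        grind
      · simp only [Wreath.mul_pm, Equiv.Perm.mul_apply, Equiv.prodCongr_apply,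
          Prod.map_apply, Equiv.swap_apply_def]
        grind)
    (fun i j h _ => by
      refine Wreath.ext (funext fun ⟨a, b⟩ => ?_) (Equiv.ext fun ⟨a, b⟩ => ?_)
      · simp only [Wreath.mul_fn, Equiv.prodCongr_apply, Prod.map_apply]
        rw [crGen_swap (.inl h), crGen_swap (.inr h), mul_comm]
      · simp only [Wreath.mul_pm, Equiv.Perm.mul_apply, Equiv.prodCongr_apply,
          Prod.map_apply, Equiv.swap_apply_def]
        refine Prod.ext ?_ ?_ <;> grind)

theorem crHom_pm (g : BraidGroup m) : (crHom m g).pm = (perm m g).prodCongr (perm m g) := by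
  let φ : Equiv.Perm ℕ →* Equiv.Perm (ℕ × ℕ) :=
    { toFun := fun s => s.prodCongr s
      map_one' := by ext <;> rfl
      map_mul' := fun s t => by ext <;> rfl }
  have : Wreath.pmHom.comp (crHom m) = φ.comp (perm m) := hom_ext fun i hi => by
    rw [MonoidHom.comp_apply, MonoidHom.comp_apply, perm_σ hi, crHom, lift_σ hi]
    rfl
  exact DFunLike.congr_fun this g

/-- The number of crossings of the strands starting at `a` and `b`. -/
def cr (g : BraidGroup m) (a b : ℕ) : ℤ := ((crHom m g).fn (a, b)).toAdd

theorem cr_mul (g h : BraidGroup m) (a b : ℕ) :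
    cr (g * h) a b = cr g (perm m h a) (perm m h b) + cr h a b := by
  simp [cr, crHom_pm]

@[simp] theorem cr_one (a b : ℕ) : cr (1 : BraidGroup m) a b = 0 := by simp [cr]

theorem cr_inv (g : BraidGroup m) (a b : ℕ) :
    cr g⁻¹ a b = -cr g ((perm m g)⁻¹ a) ((perm m g)⁻¹ b) := by
  have := cr_mul g g⁻¹ a b
  rw [mul_inv_cancel, cr_one, map_inv] at this
  omega

theorem cr_σ {i : ℕ} (h : i < m) (a b : ℕ) :
    cr (σ m i) a b = if (a = i ∧ b = i + 1) ∨ (a = i + 1 ∧ b = i) then 1 else 0 := by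
  rw [cr, crHom, lift_σ h]
  simp only [crGen]
  split_ifs <;> rfl

theorem cr_mul_pure (g : BraidGroup m) {h : BraidGroup m} (hh : IsPure h) (a b : ℕ) :
    cr (g * h) a b = cr g a b + cr h a b := by
  rw [cr_mul, hh]; rfl

theorem cr_zpow_pure {g : BraidGroup m} (hg : IsPure g) (n : ℤ) (a b : ℕ) :
    cr (g ^ n) a b = n * cr g a b := by
  induction n using Int.induction_on with
  | zero => simp
  | succ n ih => rw [zpow_add_one, cr_mul_pure _ hg, ih]; ring
  | pred n ih =>
    have := cr_mul_pure (g ^ (-(n : ℤ) - 1)) hg a b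
    rw [← zpow_add_one, sub_add_cancel, ih] at this
    linarith

theorem cr_conj {g v : BraidGroup m} (hv : IsPure v) (a b : ℕ) :
    cr (g * v * g⁻¹) (perm m g a) (perm m g b) = cr v a b := by
  rw [cr_mul, cr_inv, map_inv, cr_mul_pure _ hv]
  simp

theorem IsPure.conj {v : BraidGroup m} (hv : IsPure v) (g : BraidGroup m) :
    IsPure (g * v * g⁻¹) := by
  rw [IsPure] at hv ⊢
  simp [hv]

theorem IsPure.mul {v w : BraidGroup m} (hv : IsPure v) (hw : IsPure w) : IsPure (v * w) := by
  rw [IsPure] at hv hw ⊢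
  simp [hv, hw]

theorem IsPure.inv {v : BraidGroup m} (hv : IsPure v) : IsPure v⁻¹ := by
  rw [IsPure] at hv ⊢
  simp [hv]

theorem IsPure.zpow {v : BraidGroup m} (hv : IsPure v) (n : ℤ) : IsPure (v ^ n) := by
  rw [IsPure] at hv ⊢
  simp [hv]

theorem isPure_σ_sq {i : ℕ} : IsPure (σ m i ^ 2) := by
  rcases lt_or_ge i m with h | h
  · rw [IsPure, map_pow, perm_σ h, pow_two, Equiv.swap_mul_self]
  · rw [σ_of_le h, one_pow, IsPure, map_one]

theorem cr_σ_sq {i : ℕ} (h : i < m) (a b : ℕ) :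
    cr (σ m i ^ 2) a b = if (a = i ∧ b = i + 1) ∨ (a = i + 1 ∧ b = i) then 2 else 0 := by
  rw [pow_two, cr_mul, perm_σ h, cr_σ h, cr_σ h]
  simp only [Equiv.swap_apply_def]
  grind

theorem cr_symm (g : BraidGroup m) (a b : ℕ) : cr g a b = cr g b a := by
  let S : Subgroup (BraidGroup m) :=
    { carrier := {g | ∀ a b, cr g a b = cr g b a}
      one_mem' := by simp
      mul_mem' := fun {g h} hg hh a b => by rw [cr_mul, cr_mul, hg, hh]
      inv_mem' := fun {g} hg a b => by rw [cr_inv, cr_inv, hg] }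
  refine mem_of_σ_mem (S := S) (fun i hi a b => ?_) g a b
  rw [cr_σ hi, cr_σ hi]
  grind

/-- The strands outside of the braid do not cross. -/
theorem cr_of_gt (g : BraidGroup m) {a b : ℕ} (h : m < b ∨ a = b) : cr g a b = 0 := by
  let S : Subgroup (BraidGroup m) :=
    { carrier := {g | ∀ a b, m < b ∨ a = b → cr g a b = 0}
      one_mem' := by simp
      mul_mem' := fun {g h} hg hh a b hab => by
        rw [cr_mul, hh a b hab, hg, add_zero]
        rcases hab with hab | rfl
        · exact .inl (by rwa [perm_of_gt _ hab])
        · exact .inr rfl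
      inv_mem' := fun {g} hg a b hab => by
        rw [cr_inv, hg, neg_zero]
        rcases hab with hab | rfl
        · exact .inl (by rwa [← map_inv, perm_of_gt _ hab])
        · exact .inr rfl }
  refine mem_of_σ_mem (S := S) (fun i hi a b h => ?_) g a b h
  rw [cr_σ hi, if_neg (by omega)]

theorem cr_ext {g h : BraidGroup m} (e : ∀ a b, a < b → b ≤ m → cr g a b = cr h a b) (a b : ℕ) :
    cr g a b = cr h a b := by
  wlog hab : a ≤ b generalizing a b
  · rw [cr_symm g, cr_symm h]
    exact this b a (by omega)
  rcases hab.eq_or_lt with rfl | hab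
  · rw [cr_of_gt _ (.inr rfl), cr_of_gt _ (.inr rfl)]
  · rcases lt_or_ge m b with hb | hb
    · rw [cr_of_gt _ (.inl hb), cr_of_gt _ (.inl hb)]
    · exact e a b hab hb

/-- The parity of the number of crossings tells whether two strands exchange their order. -/
theorem even_cr_iff (g : BraidGroup m) {a b : ℕ} (h : a ≠ b) :
    Even (cr g a b) ↔ (a < b ↔ perm m g a < perm m g b) := by
  let S : Subgroup (BraidGroup m) :=
    { carrier := {g | ∀ a b, a ≠ b → (Even (cr g a b) ↔ (a < b ↔ perm m g a < perm m g b))}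
      one_mem' := by simp
      mul_mem' := fun {g h} hg hh a b hab => by
        rw [cr_mul, Int.even_add, hh a b hab, hg _ _ ((perm m h).injective.ne hab), map_mul,
          Equiv.Perm.mul_apply, Equiv.Perm.mul_apply]
        tauto
      inv_mem' := fun {g} hg a b hab => by
        rw [cr_inv, even_neg, hg _ _ ((perm m g)⁻¹.injective.ne hab), map_inv]
        have e : ∀ c, perm m g ((perm m g)⁻¹ c) = c := fun c => by simp
        rw [e, e]
        tauto }
  refine mem_of_σ_mem (S := S) (fun i hi a b h => ?_) g a b h
  rw [cr_σ hi, perm_σ hi]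
  simp only [Equiv.swap_apply_def]
  split_ifs <;> first | omega | simp <;> omega

theorem cr_ι (v : A m) {a b : ℕ} (ha : a ≤ m) (hb : b ≤ m) :
    cr (ι m v) a b = cr v.right a b := by
  let S : Subgroup (A m) :=
    { carrier := {v | ∀ a b, a ≤ m → b ≤ m → cr (ι m v) a b = cr v.right a b}
      one_mem' := by simp
      mul_mem' := fun {v w} hv hw a b ha hb => by
        rw [map_mul, cr_mul, perm_ι, mul_right, cr_mul, hw a b ha hb,
          hv _ _ (perm_le _ ha) (perm_le _ hb)]
      inv_mem' := fun {v} hv a b ha hb => by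
        rw [map_inv, cr_inv, perm_ι, inv_right, cr_inv, ← map_inv,
          hv _ _ (perm_le _ ha) (perm_le _ hb)] }
  refine A_mem_of_mem_last (S := S) (fun i hi a b ha hb => ?_) (fun a b ha hb => ?_) v a b ha hb
  · rw [ι_τ hi, cr_σ (by omega), right_inr, cr_σ hi]
  · rw [ι_ξ le_rfl, bX_self, cr_σ_sq (by omega), right_inl, cr_one, if_neg (by omega)]

theorem cr_incl (g : BraidGroup m) (a b : ℕ) : cr (incl m g) a b = cr g a b := by
  let S : Subgroup (BraidGroup m) :=
    { carrier := {g | ∀ a b, cr (incl m g) a b = cr g a b}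
      one_mem' := by simp
      mul_mem' := fun {g h} hg hh a b => by rw [map_mul, cr_mul, cr_mul, hg, hh, perm_incl]
      inv_mem' := fun {g} hg a b => by rw [map_inv, cr_inv, cr_inv, hg, perm_incl] }
  exact mem_of_σ_mem (S := S) (fun i hi a b => by
    rw [incl_σ hi, cr_σ (by omega), cr_σ hi]) g a b

theorem isPure_ιF (f : F (m + 1)) : IsPure (ιF m f) := by
  rw [IsPure, ← ι_inl, perm_ι, right_inl, map_one]

theorem cr_ιF (f : F (m + 1)) {j : ℕ} (hj : j ≤ m) : cr (ιF m f) j (m + 1) = 2 * ab f j := by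
  let S : Subgroup (F (m + 1)) :=
    { carrier := {f | ∀ j ≤ m, cr (ιF m f) j (m + 1) = 2 * ab f j}
      one_mem' := by simp
      mul_mem' := fun {f g} hf hg j hj => by
        rw [map_mul, cr_mul_pure _ (isPure_ιF g), hf j hj, hg j hj, ab_mul]; ring
      inv_mem' := fun {f} hf j hj => by
        have := isPure_ιF f
        rw [IsPure] at this
        rw [map_inv, cr_inv, this, ab_inv, inv_one, Equiv.Perm.one_apply, Equiv.Perm.one_apply,
          hf j hj]
        ring }
  refine mem_of_X_mem (S := S) (fun i hi => ?_) f j hj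
  induction hk : m - i generalizing i with
  | zero =>
    obtain rfl : i = m := by omega
    intro j hj
    rw [ιF_X le_rfl, bX_self, cr_σ_sq (by omega), ab_X (by omega)]
    grind
  | succ k ih =>
    intro j hj
    have h1 := ih (i + 1) (by omega) (by omega)
    have hσ := ιF_artin (σ m i) (X (m + 1) i)
    rw [artin_X_self (by omega), incl_σ (by omega)] at hσ
    have h2 := cr_conj (g := σ (m + 1) i) (isPure_ιF (X (m + 1) i)) j (m + 1)
    rw [← hσ, perm_σ (by omega),
      Equiv.swap_apply_of_ne_of_ne (a := i) (b := i + 1) (x := m + 1) (by omega) (by omega)] at h2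
    rw [← h2, h1 _ (by rw [Equiv.swap_apply_def]; split_ifs <;> omega), ab_X (by omega),
      ab_X (by omega), Equiv.swap_apply_def]
    grind

theorem cr_ι_last (v : A m) {j : ℕ} (hj : j ≤ m) :
    cr (ι m v) j (m + 1) = 2 * ab v.left (perm m v.right j) := by
  conv_lhs => rw [← inl_left_mul_inr_right v, map_mul, ι_inl, ι_inr]
  rw [cr_mul, perm_incl, perm_of_gt _ (Nat.lt_succ_self m), cr_ιF _ (perm_le _ hj), cr_incl,
    cr_of_gt _ (.inl (by omega)), add_zero]

theorem cr_z {a b : ℕ} (hab : a < b) (hb : b ≤ m) : cr (z m) a b = 2 := by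
  induction m with
  | zero => omega
  | succ m ih =>
    rcases hb.lt_or_eq with hb | rfl
    · rw [z, cr_ι _ (by omega) (by omega)]
      simpa using ih (by omega)
    · rw [z, cr_ι_last _ (by omega)]
      have := isPure_z m
      rw [IsPure] at this
      simp [this, ab_P (show a ≤ m by omega)]

/-- The pure braid group is normally generated by the square of a generator. -/
theorem IsPure.mem_of_normal : ∀ {m : ℕ} {S : Subgroup (BraidGroup m)}, S.Normal →
    σ m 0 ^ 2 ∈ S → ∀ {v : BraidGroup m}, IsPure v → v ∈ S
  | 0, S, _, _, v, _ => mem_of_σ_mem (by simp) v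
  | m + 1, S, hS, h0, v, hv => by
    have hσ : ∀ i < m + 1, σ (m + 1) i ^ 2 ∈ S := fun i hi => by
      obtain ⟨g, hg⟩ := isConj_iff.1 (σ_isConj hi)
      rw [← hg, conj_pow]
      exact hS.conj_mem _ h0 _
    have hF : ∀ f, ιF m f ∈ S := fun f => by
      refine mem_of_X_mem (S := S.comap (ιF m)) (fun i hi => ?_) f
      rw [Subgroup.mem_comap]
      induction hk : m - i generalizing i with
      | zero =>
        obtain rfl : i = m := by omega
        rw [ιF_X le_rfl, bX_self]
        exact hσ _ (by omega)
      | succ k ih =>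
        rw [ιF_X (by omega), bX_eq_tr (by omega)]
        exact hS.conj_mem' _ (hσ _ (by omega)) _
    obtain ⟨w, rfl⟩ : ∃ w, ι m w = v := ⟨_, (eq_ι_of_perm (by rw [hv]; rfl)).symm⟩
    rw [← inl_left_mul_inr_right w, map_mul, ι_inl, ι_inr]
    refine mul_mem (hF _) ?_
    rw [IsPure, perm_ι] at hv
    rw [← Subgroup.mem_comap]
    refine IsPure.mem_of_normal inferInstance ?_ hv
    rcases Nat.eq_zero_or_pos m with rfl | hm
    · rw [σ_of_le le_rfl, one_pow]; exact one_mem _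
    · rw [Subgroup.mem_comap, map_pow, incl_σ hm]
      exact h0

/-- An endomorphism preserving the underlying permutations and the crossing numbers of the square
of a generator preserves the crossing numbers of the pure braids. -/
theorem cr_map {Φ : BraidGroup m →* BraidGroup m} (hp : ∀ g, perm m (Φ g) = perm m g)
    (h0 : ∀ a b, cr (Φ (σ m 0 ^ 2)) a b = cr (σ m 0 ^ 2) a b) {v : BraidGroup m} (hv : IsPure v)
    (a b : ℕ) : cr (Φ v) a b = cr v a b := by
  have hpΦ : ∀ {v}, IsPure v → IsPure (Φ v) := fun hv => by rwa [IsPure, hp]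
  let S : Subgroup (BraidGroup m) :=
    { carrier := {v | IsPure v ∧ ∀ a b, cr (Φ v) a b = cr v a b}
      one_mem' := ⟨map_one _, by simp⟩
      mul_mem' := fun {v w} hv hw => ⟨hv.1.mul hw.1, fun a b => by
        rw [map_mul, cr_mul_pure _ hw.1, cr_mul_pure _ (hpΦ hw.1), hv.2, hw.2]⟩
      inv_mem' := fun {v} hv => ⟨hv.1.inv, fun a b => by
        rw [map_inv, cr_inv, cr_inv, hp, hv.2]⟩ }
  refine (IsPure.mem_of_normal (S := S) ⟨fun v hv g => ⟨hv.1.conj g, fun a b => ?_⟩⟩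
    ⟨isPure_σ_sq, h0⟩ hv).2 a b
  have h1 := cr_conj (g := g) hv.1 ((perm m g)⁻¹ a) ((perm m g)⁻¹ b)
  have h2 := cr_conj (g := Φ g) (hpΦ hv.1) ((perm m g)⁻¹ a) ((perm m g)⁻¹ b)
  rw [hp, hv.2] at h2
  have e : ∀ c, perm m g ((perm m g)⁻¹ c) = c := fun c => by simp
  rw [e, e] at h1 h2
  rw [map_mul, map_mul, map_inv, h1, h2]

end BraidGroup

namespace BraidGroup

open SemidirectProduct

/-! ### Deleting strands -/

section Delete

variable {m k : ℕ}

/-- The braid obtained by deleting the strand starting at `j`. -/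
def del (g : BraidGroup (m + 1)) (j : ℕ) : BraidGroup m := (coc g j).right

theorem del_mul (g h : BraidGroup (m + 1)) (j : ℕ) :
    del (g * h) j = del g (perm _ h j) * del h j := by
  rw [del, coc_mul, mul_right]; rfl

@[simp] theorem del_one (j : ℕ) : del (1 : BraidGroup (m + 1)) j = 1 := by simp [del]

theorem del_inv (g : BraidGroup (m + 1)) (j : ℕ) :
    del g⁻¹ j = (del g ((perm _ g)⁻¹ j))⁻¹ := by
  rw [del, coc_inv, inv_right]; rfl

theorem del_σ {i j : ℕ} (hi : i ≤ m) (hj : j ≤ m + 1) : del (σ (m + 1) i) j =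
    if j < i then σ m (i - 1) else if j ≤ i + 1 then 1 else σ m i := by
  rw [del, coc_σ hi]
  split_ifs with h1 h2
  · rw [cocGen_lt hi h1, right_inr]
  · rcases (show j = i ∨ j = i + 1 by omega) with rfl | rfl
    · rw [cocGen_self, one_right]
    · rw [cocGen_succ, right_inl]
  · rw [cocGen_gt hj (by omega), right_inr]

theorem del_ι (v : A m) : del (ι m v) (m + 1) = v.right := by rw [del, coc_ι]

theorem del_incl (g : BraidGroup m) : del (incl m g) (m + 1) = g := by
  rw [← ι_inr, del_ι, right_inr]

theorem del_incl_incl (g : BraidGroup m) : del (incl (m + 1) (incl m g)) (m + 1) = incl m g := by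
  let S : Subgroup (BraidGroup m) :=
    { carrier := {g | del (incl (m + 1) (incl m g)) (m + 1) = incl m g}
      one_mem' := by simp
      mul_mem' := fun {g h} hg hh => by
        rw [Set.mem_ofPred_eq] at *
        rw [map_mul, map_mul, del_mul, perm_incl, perm_incl, perm_of_gt _ (by omega), hg, hh]
      inv_mem' := fun {g} hg => by
        rw [Set.mem_ofPred_eq] at *
        rw [map_inv, map_inv, del_inv, perm_incl, perm_incl, ← map_inv, perm_of_gt _ (by omega),
          hg] }
  refine mem_of_σ_mem (S := S) (fun i hi => ?_) g
  show del _ _ = _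
  rw [incl_σ hi, incl_σ (by omega), del_σ (by omega) (by omega), if_neg (by omega),
    if_neg (by omega)]

theorem del_one_of_pure_conj {g v : BraidGroup (m + 1)} (hv : IsPure v) (j : ℕ) :
    del (g * v * g⁻¹) j = del g ((perm _ g)⁻¹ j) * del v ((perm _ g)⁻¹ j) *
      (del g ((perm _ g)⁻¹ j))⁻¹ := by
  rw [IsPure] at hv
  rw [del_mul, del_mul, del_inv, hv, map_inv, Equiv.Perm.one_apply]

/-- The deletion of the `k`-th generator of the free group. -/
def fdel (k : ℕ) : F (k + 2) →* F (k + 1) :=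
  flift fun i => if i < k then X (k + 1) i else if i = k then 1 else X (k + 1) k

theorem del_ιF (f : F (k + 2)) : del (ιF (k + 1) f) k = ιF k (fdel k f) := by
  let S : Subgroup (F (k + 2)) :=
    { carrier := {f | del (ιF (k + 1) f) k = ιF k (fdel k f)}
      one_mem' := by simp
      mul_mem' := fun {f g} hf hg => by
        rw [Set.mem_ofPred_eq] at *
        rw [map_mul, del_mul, isPure_ιF, Equiv.Perm.one_apply, hf, hg, map_mul, map_mul]
      inv_mem' := fun {f} hf => by
        rw [Set.mem_ofPred_eq] at *
        rw [map_inv, del_inv, isPure_ιF, inv_one, Equiv.Perm.one_apply, hf, map_inv, map_inv] }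
  refine mem_of_X_mem (S := S) (fun i hi => ?_) f
  show del _ _ = _
  rw [ιF_X (by omega), fdel, flift_X hi]
  rcases (show i = k + 1 ∨ i = k ∨ i < k by omega) with rfl | rfl | h
  · rw [if_neg (by omega), if_neg (by omega), bX_self, ιF_X le_rfl, bX_self, pow_two, del_mul,
      perm_σ (by omega), Equiv.swap_apply_of_ne_of_ne (by omega) (by omega),
      del_σ (by omega) (by omega), if_pos (by omega), Nat.add_sub_cancel, pow_two]
  · rw [if_neg (by omega), if_pos rfl, bX_lt le_rfl, bX_self, map_one,
      del_one_of_pure_conj isPure_σ_sq, perm_σ (by omega), Equiv.swap_inv,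
      Equiv.swap_apply_of_ne_of_ne (by omega) (by omega), pow_two, del_mul, perm_σ (by omega),
      Equiv.swap_apply_left, del_σ (i := i) (by omega) (by omega),
      del_σ (i := i) (j := i) (by omega) (by omega)]
    simp
  · obtain ⟨k, rfl⟩ : ∃ l, k = l + 1 := ⟨k - 1, by omega⟩
    have hb : IsPure (bX (k + 1 + 2) k i) := by
      rw [← incl_bX (by omega), ← incl_bX (by omega), IsPure, perm_incl, perm_incl,
        ← ιF_X (by omega)]
      exact isPure_ιF _
    rw [if_pos h, bX_lt (by omega), bX_lt (by omega), ιF_X (by omega), bX_lt (by omega),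
      del_one_of_pure_conj (hb.conj _), perm_σ (by omega), Equiv.swap_inv,
      Equiv.swap_apply_of_ne_of_ne (by omega) (by omega), del_one_of_pure_conj hb,
      perm_σ (by omega), Equiv.swap_inv, Equiv.swap_apply_left, ← incl_bX (by omega),
      ← incl_bX (by omega), del_incl_incl, incl_bX (by omega), del_σ (by omega) (by omega),
      del_σ (by omega) (by omega)]
    simp

/-- A section of `μ` after deletion. -/
def fret (k : ℕ) : F (k + 1) →* F 2 :=
  flift fun i => if i = 0 then X 2 0 else if i = k then X 2 1 else 1

theorem fret_bp (hk : 1 ≤ k) {n : ℕ} (hn : 1 ≤ n) (hnk : n ≤ k) :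
    fret k (bp (k + 1) n) = X 2 0 := by
  induction n, hn using Nat.le_induction with
  | base => rw [bp_succ, bp, one_mul, fret, flift_X (by omega), if_pos rfl]
  | succ n hn ih =>
    rw [bp_succ, map_mul, ih (by omega), fret, flift_X (by omega), if_neg (by omega),
      if_neg (by omega), mul_one]

theorem fret_P (hk : 1 ≤ k) : fret k (P k) = X 2 0 * X 2 1 := by
  rw [P, bp_succ, map_mul, fret_bp hk hk le_rfl, fret, flift_X (by omega), if_neg (by omega),
    if_pos rfl]

theorem fret_last (hk : 1 ≤ k) : fret k (X (k + 1) k) = X 2 1 := by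
  rw [fret, flift_X (by omega), if_neg (by omega), if_pos rfl]

theorem fdel_Femb_bp {n : ℕ} (hn : n ≤ k) : fdel k (bp (k + 2) n) = bp (k + 1) n := by
  induction n with
  | zero => simp [bp]
  | succ n ih =>
    rw [bp_succ, map_mul, ih (by omega), bp_succ, fdel, flift_X (by omega), if_pos (by omega)]

theorem fdel_Femb_P : fdel k (Femb (k + 1) (P k)) = bp (k + 1) k := by
  rw [P, Femb_bp le_rfl, bp_succ, map_mul, fdel_Femb_bp le_rfl, fdel, flift_X (by omega),
    if_neg (by omega), if_pos rfl, mul_one]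

theorem fdel_last : fdel k (X (k + 2) (k + 1)) = X (k + 1) k := by
  rw [fdel, flift_X (by omega), if_neg (by omega), if_neg (by omega)]

theorem fdel_P : fdel k (P (k + 1)) = P k := by
  rw [P_succ, map_mul, fdel_Femb_P, fdel_last, P, bp_succ]

theorem fret_fdel_μ (hk : 1 ≤ k) (w : F 2) : fret k (fdel k (μ k w)) = w := by
  refine DFunLike.congr_fun (f := (fret k).comp ((fdel k).comp (μ k))) (g := MonoidHom.id _)
    (fhom_ext fun i hi => ?_) w
  rcases (show i = 0 ∨ i = 1 by omega) with rfl | rfl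
  · rw [MonoidHom.comp_apply, MonoidHom.comp_apply, μ_zero, fdel_Femb_P, fret_bp hk hk le_rfl]
    rfl
  · rw [MonoidHom.comp_apply, MonoidHom.comp_apply, μ_one, fdel_last, fret_last hk]
    rfl

theorem μ_mul : μ k (X 2 0 * X 2 1) = P (k + 1) := by
  rw [map_mul, μ_zero, μ_one, P_succ]

end Delete

end BraidGroup

namespace BraidGroup

open SemidirectProduct

/-! ### Endomorphisms preserving the underlying permutations -/

section Descend

variable {m k : ℕ} {Φ : BraidGroup (m + 1) →* BraidGroup (m + 1)} {φ : A m →* A m}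

theorem exists_descend (hp : ∀ g, perm (m + 1) (Φ g) = perm (m + 1) g) :
    ∃ φ : A m →* A m, ∀ v, Φ (ι m v) = ι m (φ v) :=
  ⟨{ toFun := fun v => coc (Φ (ι m v)) (m + 1)
     map_one' := by simp
     map_mul' := fun v w => by rw [map_mul, map_mul, coc_mul, hp, perm_ι_last] },
    fun v => eq_ι_of_perm (by rw [hp, perm_ι_last])⟩

theorem perm_descend (hp : ∀ g, perm (m + 1) (Φ g) = perm (m + 1) g)
    (hφ : ∀ v, Φ (ι m v) = ι m (φ v)) (v : A m) : perm m (φ v).right = perm m v.right := by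
  rw [← perm_ι, ← hφ, hp, perm_ι]

theorem right_inl_descend {Φ : BraidGroup (k + 2) →* BraidGroup (k + 2)}
    {φ : A (k + 1) →* A (k + 1)} (hk : 1 ≤ k)
    (hp : ∀ g, perm (k + 2) (Φ g) = perm (k + 2) g) (hφ : ∀ v, Φ (ι (k + 1) v) = ι (k + 1) (φ v))
    (hc : ∀ v, IsPure v → ∀ a b, cr (Φ v) a b = cr v a b)
    (hh : ∀ g, (φ (inr g)).right = g) (f : F (k + 2)) : (φ (inl f)).right = 1 := by
  have hlast : (φ (ξ (k + 1) (k + 1))).right = 1 := by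
    have hy : IsPure (φ (ξ (k + 1) (k + 1))).right := by
      rw [IsPure, perm_descend hp hφ, right_inl, map_one]
    have hcy : ∀ a b, a ≤ k + 1 → b ≤ k + 1 → cr (φ (ξ (k + 1) (k + 1))).right a b = 0 :=
      fun a b ha hb => by
        rw [← cr_ι _ ha hb, ← hφ, hc _ (by rw [IsPure, perm_ι, right_inl, map_one]),
          cr_ι _ ha hb, right_inl, cr_one]
    obtain ⟨j, l, e⟩ := pure_commute_incl hy fun g => by
      have h1 : Commute (inr (incl k g) : A (k + 1)) (ξ (k + 1) (k + 1)) := by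
        rw [Commute, SemiconjBy, inr_mul_inl, artin_incl_last]
      have := (h1.map φ).map (rightHom (φ := artin (k + 1)))
      rw [rightHom_eq_right] at this
      simpa only [hh] using this.symm
    rw [e] at hcy
    have hj := hcy 0 (k + 1) (by omega) le_rfl
    have hl := hcy 0 1 (by omega) (by omega)
    rw [cr_ι_last _ (by omega), mul_left, left_inl, left_inr] at hj
    rw [cr_ι _ (by omega) (by omega), mul_right, right_inl, right_inr, one_mul,
      cr_zpow_pure (isPure_z k), cr_z (by omega) hk] at hl
    have hz := (isPure_z k).zpow l
    rw [IsPure] at hz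
    simp only [mul_right, right_inl, right_inr, one_mul, hz] at hj
    have hj' : j = 0 := by simpa [ab_P] using hj
    have hl' : l = 0 := by omega
    rw [e, hj', hl']
    simp
  refine mem_of_X_mem (S := ((rightHom (φ := artin (k + 1))).comp (φ.comp inl)).ker)
    (fun i hi => ?_) f
  rw [MonoidHom.mem_ker, MonoidHom.comp_apply, MonoidHom.comp_apply, rightHom_eq_right]
  induction hj : k + 1 - i generalizing i with
  | zero =>
    obtain rfl : i = k + 1 := by omega
    exact hlast
  | succ j ih =>
    have h1 : inl (X (k + 2) i) = (τ (k + 1) i)⁻¹ * ξ (k + 1) (i + 1) * τ (k + 1) i := by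
      rw [mul_assoc, eq_inv_mul_iff_mul_eq]
      exact τ_ξ_self (by omega)
    rw [h1, map_mul, map_mul, mul_right, mul_right, ih _ (by omega) (by omega), mul_one,
      map_inv, inv_right, inv_mul_cancel]

theorem right_descend (hl : ∀ f, (φ (inl f)).right = 1) (hh : ∀ g, (φ (inr g)).right = g)
    (v : A m) : (φ v).right = v.right := by
  conv_lhs => rw [← inl_left_mul_inr_right v]
  rw [map_mul, mul_right, hl, hh, one_mul]

theorem exists_descend_inl (hl : ∀ f, (φ (inl f)).right = 1) :
    ∃ ψ : F (m + 1) →* F (m + 1), ∀ f, φ (inl f) = inl (ψ f) :=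
  ⟨{ toFun := fun f => (φ (inl f)).left
     map_one' := by simp
     map_mul' := fun f g => by rw [map_mul, map_mul, mul_left, hl, map_one]; rfl },
    fun f => SemidirectProduct.ext rfl (hl f)⟩

theorem ab_descend {ψ : F (m + 1) →* F (m + 1)} (hφ : ∀ v, Φ (ι m v) = ι m (φ v))
    (hc : ∀ v, IsPure v → ∀ a b, cr (Φ v) a b = cr v a b)
    (hψ : ∀ f, φ (inl f) = inl (ψ f)) (f : F (m + 1)) {j : ℕ} (hj : j ≤ m) :
    ab (ψ f) j = ab f j := by
  have := hc _ (isPure_ιF f) j (m + 1)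
  rw [← ι_inl, hφ, hψ, ι_inl, ι_inl, cr_ιF _ hj, cr_ιF _ hj] at this
  omega

/-- Deleting an arbitrary strand commutes with the endomorphism up to a conjugation. -/
theorem exists_del_conj (hp : ∀ g, perm (m + 1) (Φ g) = perm (m + 1) g)
    (hφ : ∀ v, Φ (ι m v) = ι m (φ v)) (hr : ∀ v, (φ v).right = v.right) {j : ℕ}
    (hj : j ≤ m + 1) : ∃ γ : BraidGroup m, IsPure γ ∧ ∀ g, perm (m + 1) g j = j →
      del (Φ g) j = γ * del g j * γ⁻¹ := by
  have hpu : IsPure ((tr m j)⁻¹ * Φ (tr m j)) := by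
    rw [IsPure, map_mul, map_inv, hp, inv_mul_cancel]
  obtain ⟨u, hu⟩ : ∃ u, ι m u = (tr m j)⁻¹ * Φ (tr m j) :=
    ⟨_, (eq_ι_of_perm (by rw [hpu]; rfl)).symm⟩
  refine ⟨u.right, by rw [IsPure, ← perm_ι, hu, hpu], fun g hg => ?_⟩
  have h1 := mul_tr g hj
  have h2 := mul_tr (Φ g) hj
  rw [hp, hg] at h2
  rw [hg] at h1
  have h3 := congrArg Φ h1
  rw [map_mul, map_mul, hφ] at h3
  have h4 : ι m (coc (Φ g) j) = ι m (u * φ (coc g j) * u⁻¹) := by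
    rw [map_mul, map_mul, map_inv, hu]
    calc _ = (tr m j)⁻¹ * (Φ g * tr m j) := by rw [h2]; group
      _ = (tr m j)⁻¹ * (Φ g * Φ (tr m j)) * ((tr m j)⁻¹ * Φ (tr m j))⁻¹ := by group
      _ = _ := by rw [h3]; group
  rw [del, ι_injective h4, mul_right, mul_right, inv_right, hr, del]

end Descend

/-! ### Endomorphisms fixing all generators but the last -/

section FixIncl

variable {k : ℕ} {Φ : BraidGroup (k + 2) →* BraidGroup (k + 2)}

theorem exists_eq_conj_of_fix_incl (hk : 1 ≤ k) (hp : ∀ g, perm (k + 2) (Φ g) = perm (k + 2) g)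
    (hfix : ∀ g, Φ (incl (k + 1) g) = incl (k + 1) g) :
    ∃ i : ℤ, ∀ v, Φ (ι (k + 1) v) =
      ιF (k + 1) (P (k + 1) ^ i) * ι (k + 1) v * (ιF (k + 1) (P (k + 1) ^ i))⁻¹ := by
  have hc : ∀ v, IsPure v → ∀ a b, cr (Φ v) a b = cr v a b := fun v hv => by
    refine cr_map hp (fun a b => ?_) hv
    rw [← incl_σ (by omega), ← map_pow, hfix]
  obtain ⟨φ, hφ⟩ := exists_descend hp
  have hinr : ∀ g, φ (inr g) = inr g := fun g =>
    ι_injective (by rw [← hφ, ι_inr, hfix])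
  have hh : ∀ g, (φ (inr g)).right = g := fun g => by rw [hinr, right_inr]
  have hl := right_inl_descend hk hp hφ hc hh
  obtain ⟨ψ, hψ⟩ := exists_descend_inl hl
  obtain ⟨w, hw⟩ : ∃ w, ψ (X (k + 2) (k + 1)) = μ k w := by
    refine mem_range_μ_of_fixed ?_
    have h1 : Commute (inr (incl k (z k)) : A (k + 1)) (ξ (k + 1) (k + 1)) := by
      rw [Commute, SemiconjBy, inr_mul_inl, artin_incl_last]
    have h2 := (h1.map φ).eq
    rw [hinr, hψ, inr_mul_inl] at h2
    exact inl_injective (mul_right_cancel h2)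
  obtain ⟨γ, hγp, hγ⟩ := exists_del_conj hp hφ (right_descend hl hh) (show k ≤ k + 2 by omega)
  have hγc : ∀ g, Commute γ (incl k g) := by
    have key : ∀ β, perm (k + 1) β k = k → ∀ b, del (incl (k + 1) β) k = b → Commute γ b :=
      fun β hβ b hb => by
        have := hγ (incl (k + 1) β) (by rwa [perm_incl])
        rw [hfix, hb, eq_mul_inv_iff_mul_eq] at this
        exact this.symm
    intro g
    refine commute_of_σ (f := incl k) (fun i hi => ?_) g
    rw [incl_σ hi]
    rcases (show i + 1 < k ∨ i + 1 = k by omega) with h | rfl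
    · refine key (σ (k + 1) i) ?_ _ ?_
      · rw [perm_σ (by omega), Equiv.swap_apply_of_ne_of_ne (by omega) (by omega)]
      · rw [incl_σ (by omega), del_σ (by omega) (by omega), if_neg (by omega), if_neg (by omega)]
    · refine key (σ (i + 2) (i + 1) * σ (i + 2) i * (σ (i + 2) (i + 1))⁻¹) ?_ _ ?_
      · rw [map_mul, map_mul, map_inv, perm_σ (by omega), perm_σ (by omega)]
        simp only [Equiv.swap_inv, Equiv.Perm.mul_apply, Equiv.swap_apply_left]
        rw [Equiv.swap_apply_of_ne_of_ne (a := i) (by omega) (by omega), Equiv.swap_apply_right]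
      · rw [map_mul, map_mul, map_inv, incl_σ (by omega), incl_σ (by omega), del_mul, del_mul,
          del_inv, map_inv, perm_σ (by omega), perm_σ (by omega)]
        simp only [Equiv.swap_inv, Equiv.swap_apply_left]
        rw [Equiv.swap_apply_of_ne_of_ne (a := i) (by omega) (by omega),
          del_σ (by omega) (by omega), del_σ (by omega) (by omega)]
        simp
        omega
  obtain ⟨i, l, e⟩ := pure_commute_incl hγp hγc
  have hdel := hγ (ιF (k + 1) (X (k + 2) (k + 1))) (by rw [isPure_ιF]; rfl)
  rw [← ι_inl, hφ, hψ, ι_inl, ι_inl, hw, del_ιF, del_ιF, fdel_last, e, ← ι_inl, ← ι_inl,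
    ← map_inv, ← map_mul, ← map_mul] at hdel
  have hdel' := ι_injective hdel
  have hw' : fdel k (μ k w) = P k ^ (i - l) * X (k + 1) k * (P k ^ (i - l))⁻¹ := by
    apply inl_injective (φ := artin k)
    rw [hdel', mul_inv_rev, mul_assoc, mul_assoc, ← mul_assoc (inr _) (inl _), inr_mul_inl,
      artin_z_zpow, mul_assoc, mul_inv_cancel_left, ← map_inv, ← map_mul, ← map_mul]
    congr 1
    group
  have hψX : ψ (X (k + 2) (k + 1)) =
      P (k + 1) ^ (i - l) * X (k + 2) (k + 1) * (P (k + 1) ^ (i - l))⁻¹ := by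
    have hw2 := congrArg (fret k) hw'
    rw [map_mul, map_mul, map_inv, map_zpow, fret_P hk, fret_last hk, fret_fdel_μ hk] at hw2
    rw [hw, hw2, map_mul (μ k), map_mul (μ k), map_inv, map_zpow, μ_mul, μ_one]
  refine ⟨i - l, fun v => ?_⟩
  have hcomm : ∀ g, Commute (inr g : A (k + 1)) (inl (P (k + 1) ^ (i - l))) := fun g => by
    rw [Commute, SemiconjBy, inr_mul_inl, map_zpow, artin_P]
  suffices φ v = inl (P (k + 1) ^ (i - l)) * v * (inl (P (k + 1) ^ (i - l)))⁻¹ by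
    rw [hφ, this, map_mul, map_mul, map_inv, ι_inl]
  refine DFunLike.congr_fun (f := φ) (g := (MulAut.conj (inl (P (k + 1) ^ (i - l)))).toMonoidHom)
    (MonoidHom.eq_of_eqOn_top fun v _ => ?_) v
  refine A_mem_of_mem_last (S := φ.eqLocus
    (MulAut.conj (inl (P (k + 1) ^ (i - l)))).toMonoidHom) (fun i hi => ?_) ?_ v
  · show φ _ = inl _ * _ * (inl _)⁻¹
    rw [hinr, ← (hcomm _).eq, mul_inv_cancel_right]
  · show φ _ = inl _ * _ * (inl _)⁻¹
    rw [hψ, hψX, map_mul, map_mul, map_inv]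

/-- An endomorphism fixing all generators but the last one is an inner automorphism. -/
theorem eq_conj_of_fix_incl (hk : 1 ≤ k) (hp : ∀ g, perm (k + 2) (Φ g) = perm (k + 2) g)
    (hfix : ∀ g, Φ (incl (k + 1) g) = incl (k + 1) g) :
    ∃ v, IsPure v ∧ ∀ g, Φ g = v * g * v⁻¹ := by
  obtain ⟨i, hi⟩ := exists_eq_conj_of_fix_incl hk hp hfix
  set v := ιF (k + 1) (P (k + 1) ^ i) with hv
  have hvp : IsPure v := isPure_ιF _
  set Ψ := (MulAut.conj v⁻¹).toMonoidHom.comp Φ with hΨ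
  have hΨ' : ∀ g, Ψ g = v⁻¹ * Φ g * v := fun g => by
    rw [hΨ, MonoidHom.comp_apply]; simp
  have hΨι : ∀ a, Ψ (ι (k + 1) a) = ι (k + 1) a := fun a => by rw [hΨ', hi]; group
  have hΨinc : ∀ a, Ψ (incl (k + 1) a) = incl (k + 1) a := fun a => by rw [← ι_inr, hΨι]
  have hΨp : ∀ g, IsPure g → Ψ g = g := fun g hg => by
    rw [eq_ι_of_perm (g := g) (by rw [hg]; rfl), hΨι]
  have hpΨ : ∀ g, perm (k + 2) (Ψ g) = perm (k + 2) g := fun g => by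
    rw [IsPure] at hvp
    rw [hΨ', map_mul, map_mul, map_inv, hvp, hp]
    simp
  set s := (σ (k + 2) (k + 1))⁻¹ * Ψ (σ (k + 2) (k + 1)) with hs
  have hsp : IsPure s := by rw [IsPure, map_mul, map_inv, hpΨ, inv_mul_cancel]
  have hsc : ∀ g, IsPure g → Commute s g := fun g hg => by
    have h1 := hΨp _ (hg.conj (σ (k + 2) (k + 1)))
    rw [map_mul, map_mul, map_inv, hΨp _ hg] at h1
    rw [Commute, SemiconjBy, hs, mul_assoc, inv_mul_eq_iff_eq_mul]
    calc _ = Ψ (σ (k + 2) (k + 1)) * g * (Ψ (σ (k + 2) (k + 1)))⁻¹ * Ψ (σ (k + 2) (k + 1)) := by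
          group
      _ = _ := by rw [h1]; group
  have hsi : ∀ g, Commute s (incl (k + 1) (incl k g)) := fun g => by
    have h1 := σ_last_comm_incl g
    have h2 := h1.map Ψ
    rw [hΨinc] at h2
    exact h1.inv_left.mul_left h2
  obtain ⟨y, hy⟩ : ∃ y, ι (k + 1) y = s := ⟨_, (eq_ι_of_perm (by rw [hsp]; rfl)).symm⟩
  have hyp : IsPure y.right := by rw [IsPure, ← perm_ι, hy, hsp]
  obtain ⟨j, l, hb⟩ := pure_commute_incl hyp fun g => by
    have := hsi g
    rw [← hy, ← ι_inr, ι_comm_iff] at this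
    have := this.map (rightHom (φ := artin (k + 1)))
    simpa using this
  have hl : l = 0 := by
    have hsq := hΨp _ (isPure_σ_sq (m := k + 2) (i := k + 1))
    have hconj : σ (k + 2) (k + 1) * s * (σ (k + 2) (k + 1))⁻¹ = s⁻¹ := by
      have hR : Ψ (σ (k + 2) (k + 1)) = σ (k + 2) (k + 1) * s := by rw [hs]; group
      rw [map_pow, hR] at hsq
      have h3 := (hsc _ (isPure_σ_sq (m := k + 2) (i := k + 1))).eq
      have h4 : σ (k + 2) (k + 1) * s * (σ (k + 2) (k + 1))⁻¹ *
          (s * σ (k + 2) (k + 1) ^ 2) = σ (k + 2) (k + 1) ^ 2 := by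
        rw [h3]
        calc _ = (σ (k + 2) (k + 1) * s) ^ 2 := by simp only [pow_two]; group
          _ = _ := hsq
      rw [← mul_assoc, mul_eq_right] at h4
      exact eq_inv_of_mul_eq_one_left h4
    have h5 := cr_conj (g := σ (k + 2) (k + 1)) hsp 0 1
    rw [hconj, perm_σ (by omega), Equiv.swap_apply_of_ne_of_ne (by omega) (by omega),
      Equiv.swap_apply_of_ne_of_ne (by omega) (by omega), ← zpow_neg_one, cr_zpow_pure hsp, ← hy,
      cr_ι _ (by omega) (by omega), hb, cr_ι _ (by omega) (by omega), mul_right, right_inl,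
      right_inr, one_mul, cr_zpow_pure (isPure_z k), cr_z (by omega) hk] at h5
    omega
  have hj : j = 0 := by
    have h1 := hsc (incl (k + 1) (ιF k (X (k + 1) k))) (by
      rw [IsPure, perm_incl, isPure_ιF])
    rw [← hy, ← ι_inr, ι_comm_iff] at h1
    have h2 := h1.map (rightHom (φ := artin (k + 1)))
    rw [rightHom_eq_right] at h2
    simp only [hb, hl, right_inr, zpow_zero, map_one, mul_one] at h2
    rw [← ι_inl (X (k + 1) k), ι_comm_iff] at h2
    have h3 : Commute (P k ^ j) (X (k + 1) k) :=
      inl_injective (φ := artin k) (by simpa using h2.eq)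
    obtain ⟨a, ha⟩ := exists_eq_zpow_of_commute (j := k)
      (by rw [ab_X (by omega), if_pos rfl]) h3
    have h4 := congrArg (fun f => ab f 0) ha
    simp only [ab_zpow, ab_P (Nat.zero_le k)] at h4
    rw [ab_X (by omega), if_neg (by omega)] at h4
    omega
  have hy1 : y = inl y.left := by
    refine SemidirectProduct.ext rfl ?_
    rw [hb, hj, hl]
    simp
  have hy2 : y.left = 1 := by
    have h1 : ∀ f, Commute y.left f := fun f => by
      have h1 := hsc (ιF (k + 1) f) (isPure_ιF f)
      rw [← hy, ← ι_inl, ι_comm_iff, hy1] at h1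
      exact inl_injective (φ := artin (k + 1)) (by simpa using h1.eq)
    obtain ⟨a, ha⟩ := exists_eq_zpow_of_commute (j := 0)
      (by rw [ab_X (by omega), if_pos rfl]) (h1 (X (k + 2) 0))
    obtain ⟨b, hb⟩ := exists_eq_zpow_of_commute (j := 1)
      (by rw [ab_X (by omega), if_pos rfl]) (h1 (X (k + 2) 1))
    have h4 := congrArg (fun f => ab f 0) (ha.symm.trans hb)
    simp only [ab_zpow] at h4
    rw [ab_X (by omega), ab_X (by omega), if_pos rfl, if_neg (by omega)] at h4
    rw [ha, show a = 0 by omega, zpow_zero]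
  have hs1 : s = 1 := by rw [← hy, hy1, hy2, map_one, map_one]
  have hΨid : Ψ = MonoidHom.id _ := hom_ext fun i hi => by
    rcases (show i < k + 1 ∨ i = k + 1 by omega) with h | rfl
    · rw [← incl_σ h, hΨinc]; rfl
    · rw [hs, inv_mul_eq_one] at hs1
      exact hs1.symm
  refine ⟨v, hvp, fun g => ?_⟩
  have := hΨ' g
  rw [hΨid, MonoidHom.id_apply] at this
  calc Φ g = v * (v⁻¹ * Φ g * v) * v⁻¹ := by group
    _ = _ := by rw [← this]

end FixIncl

end BraidGroup

namespace BraidGroup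

open SemidirectProduct

/-! ### Standard endomorphisms -/

section Std

variable {m k : ℕ} {Φ : BraidGroup m →* BraidGroup m}

/-- An endomorphism which is, up to a transvection and the mirror automorphism, the conjugation by
a pure braid. -/
def IsStd (Φ : BraidGroup m →* BraidGroup m) : Prop :=
  ∃ g, IsPure g ∧ ∃ e : ℤ, (e = 1 ∨ e = -1) ∧ ∃ k : ℤ, ∀ i < m,
    Φ (σ m i) = g * σ m i ^ e * g⁻¹ * z m ^ k

/-- All endomorphisms preserving the underlying permutations are standard. -/
def Rigid (m : ℕ) : Prop :=
  ∀ Φ : BraidGroup m →* BraidGroup m, (∀ g, perm m (Φ g) = perm m g) → IsStd Φ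

theorem z_zpow_comm (k : ℤ) (g : BraidGroup m) : Commute (z m ^ k) g := (z_comm g).zpow_left k

theorem IsStd.of_conj {v : BraidGroup m} (hv : IsPure v)
    (h : IsStd ((MulAut.conj v).toMonoidHom.comp Φ)) : IsStd Φ := by
  obtain ⟨g, hg, e, he, k, H⟩ := h
  refine ⟨v⁻¹ * g, hv.inv.mul hg, e, he, k, fun i hi => ?_⟩
  have : v * Φ (σ m i) * v⁻¹ = g * σ m i ^ e * g⁻¹ * z m ^ k := H i hi
  calc Φ (σ m i) = v⁻¹ * (v * Φ (σ m i) * v⁻¹) * v := by group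
    _ = v⁻¹ * (g * σ m i ^ e * g⁻¹) * (z m ^ k * v) := by rw [this]; simp only [mul_assoc]
    _ = _ := by rw [(z_zpow_comm k v).eq]; group

/-- The mirror automorphism. -/
def mirror (m : ℕ) : BraidGroup m →* BraidGroup m :=
  lift (fun i => (σ m i)⁻¹)
    (fun i hi => by simpa [mul_assoc] using congrArg (·⁻¹) (σ_braid hi))
    (fun i j h _ => (σ_comm h).inv_inv.eq)

theorem mirror_σ {i : ℕ} (h : i < m) : mirror m (σ m i) = (σ m i)⁻¹ := lift_σ h

theorem perm_mirror (g : BraidGroup m) : perm m (mirror m g) = perm m g :=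
  DFunLike.congr_fun (f := (perm m).comp (mirror m)) (hom_ext fun i hi => by
    rw [MonoidHom.comp_apply, mirror_σ hi, map_inv, perm_σ hi, Equiv.swap_inv]) g

theorem IsStd.of_mirror (h : IsStd (Φ.comp (mirror m))) : IsStd Φ := by
  obtain ⟨g, hg, e, he, k, H⟩ := h
  refine ⟨g, hg, -e, by omega, -k, fun i hi => ?_⟩
  have := H i hi
  rw [MonoidHom.comp_apply, mirror_σ hi, map_inv, inv_eq_iff_eq_inv] at this
  rw [this, mul_inv_rev, ← zpow_neg, (z_zpow_comm _ _).eq]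
  group

/-- The composition with a transvection. -/
def trv (Φ : BraidGroup m →* BraidGroup m) (k : ℤ) : BraidGroup m →* BraidGroup m where
  toFun g := Φ g * z m ^ (k * exp g)
  map_one' := by simp
  map_mul' g h := by
    rw [map_mul, exp_mul, mul_add, zpow_add, mul_assoc, mul_assoc, ← mul_assoc (Φ h),
      ← (z_zpow_comm _ (Φ h)).eq, mul_assoc]

theorem trv_apply (k : ℤ) (g : BraidGroup m) : trv Φ k g = Φ g * z m ^ (k * exp g) := rfl

theorem perm_trv (k : ℤ) (g : BraidGroup m) : perm m (trv Φ k g) = perm m (Φ g) := by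
  rw [trv_apply, map_mul, (isPure_z m).zpow, mul_one]

theorem IsStd.of_trv {l : ℤ} (h : IsStd (trv Φ l)) : IsStd Φ := by
  obtain ⟨g, hg, e, he, k, H⟩ := h
  refine ⟨g, hg, e, he, k - l, fun i hi => ?_⟩
  have := H i hi
  rw [trv_apply, exp_σ hi, mul_one] at this
  rw [zpow_sub, ← mul_assoc, ← this, mul_inv_cancel_right]

end Std

section Induction

variable {m k : ℕ}

theorem conj_inl_P (v : A m) : v * inl (P m) * v⁻¹ = inl (v.left * P m * v.left⁻¹) := by
  conv_lhs => rw [← inl_left_mul_inr_right v]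
  rw [mul_assoc (inl _), inr_mul_inl, artin_P, mul_inv_rev, map_mul, map_mul, map_inv]
  group

theorem del_mul_last (g : BraidGroup (m + 1)) {h : BraidGroup (m + 1)}
    (hh : perm _ h (m + 1) = m + 1) : del (g * h) (m + 1) = del g (m + 1) * del h (m + 1) := by
  rw [del_mul, hh]

theorem del_z (l : ℤ) : del (z (m + 1) ^ l) (m + 1) = z m ^ l := by
  rw [z, ← map_zpow, del_ι, ← rightHom_eq_right, map_zpow, map_mul]
  simp

variable {Φ : BraidGroup (k + 2) →* BraidGroup (k + 2)}

theorem isStd_of_fix_P (hk : 1 ≤ k) (hp : ∀ g, perm (k + 2) (Φ g) = perm (k + 2) g)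
    (hc : ∀ v, IsPure v → ∀ a b, cr (Φ v) a b = cr v a b)
    (hN : ∀ g, del (Φ (incl (k + 1) g)) (k + 2) = g)
    (hP : Φ (ιF (k + 1) (P (k + 1))) = ιF (k + 1) (P (k + 1))) : IsStd Φ := by
  obtain ⟨φ, hφ⟩ := exists_descend hp
  have hfix : ∀ g, Φ (incl (k + 1) g) = incl (k + 1) g := by
    refine DFunLike.congr_fun (f := Φ.comp (incl (k + 1))) (hom_ext fun i hi => ?_)
    rw [MonoidHom.comp_apply]
    have h1 : φ (inr (σ (k + 1) i)) = inl (φ (inr (σ (k + 1) i))).left * inr (σ (k + 1) i) := by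
      conv_lhs => rw [← inl_left_mul_inr_right (φ (inr (σ (k + 1) i)))]
      rw [← del_ι, ← hφ, ι_inr, hN]
    set κ := (φ (inr (σ (k + 1) i))).left
    have h2 : Commute (ι (k + 1) (φ (inr (σ (k + 1) i)))) (ι (k + 1) (inl (P (k + 1)))) := by
      rw [← hφ, ι_inl, ← hP, ι_inr]
      exact (incl_comm_ιF_P _).map Φ
    rw [ι_comm_iff, h1] at h2
    have h3 := artin_eq_conj h2
    rw [artin_P, mul_assoc, eq_inv_mul_iff_mul_eq] at h3
    obtain ⟨l, hl⟩ := exists_eq_zpow_of_commute (ab_P (Nat.zero_le _)) h3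
    have h4 := hc _ (isPure_σ_sq (m := k + 2) (i := i)) 0 (k + 2)
    have h5 : (inl κ * inr (σ (k + 1) i) : A (k + 1)) ^ 2 =
        inl (P (k + 1) ^ (2 * l)) * inr (σ (k + 1) i ^ 2) := by
      rw [pow_two, mul_assoc, ← mul_assoc (inr _), inr_mul_inl, hl, map_zpow (artin (k + 1) (σ (k + 1) i)), artin_P, two_mul,
        zpow_add, map_mul, map_pow, pow_two]
      simp only [mul_assoc]
    have h6 : IsPure (σ (k + 1) i ^ 2) := isPure_σ_sq
    rw [IsPure] at h6
    rw [cr_σ_sq (by omega), if_neg (by omega), ← incl_σ hi, ← ι_inr, map_pow, hφ, h1, ← map_pow,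
      h5, cr_ι_last _ (by omega)] at h4
    simp only [mul_right, right_inl, right_inr, one_mul, mul_left, left_inl, left_inr, map_one,
      mul_one, h6, Equiv.Perm.one_apply, ab_zpow, ab_P (Nat.zero_le _)] at h4
    rw [← ι_inr, hφ, h1, hl, show l = 0 by omega]
    simp
  obtain ⟨v, hv, H⟩ := eq_conj_of_fix_incl hk hp hfix
  exact ⟨v, hv, 1, .inl rfl, 0, fun i _ => by rw [H]; simp⟩

theorem cr_of_del (hk : 2 ≤ k) (hp : ∀ g, perm (k + 2) (Φ g) = perm (k + 2) g)
    (hN : ∀ g, del (Φ (incl (k + 1) g)) (k + 2) = g) {v : BraidGroup (k + 2)} (hv : IsPure v)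
    (a b : ℕ) : cr (Φ v) a b = cr v a b := by
  obtain ⟨φ, hφ⟩ := exists_descend hp
  refine cr_map hp (fun a b => ?_) hv a b
  have hle : ∀ a b, a ≤ k + 1 → b ≤ k + 1 →
      cr (Φ (σ (k + 2) 0 ^ 2)) a b = cr (σ (k + 2) 0 ^ 2) a b := fun a b ha hb => by
    rw [← incl_σ (by omega), ← map_pow, cr_incl, ← ι_inr, hφ, cr_ι _ ha hb, ← del_ι, ← hφ, ι_inr,
      hN]
  have hinv : ∀ i, 2 ≤ i → i < k + 2 → ∀ a b, cr (Φ (σ (k + 2) 0 ^ 2)) (Equiv.swap i (i + 1) a)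
      (Equiv.swap i (i + 1) b) = cr (Φ (σ (k + 2) 0 ^ 2)) a b := fun i h2 hi a b => by
    have h := cr_conj (g := Φ (σ (k + 2) i)) (v := Φ (σ (k + 2) 0 ^ 2))
      (by rw [IsPure, hp, isPure_σ_sq]) a b
    have hcm : Commute (Φ (σ (k + 2) i)) (Φ (σ (k + 2) 0 ^ 2)) :=
      ((σ_comm (m := k + 2) (by omega : 0 + 2 ≤ i)).symm.pow_right 2).map Φ
    rwa [hcm.eq, mul_inv_cancel_right, hp, perm_σ hi] at h
  have hlt : ∀ a, a < k + 1 → cr (Φ (σ (k + 2) 0 ^ 2)) a (k + 2) = 0 := fun a ha => by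
    have h := hinv (k + 1) (by omega) (by omega) a (k + 1)
    rw [Equiv.swap_apply_left, Equiv.swap_apply_of_ne_of_ne (by omega) (by omega),
      hle _ _ (by omega) le_rfl, cr_σ_sq (by omega), if_neg (by omega)] at h
    exact h
  refine cr_ext (fun a b hab hb => ?_) a b
  rcases (show b ≤ k + 1 ∨ b = k + 2 by omega) with hb | rfl
  · exact hle a b (by omega) hb
  · rw [cr_σ_sq (by omega), if_neg (by omega)]
    rcases (show a < k + 1 ∨ a = k + 1 by omega) with ha | rfl
    · exact hlt a ha
    · have h := hinv k hk (by omega) k (k + 2)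
      rwa [Equiv.swap_apply_left, Equiv.swap_apply_of_ne_of_ne (a := k) (b := k + 1) (x := k + 2)
        (by omega) (by omega), hlt k (by omega)] at h

theorem isStd_of_del (hk : 2 ≤ k) (hp : ∀ g, perm (k + 2) (Φ g) = perm (k + 2) g)
    (hN : ∀ g, del (Φ (incl (k + 1) g)) (k + 2) = g) : IsStd Φ := by
  have hc : ∀ v, IsPure v → ∀ a b, cr (Φ v) a b = cr v a b := fun v hv => cr_of_del hk hp hN hv
  obtain ⟨φ, hφ⟩ := exists_descend hp
  have hh : ∀ g, (φ (inr g)).right = g := fun g => by rw [← del_ι, ← hφ, ι_inr, hN]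
  have hl := right_inl_descend (by omega) hp hφ hc hh
  obtain ⟨ψ, hψ⟩ := exists_descend_inl hl
  obtain ⟨c, u, hcu⟩ : ∃ c u, ψ (P (k + 1)) = c * μ k u * c⁻¹ := by
    refine conj_mem_range_μ (g := (φ (inr (incl k (z k)))).left⁻¹) ?_ ?_
    · rw [inv_inv]
      refine artin_eq_conj ?_
      have h1 : Commute (inr (incl k (z k)) : A (k + 1)) (inl (P (k + 1))) := by
        rw [Commute, SemiconjBy, inr_mul_inl, artin_P]
      have h2 := h1.map φ
      rw [hψ] at h2
      conv at h2 => rw [← inl_left_mul_inr_right (φ (inr (incl k (z k)))), hh]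
      exact h2
    · rw [ab_descend hφ hc hψ _ le_rfl, ab_P le_rfl]
      exact one_ne_zero
  obtain ⟨γ, hγp, hγ⟩ := exists_del_conj hp hφ (right_descend hl hh) (show k ≤ k + 2 by omega)
  have hdel := hγ (ιF (k + 1) (P (k + 1))) (by rw [isPure_ιF]; rfl)
  obtain ⟨y, rfl⟩ : ∃ y, ι k y = γ := ⟨_, (eq_ι_of_perm (by rw [hγp]; rfl)).symm⟩
  rw [← ι_inl, hφ, hψ, ι_inl, ι_inl, del_ιF, del_ιF, fdel_P, ← ι_inl, ← ι_inl, ← map_inv,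
    ← map_mul, ← map_mul, conj_inl_P] at hdel
  have h1 := congrArg (fret k) (inl_injective (ι_injective hdel))
  rw [hcu, map_mul, map_mul, map_mul, map_mul, map_mul, map_mul, fret_fdel_μ (by omega),
    fret_P (by omega), map_inv, map_inv, map_inv] at h1
  set r := fret k (fdel k c)
  set s := fret k y.left
  have hu : u = (r⁻¹ * s) * (X 2 0 * X 2 1) * (r⁻¹ * s)⁻¹ := by
    calc u = r⁻¹ * (r * u * r⁻¹) * r := by group
      _ = r⁻¹ * (s * (X 2 0 * X 2 1) * s⁻¹) * r := by rw [h1]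
      _ = _ := by group
  set w := c * μ k (r⁻¹ * s) with hw
  have hQ : ψ (P (k + 1)) = w * P (k + 1) * w⁻¹ := by
    rw [hcu, hu, map_mul (μ k), map_mul (μ k), map_inv, μ_mul, hw]
    group
  have hwp : IsPure (ιF (k + 1) w) := isPure_ιF w
  have hwi : IsPure (ιF (k + 1) w)⁻¹ := hwp.inv
  refine IsStd.of_conj hwi (isStd_of_fix_P (by omega) (fun g => ?_) (fun v hv a b => ?_)
    (fun g => ?_) ?_)
  · show perm _ ((ιF (k + 1) w)⁻¹ * Φ g * ((ιF (k + 1) w)⁻¹)⁻¹) = _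
    rw [IsPure] at hwp
    rw [inv_inv, map_mul, map_mul, map_inv, hwp, hp]
    simp
  · show cr ((ιF (k + 1) w)⁻¹ * Φ v * ((ιF (k + 1) w)⁻¹)⁻¹) a b = _
    have := cr_conj (g := (ιF (k + 1) w)⁻¹) (v := Φ v) (by rw [IsPure, hp, hv]) a b
    rw [hwi] at this
    rw [← hc _ hv]
    exact this
  · show del ((ιF (k + 1) w)⁻¹ * Φ (incl (k + 1) g) * ((ιF (k + 1) w)⁻¹)⁻¹) (k + 2) = g
    rw [inv_inv, ← ι_inr, hφ, ← ι_inl, ← map_inv (ι (k + 1)), ← map_mul, ← map_mul, del_ι]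
    simp [hh]
  · show (ιF (k + 1) w)⁻¹ * Φ _ * ((ιF (k + 1) w)⁻¹)⁻¹ = _
    rw [← ι_inl (P (k + 1)), hφ, hψ, ι_inl, ι_inl, hQ, inv_inv, ← map_inv, ← map_mul, ← map_mul]
    congr 1
    group

theorem isStd_of_del_conj (hk : 2 ≤ k) (hp : ∀ g, perm (k + 2) (Φ g) = perm (k + 2) g)
    {g : BraidGroup (k + 1)} (hg : IsPure g) {l : ℤ}
    (hN : ∀ i < k + 1, del (Φ (σ (k + 2) i)) (k + 2) = g * σ (k + 1) i * g⁻¹ * z (k + 1) ^ l) :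
    IsStd Φ := by
  have hgi : IsPure (incl (k + 1) g)⁻¹ := by
    rw [IsPure, map_inv, perm_incl, hg, inv_one]
  set Ψ := (MulAut.conj (incl (k + 1) g)⁻¹).toMonoidHom.comp (trv Φ (-l)) with hΨ
  have hpΨ : ∀ g, perm (k + 2) (Ψ g) = perm (k + 2) g := fun a => by
    show perm _ ((incl (k + 1) g)⁻¹ * trv Φ (-l) a * ((incl (k + 1) g)⁻¹)⁻¹) = _
    rw [IsPure] at hgi
    rw [map_mul, map_mul, map_inv _ (incl (k + 1) g)⁻¹, hgi, perm_trv, hp]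
    simp
  refine IsStd.of_trv (l := -l) (IsStd.of_conj hgi (isStd_of_del hk hpΨ ?_))
  obtain ⟨φ, hφ⟩ := exists_descend hpΨ
  have h1 : ∀ a, del (Ψ (incl (k + 1) a)) (k + 2) = (rightHom (φ := artin (k + 1))).comp
      (φ.comp inr) a := fun a => by
    rw [← ι_inr, hφ, del_ι]; rfl
  intro a
  rw [h1]
  refine DFunLike.congr_fun (g := MonoidHom.id _) (hom_ext fun i hi => ?_) a
  rw [← h1, incl_σ hi]
  show del ((incl (k + 1) g)⁻¹ * (trv Φ (-l) (σ (k + 2) i)) * ((incl (k + 1) g)⁻¹)⁻¹) _ = _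
  have e1 : perm (k + 2) (z (k + 2) ^ (-l)) (k + 2) = k + 2 := by rw [(isPure_z _).zpow]; rfl
  rw [inv_inv, trv_apply, exp_σ (by omega), mul_one,
    del_mul_last _ (by rw [perm_incl, perm_of_gt _ (by omega)]), del_mul_last,
    del_mul_last _ e1, hN i hi, del_z, del_incl, ← map_inv, del_incl, zpow_neg,
    mul_inv_cancel_right, MonoidHom.id_apply]
  · group
  · rw [map_mul, Equiv.Perm.mul_apply, e1, hp, perm_σ (by omega),
      Equiv.swap_apply_of_ne_of_ne (by omega) (by omega)]

theorem Rigid.succ (hk : 2 ≤ k) (h : Rigid (k + 1)) : Rigid (k + 2) := fun Φ hp => by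
  obtain ⟨φ, hφ⟩ := exists_descend hp
  have h1 : ∀ a, (rightHom (φ := artin (k + 1))).comp (φ.comp inr) a =
      del (Φ (incl (k + 1) a)) (k + 2) := fun a => by
    rw [← ι_inr, hφ, del_ι]; rfl
  obtain ⟨g, hg, e, he, l, H⟩ := h ((rightHom (φ := artin (k + 1))).comp (φ.comp inr)) fun a => by
    show perm _ (φ (inr a)).right = _
    rw [perm_descend hp hφ, right_inr]
  rcases he with rfl | rfl
  · refine isStd_of_del_conj hk hp hg (l := l) fun i hi => ?_
    rw [← incl_σ hi, ← h1, H i hi, zpow_one]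
  · refine IsStd.of_mirror (isStd_of_del_conj hk (fun a => ?_) hg (l := -l) fun i hi => ?_)
    · rw [MonoidHom.comp_apply, hp, perm_mirror]
    · rw [MonoidHom.comp_apply, mirror_σ (by omega), ← incl_σ hi, ← map_inv, ← h1, map_inv, H i hi,
        mul_inv_rev, ← zpow_neg, (z_zpow_comm _ _).eq]
      group

end Induction

end BraidGroup

/-! ### The braid group on four strands as a semidirect product -/

namespace BraidGroup

open SemidirectProduct

/-- The endomorphism underlying `twAut0`. -/
def twHom0 : F 2 →* F 2 := flift fun k => if k = 0 then X 2 0 else X 2 1 * (X 2 0)⁻¹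

/-- The endomorphism underlying `twAut1`. -/
def twHom1 : F 2 →* F 2 := flift fun k => if k = 0 then X 2 0 * X 2 1 else X 2 1

/-- The action of `σ_0` on the kernel of the map from four to three strands. -/
def twAut0 : MulAut (F 2) :=
  MonoidHom.toMulEquiv twHom0 (flift fun k => if k = 0 then X 2 0 else X 2 1 * X 2 0)
    (fhom_ext fun k hk => by
      interval_cases k <;> simp (disch := omega) [twHom0, flift_X])
    (fhom_ext fun k hk => by
      interval_cases k <;> simp (disch := omega) [twHom0, flift_X])

/-- The action of `σ_1` on the kernel of the map from four to three strands. -/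
def twAut1 : MulAut (F 2) :=
  MonoidHom.toMulEquiv twHom1 (flift fun k => if k = 0 then X 2 0 * (X 2 1)⁻¹ else X 2 1)
    (fhom_ext fun k hk => by
      interval_cases k <;> simp (disch := omega) [twHom1, flift_X])
    (fhom_ext fun k hk => by
      interval_cases k <;> simp (disch := omega) [twHom1, flift_X])

theorem twAut0_zero : twAut0 (X 2 0) = X 2 0 :=
  by
  simp (disch := omega) [twAut0, twHom0, flift_X]
theorem twAut0_one : twAut0 (X 2 1) = X 2 1 * (X 2 0)⁻¹ :=
  by
  simp (disch := omega) [twAut0, twHom0, flift_X]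
theorem twAut1_zero : twAut1 (X 2 0) = X 2 0 * X 2 1 :=
  by
  simp (disch := omega) [twAut1, twHom1, flift_X]
theorem twAut1_one : twAut1 (X 2 1) = X 2 1 :=
  by
  simp (disch := omega) [twAut1, twHom1, flift_X]

/-- The action of the braid group on three strands on the kernel of the map from four to three
strands. -/
def tw : BraidGroup 2 →* MulAut (F 2) :=
  lift (fun j => if j = 0 then twAut0 else twAut1)
    (fun i hi => by
      obtain rfl : i = 0 := by omega
      refine mulAut_ext fun k hk => ?_
      interval_cases k <;>
      simp [MulAut.mul_apply, twAut0_zero, twAut0_one, twAut1_zero, twAut1_one, mul_assoc])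
    (fun i j hij hj => by omega)

theorem tw_σ0 : tw (σ 2 0) = twAut0 := lift_σ (by omega)
theorem tw_σ1 : tw (σ 2 1) = twAut1 := lift_σ (by omega)

/-- The map from four strands to three strands. -/
def qd : BraidGroup 3 →* BraidGroup 2 :=
  lift (fun j => if j = 1 then σ 2 1 else σ 2 0)
    (fun i hi => by
      obtain rfl | rfl : i = 0 ∨ i = 1 := by omega
      · exact σ_braid (by omega)
      · exact (σ_braid (by omega)).symm)
    (fun i j hij hj => by
      obtain rfl : i = 0 := by omega
      obtain rfl : j = 2 := by omega
      rfl)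

theorem qd_σ0 : qd (σ 3 0) = σ 2 0 := lift_σ (by omega)
theorem qd_σ1 : qd (σ 3 1) = σ 2 1 := lift_σ (by omega)
theorem qd_σ2 : qd (σ 3 2) = σ 2 0 := lift_σ (by omega)

theorem qd_incl (b : BraidGroup 2) : qd (incl 2 b) = b := by
  refine DFunLike.congr_fun (f := qd.comp (incl 2)) (g := MonoidHom.id _)
    (hom_ext fun i hi => ?_) b
  interval_cases i
  · exact (congrArg qd (incl_σ (by omega))).trans qd_σ0
  · exact (congrArg qd (incl_σ (by omega))).trans qd_σ1

theorem exp_qd (g : BraidGroup 3) : exp (qd g) = exp g := by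
  have : (expHom 2).comp qd = expHom 3 := hom_ext fun i hi => by
    have h : ∀ {m} (g : BraidGroup m), expHom m g = Multiplicative.ofAdd (exp g) := fun g => rfl
    interval_cases i <;> simp (disch := omega) [h, qd_σ0, qd_σ1, qd_σ2, exp_σ]
  exact congrArg Multiplicative.toAdd (DFunLike.congr_fun this g)

/-- The first generator of the kernel. -/
def jx : BraidGroup 3 := σ 3 0 * (σ 3 2)⁻¹

/-- The second generator of the kernel. -/
def jy : BraidGroup 3 := jx⁻¹ * (σ 3 1 * jx * (σ 3 1)⁻¹)

/-- The inclusion of the kernel of the map from four to three strands. -/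
def jF : F 2 →* BraidGroup 3 := flift fun k => if k = 0 then jx else jy

theorem jF_zero : jF (X 2 0) = jx := flift_X (by omega)
theorem jF_one : jF (X 2 1) = jy := flift_X (by omega)

theorem braid3_01 : σ 3 0 * σ 3 1 * σ 3 0 = σ 3 1 * σ 3 0 * σ 3 1 := σ_braid (by omega)
theorem braid3_12 : σ 3 1 * σ 3 2 * σ 3 1 = σ 3 2 * σ 3 1 * σ 3 2 := σ_braid (by omega)
theorem comm3_02 : Commute (σ 3 0) (σ 3 2) := σ_comm (by omega)

theorem qd_jF (f : F 2) : qd (jF f) = 1 := by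
  have hx : qd jx = 1 := by simp [jx, qd_σ0, qd_σ2]
  refine DFunLike.congr_fun (f := qd.comp jF) (g := 1) (fhom_ext fun k hk => ?_) f
  interval_cases k
  · simpa [jF_zero] using hx
  · simp [jF_one, jy, hx]

theorem jy_eq {G : Type*} [Group G] {a b c : G} (h01 : a * b * a = b * a * b)
    (h12 : b * c * b = c * b * c) :
    (a * c⁻¹)⁻¹ * (b * (a * c⁻¹) * b⁻¹) = c * b * a * c⁻¹ * b⁻¹ * c⁻¹ := by
  have h1 : a⁻¹ * b * a = b * a * b⁻¹ := by
    rw [eq_mul_inv_iff_mul_eq, mul_assoc, mul_assoc, inv_mul_eq_iff_eq_mul, ← mul_assoc, ← mul_assoc,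
      h01]
  have h2 : b⁻¹ * c⁻¹ * b⁻¹ = c⁻¹ * b⁻¹ * c⁻¹ := by
    simpa [mul_assoc] using congrArg (·⁻¹) h12
  calc (a * c⁻¹)⁻¹ * (b * (a * c⁻¹) * b⁻¹) = c * (a⁻¹ * b * a) * c⁻¹ * b⁻¹ := by group
    _ = c * b * a * (b⁻¹ * c⁻¹ * b⁻¹) := by rw [h1]; group
    _ = _ := by rw [h2]; group

theorem conj_jy {G : Type*} [Group G] {a b c y : G} (h01 : a * b * a = b * a * b)
    (h12 : b * c * b = c * b * c) (h02 : a * c = c * a)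
    (hy : y = c * b * a * c⁻¹ * b⁻¹ * c⁻¹) :
    a * y * a⁻¹ = y * (a * c⁻¹)⁻¹ ∧ b * y * b⁻¹ = y := by
  have h2 : b⁻¹ * c⁻¹ * b⁻¹ = c⁻¹ * b⁻¹ * c⁻¹ := by
    have := congrArg (·⁻¹) h12
    simpa [mul_assoc] using this
  have h3 : c * b⁻¹ * c⁻¹ = b⁻¹ * c⁻¹ * b := by
    calc c * b⁻¹ * c⁻¹ = c * (b⁻¹ * c⁻¹ * b⁻¹) * b := by group
      _ = _ := by rw [h2]; group
  have hy' : y = c * b * a * (b⁻¹ * c⁻¹ * b⁻¹) := by rw [h2, hy]; group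
  constructor
  · calc a * y * a⁻¹ = (a * c) * b * a * (b⁻¹ * c⁻¹ * b⁻¹) * a⁻¹ := by rw [hy']; group
      _ = c * (a * b * a) * (b⁻¹ * c⁻¹ * b⁻¹) * a⁻¹ := by rw [h02]; group
      _ = c * b * a * c⁻¹ * b⁻¹ * c⁻¹ * (c * a⁻¹) := by rw [h01]; group
      _ = _ := by rw [hy]; group
  · calc b * y * b⁻¹ = (b * c * b) * a * (b⁻¹ * c⁻¹ * b⁻¹) * b⁻¹ := by rw [hy']; group
      _ = c * b * (c * a) * b⁻¹ * c⁻¹ * b⁻¹ * b⁻¹ := by rw [h12]; group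
      _ = c * b * a * (c * b⁻¹ * c⁻¹) * b⁻¹ * b⁻¹ := by rw [← h02]; group
      _ = y := by rw [h3, hy']; group

theorem incl_mul_jF (b : BraidGroup 2) (f : F 2) :
    jF (tw b f) = incl 2 b * jF f * (incl 2 b)⁻¹ := by
  have hy := conj_jy braid3_01 braid3_12 comm3_02.eq
    (jy_eq braid3_01 braid3_12)
  let S : Subgroup (BraidGroup 2) :=
    { carrier := {b | ∀ f, jF (tw b f) = incl 2 b * jF f * (incl 2 b)⁻¹}
      one_mem' := fun f => by simp
      mul_mem' := fun {a b} ha hb f => by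
        rw [map_mul, MulAut.mul_apply, ha, hb, map_mul]
        group
      inv_mem' := fun {a} ha f => by
        have := ha ((tw a)⁻¹ f)
        rw [MulAut.apply_inv_self] at this
        rw [map_inv, map_inv, this]
        group }
  refine mem_of_σ_mem (S := S) (fun i hi => ?_) b f
  intro f
  refine DFunLike.congr_fun (f := jF.comp (tw (σ 2 i)).toMonoidHom)
    (g := (MulAut.conj (incl 2 (σ 2 i))).toMonoidHom.comp jF) (fhom_ext fun k hk => ?_) f
  show jF (tw (σ 2 i) _) = incl 2 _ * _ * (incl 2 _)⁻¹
  have hx : Commute (σ 3 0) jx := (Commute.refl _).mul_right comm3_02.inv_right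
  rw [incl_σ hi]
  interval_cases i <;> interval_cases k
  · rw [tw_σ0, twAut0_zero, jF_zero, hx.eq, mul_inv_cancel_right]
  · rw [tw_σ0, twAut0_one, map_mul, map_inv, jF_zero, jF_one]
    exact hy.1.symm
  · rw [tw_σ1, twAut1_zero, map_mul, jF_zero, jF_one, jy, mul_inv_cancel_left]
  · rw [tw_σ1, twAut1_one, jF_one]
    exact hy.2.symm

/-- The splitting of the braid group on four strands. -/
def spl : BraidGroup 3 →* F 2 ⋊[tw] BraidGroup 2 :=
  lift (fun j => if j = 0 then inr (σ 2 0) else if j = 1 then inr (σ 2 1) else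
      inl (X 2 0)⁻¹ * inr (σ 2 0))
    (fun i hi => by
      have h01 : σ 2 0 * σ 2 1 * σ 2 0 = σ 2 1 * σ 2 0 * σ 2 1 := σ_braid (by omega)
      obtain rfl | rfl : i = 0 ∨ i = 1 := by omega
      · simp [← map_mul, h01]
      · refine SemidirectProduct.ext ?_ ?_
        · simp [tw_σ0, tw_σ1, twAut0_zero, twAut0_one, twAut1_zero, mul_assoc]
        · simp [h01])
    (fun i j hij hj => by
      obtain rfl : i = 0 := by omega
      obtain rfl : j = 2 := by omega
      refine SemidirectProduct.ext ?_ ?_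
      · simp [tw_σ0, twAut0_zero]
      · simp)

theorem spl_σ0 : spl (σ 3 0) = inr (σ 2 0) := lift_σ (by omega)
theorem spl_σ1 : spl (σ 3 1) = inr (σ 2 1) := lift_σ (by omega)
theorem spl_σ2 : spl (σ 3 2) = inl (X 2 0)⁻¹ * inr (σ 2 0) := lift_σ (by omega)

theorem spl_jF (f : F 2) : spl (jF f) = inl f := by
  have hx : spl jx = inl (X 2 0) := by simp [jx, spl_σ0, spl_σ2]
  refine DFunLike.congr_fun (f := spl.comp jF) (g := inl) (fhom_ext fun k hk => ?_) f
  interval_cases k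
  · rw [MonoidHom.comp_apply, jF_zero, hx]
  · rw [MonoidHom.comp_apply, jF_one, jy, map_mul, map_mul, map_mul, map_inv, map_inv, hx, spl_σ1,
      ← map_inv inr, ← inl_aut, tw_σ1, twAut1_zero]
    simp

theorem jF_injective : Function.Injective jF := fun a b h => by
  have := congrArg spl h
  rwa [spl_jF, spl_jF, inl_inj] at this

theorem eq_jF_mul (g : BraidGroup 3) : ∃ f, g = jF f * incl 2 (qd g) := by
  let S : Subgroup (BraidGroup 3) :=
    { carrier := {g | ∃ f, g = jF f * incl 2 (qd g)}
      one_mem' := ⟨1, by simp⟩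
      mul_mem' := fun {a b} ⟨u, hu⟩ ⟨v, hv⟩ => ⟨u * tw (qd a) v, by
        rw [map_mul jF, incl_mul_jF, map_mul, map_mul]
        conv_lhs => rw [hu, hv]
        group⟩
      inv_mem' := fun {a} ⟨u, hu⟩ => ⟨tw (qd a)⁻¹ u⁻¹, by
        rw [incl_mul_jF, map_inv qd, map_inv jF, map_inv (incl 2)]
        conv_lhs => rw [hu]
        group⟩ }
  refine mem_of_σ_mem (S := S) (fun i hi => ?_) g
  interval_cases i
  · exact ⟨1, by rw [qd_σ0, incl_σ (by omega)]; simp⟩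
  · exact ⟨1, by rw [qd_σ1, incl_σ (by omega)]; simp⟩
  · refine ⟨(X 2 0)⁻¹, ?_⟩
    rw [qd_σ2, incl_σ (by omega), map_inv, jF_zero, jx]
    group

theorem conj_jF (g : BraidGroup 3) : ∃ u, ∀ f, g * jF f * g⁻¹ = jF (u * tw (qd g) f * u⁻¹) := by
  obtain ⟨u, hu⟩ := eq_jF_mul g
  refine ⟨u, fun f => ?_⟩
  rw [map_mul, map_mul, incl_mul_jF, map_inv]
  conv_lhs => rw [hu]
  group

theorem exists_jF_of_qd {g : BraidGroup 3} (h : qd g = 1) : ∃ f, g = jF f := by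
  obtain ⟨f, hf⟩ := eq_jF_mul g
  exact ⟨f, by rw [hf, h]; simp⟩

/-! #### Permutations of elements of the kernel -/

/-- The permutation of the first generator. -/
def vx : Equiv.Perm ℕ := Equiv.swap 0 1 * Equiv.swap 2 3

/-- The permutation of the second generator. -/
def vy : Equiv.Perm ℕ := Equiv.swap 0 3 * Equiv.swap 1 2

theorem perm_jx : perm 3 jx = vx := by
  rw [jx, map_mul, map_inv, perm_σ (by omega), perm_σ (by omega), Equiv.swap_inv, vx]

theorem vx_mul_vy : Commute vx vy := by
  refine Equiv.ext fun k => ?_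
  rcases (show k = 0 ∨ k = 1 ∨ k = 2 ∨ k = 3 ∨ 4 ≤ k by omega) with rfl | rfl | rfl | rfl | h
  any_goals decide
  simp (disch := omega) [vx, vy, Equiv.swap_apply_of_ne_of_ne]

theorem vx_sq : vx ^ 2 = 1 := by
  refine Equiv.ext fun k => ?_
  rcases (show k = 0 ∨ k = 1 ∨ k = 2 ∨ k = 3 ∨ 4 ≤ k by omega) with rfl | rfl | rfl | rfl | h
  any_goals decide
  simp (disch := omega) [vx, pow_two, Equiv.swap_apply_of_ne_of_ne]

theorem vy_sq : vy ^ 2 = 1 := by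
  refine Equiv.ext fun k => ?_
  rcases (show k = 0 ∨ k = 1 ∨ k = 2 ∨ k = 3 ∨ 4 ≤ k by omega) with rfl | rfl | rfl | rfl | h
  any_goals decide
  simp (disch := omega) [vy, pow_two, Equiv.swap_apply_of_ne_of_ne]

theorem perm_jy : perm 3 jy = vy := by
  rw [jy, map_mul, map_mul, map_mul, map_inv, map_inv, perm_jx, perm_σ (by omega), Equiv.swap_inv]
  refine Equiv.ext fun k => ?_
  rcases (show k = 0 ∨ k = 1 ∨ k = 2 ∨ k = 3 ∨ 4 ≤ k by omega) with rfl | rfl | rfl | rfl | h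
  any_goals decide
  simp (disch := omega) [vx, vy, Equiv.swap_apply_of_ne_of_ne]

theorem perm_jF (f : F 2) : perm 3 (jF f) = vx ^ ab f 0 * vy ^ ab f 1 := by
  let Ψ : F 2 →* Equiv.Perm ℕ :=
    { toFun := fun f => vx ^ ab f 0 * vy ^ ab f 1
      map_one' := by simp
      map_mul' := fun a b => by
        rw [ab_mul, ab_mul, zpow_add, zpow_add, mul_assoc, mul_assoc,
          ← mul_assoc (vy ^ ab a 1) (vx ^ ab b 0),
          ← (vx_mul_vy.zpow_zpow (ab b 0) (ab a 1)).eq, mul_assoc] }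
  refine DFunLike.congr_fun (f := (perm 3).comp jF) (g := Ψ) (fhom_ext fun k hk => ?_) f
  show perm 3 _ = vx ^ ab (X 2 k) 0 * vy ^ ab (X 2 k) 1
  rw [ab_X hk, ab_X hk]
  interval_cases k
  · simp [jF_zero, perm_jx]
  · simp [jF_one, perm_jy]

/-- The abelianisations of two elements of the free group agree modulo two. -/
theorem even_ab_of_perm_eq {f g : F 2} (h : perm 3 (jF f) = perm 3 (jF g)) {j : ℕ} (hj : j < 2) :
    Even (ab f j - ab g j) := by
  have key : ∀ a b : ℤ, vx ^ a * vy ^ b = 1 → Even a ∧ Even b := fun a b e => by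
    have ex : ∀ k : ℤ, vx ^ (k + k) = 1 := fun k => by rw [← two_mul, zpow_mul]; simp [vx_sq]
    have ey : ∀ k : ℤ, vy ^ (k + k) = 1 := fun k => by rw [← two_mul, zpow_mul]; simp [vy_sq]
    have e0 := DFunLike.congr_fun e 0
    rcases Int.even_or_odd' a with ⟨k, rfl | rfl⟩ <;> rcases Int.even_or_odd' b with ⟨l, rfl | rfl⟩
    · simp
    all_goals
      exfalso
      simp only [two_mul, zpow_add _ _ 1, ex, ey, one_mul, mul_one, zpow_one] at e0
      revert e0
      decide
  have h1 : vx ^ ab (f * g⁻¹) 0 * vy ^ ab (f * g⁻¹) 1 = 1 := by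
    rw [← perm_jF, map_mul, map_mul, h, map_inv, map_inv, mul_inv_cancel]
  have := key _ _ h1
  rw [ab_mul, ab_mul, ab_inv, ab_inv] at this
  interval_cases j
  · exact this.1
  · exact this.2

theorem isPure_jF {f : F 2} : IsPure (jF f) ↔ Even (ab f 0) ∧ Even (ab f 1) := by
  constructor
  · intro h
    have h' : perm 3 (jF f) = perm 3 (jF 1) := by rw [IsPure] at h; rw [h]; simp
    exact ⟨by simpa using even_ab_of_perm_eq h' (j := 0) (by omega),
      by simpa using even_ab_of_perm_eq h' (j := 1) (by omega)⟩
  · rintro ⟨⟨a, ha⟩, ⟨b, hb⟩⟩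
    rw [IsPure, perm_jF, ha, hb, ← two_mul, ← two_mul, zpow_mul, zpow_mul]
    simp [vx_sq, vy_sq]

end BraidGroup

/-! ### The linear representation of the braid group on three strands -/

open Matrix in
theorem Matrix.SpecialLinearGroup.commute_of_commute_sq {K A : SpecialLinearGroup (Fin 2) ℤ}
    (hK : K.1 0 0 + K.1 1 1 ≠ 0) (h : Commute (K ^ 2) A) : Commute K A := by
  have hd : K.1 0 0 * K.1 1 1 - K.1 0 1 * K.1 1 0 = 1 := by
    rw [← Matrix.det_fin_two]; exact K.2
  have h1 : ∀ i j, (K * K * A).1 i j = (A * (K * K)).1 i j := fun i j => by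
    rw [← pow_two, h.eq]
  have h00 := h1 0 0
  have h01 := h1 0 1
  have h10 := h1 1 0
  have h11 := h1 1 1
  simp only [SpecialLinearGroup.coe_mul, Matrix.mul_apply, Fin.sum_univ_two] at h00 h01 h10 h11
  refine Subtype.ext (Matrix.ext fun i j => ?_)
  refine mul_left_cancel₀ hK ?_
  fin_cases i <;> fin_cases j <;>
    simp only [SpecialLinearGroup.coe_mul, Matrix.mul_apply, Fin.sum_univ_two, Fin.zero_eta,
      Fin.mk_one, Fin.isValue]
  · linear_combination h00
  · linear_combination h01
  · linear_combination h10
  · linear_combination h11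

open Matrix in
/-- Representations of the braid group on four strands in `SL(2, ℤ)` factor through three
strands. -/
theorem Matrix.SpecialLinearGroup.eq_of_braid {a b c : SpecialLinearGroup (Fin 2) ℤ}
    (h01 : a * b * a = b * a * b) (h12 : b * c * b = c * b * c) (h02 : a * c = c * a) : a = c := by
  set N := a * b * c with hN
  have e0 : N * a = b * N := by
    calc N * a = a * b * (c * a) := by rw [hN]; group
      _ = (a * b * a) * c := by rw [← h02]; group
      _ = _ := by rw [h01, hN]; group
  have e1 : N * b = c * N := by
    calc N * b = a * (b * c * b) := by rw [hN]; group
      _ = (a * c) * b * c := by rw [h12]; group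
      _ = _ := by rw [h02, hN]; group
  have e2 : N ^ 2 * c = a * N ^ 2 := by
    have : N ^ 2 = a * N * (a * b) := by
      calc N ^ 2 = a * (b * c) * N := by rw [pow_two, hN]; group
        _ = a * (b * (c * N)) := by group
        _ = a * (b * N * b) := by rw [← e1]; group
        _ = a * (N * a * b) := by rw [e0]
        _ = _ := by group
    calc N ^ 2 * c = a * N * (a * b * c) := by rw [this]; group
      _ = _ := by rw [← hN, pow_two]; group
  have e3 : N ^ 2 * a = c * N ^ 2 := by
    calc N ^ 2 * a = N * (N * a) := by rw [pow_two, mul_assoc]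
      _ = (N * b) * N := by rw [e0, ← mul_assoc]
      _ = _ := by rw [e1, pow_two, mul_assoc]
  have e4 : Commute ((N ^ 2) ^ 2) a := by
    calc (N ^ 2) ^ 2 * a = N ^ 2 * (N ^ 2 * a) := by rw [pow_two (N ^ 2), mul_assoc]
      _ = (N ^ 2 * c) * N ^ 2 := by rw [e3, mul_assoc]
      _ = _ := by rw [e2, pow_two (N ^ 2), mul_assoc]
  have hd : N.1 0 0 * N.1 1 1 - N.1 0 1 * N.1 1 0 = 1 := by
    rw [← Matrix.det_fin_two]; exact N.2
  have htr : (N ^ 2).1 0 0 + (N ^ 2).1 1 1 ≠ 0 := by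
    simp only [pow_two, SpecialLinearGroup.coe_mul, Matrix.mul_apply, Fin.sum_univ_two]
    intro h
    have : (N.1 0 0 + N.1 1 1) ^ 2 = 2 := by linear_combination h + 2 * hd
    set t := N.1 0 0 + N.1 1 1
    have h1 : t ≤ 1 := by nlinarith
    have h2 : -1 ≤ t := by nlinarith
    interval_cases t <;> omega
  have := (SpecialLinearGroup.commute_of_commute_sq htr e4).eq
  rw [e3] at this
  exact (mul_right_cancel this).symm

namespace BraidGroup

open SemidirectProduct Matrix

/-- The image of `σ_0` in `SL(2, ℤ)`. -/
def r0 : SpecialLinearGroup (Fin 2) ℤ := ⟨!![1, -1; 0, 1], by simp⟩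

/-- The image of `σ_1` in `SL(2, ℤ)`. -/
def r1 : SpecialLinearGroup (Fin 2) ℤ := ⟨!![1, 0; 1, 1], by simp⟩

/-- The linear representation of the braid group on three strands. -/
def lin : BraidGroup 2 →* SpecialLinearGroup (Fin 2) ℤ :=
  lift (fun j => if j = 0 then r0 else r1)
    (fun i hi => by
      obtain rfl : i = 0 := by omega
      decide)
    (fun i j hij hj => by omega)

theorem lin_σ0 : lin (σ 2 0) = r0 := lift_σ (by omega)
theorem lin_σ1 : lin (σ 2 1) = r1 := lift_σ (by omega)

theorem lin_surjective : Function.Surjective lin := by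
  rw [← MonoidHom.range_eq_top, eq_top_iff, ← SpecialLinearGroup.SL2Z_generators,
    Subgroup.closure_le]
  rintro _ (rfl | rfl)
  · refine ⟨σ 2 0 * σ 2 1 * σ 2 0, ?_⟩
    simp only [map_mul, lin_σ0, lin_σ1]
    decide
  · refine ⟨(σ 2 0)⁻¹, ?_⟩
    rw [map_inv, lin_σ0]
    decide

theorem ab_tw (b : BraidGroup 2) (f : F 2) :
    ab (tw b f) 0 = (lin b).1 0 0 * ab f 0 + (lin b).1 0 1 * ab f 1 ∧
    ab (tw b f) 1 = (lin b).1 1 0 * ab f 0 + (lin b).1 1 1 * ab f 1 := by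
  let V : F 2 →* Multiplicative (Fin 2 → ℤ) :=
    { toFun := fun f => Multiplicative.ofAdd ![ab f 0, ab f 1]
      map_one' := by
        rw [← ofAdd_zero]
        congr 1
        ext j
        fin_cases j <;> simp
      map_mul' := fun f g => by
        rw [← ofAdd_add]
        congr 1
        ext j
        fin_cases j <;> simp }
  have hV : ∀ f, V f = Multiplicative.ofAdd ![ab f 0, ab f 1] := fun f => rfl
  let M : SpecialLinearGroup (Fin 2) ℤ → Multiplicative (Fin 2 → ℤ) →* Multiplicative (Fin 2 → ℤ) :=
    fun r => AddMonoidHom.toMultiplicative (Matrix.mulVecLin r.1).toAddMonoidHom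
  have hM : ∀ r v, M r (Multiplicative.ofAdd v) = Multiplicative.ofAdd (r.1 *ᵥ v) := fun r v => rfl
  have hMM : ∀ r s v, M (r * s) v = M r (M s v) := fun r s v => by
    rw [← ofAdd_toAdd v, hM, hM, hM, Matrix.mulVec_mulVec]
    rfl
  have hM1 : ∀ v, M 1 v = v := fun v => by
    rw [← ofAdd_toAdd v, hM]
    exact congrArg _ (Matrix.one_mulVec _)
  let S : Subgroup (BraidGroup 2) :=
    { carrier := {b | ∀ f, V (tw b f) = M (lin b) (V f)}
      one_mem' := fun f => by rw [map_one, map_one, hM1, MulAut.one_apply]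
      mul_mem' := fun {a b} ha hb f => by
        rw [map_mul, MulAut.mul_apply, ha, hb, map_mul, hMM]
      inv_mem' := fun {a} ha f => by
        have h := ha ((tw a)⁻¹ f)
        rw [MulAut.apply_inv_self] at h
        rw [map_inv, map_inv, h, ← hMM, inv_mul_cancel, hM1] }
  have key : ∀ f, V (tw b f) = M (lin b) (V f) := by
    refine mem_of_σ_mem (S := S) (fun i hi => ?_) b
    intro f
    refine DFunLike.congr_fun (f := V.comp (tw (σ 2 i)).toMonoidHom)
      (g := (M (lin (σ 2 i))).comp V) (fhom_ext fun k hk => ?_) f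
    show V (tw (σ 2 i) _) = M _ (V _)
    rw [hV, hV, hM]
    congr 1
    interval_cases i <;> interval_cases k
    all_goals
      simp (disch := omega) only [tw_σ0, tw_σ1, twAut0_zero, twAut0_one, twAut1_zero, twAut1_one,
        lin_σ0, lin_σ1, r0, r1, ab_mul, ab_inv, ab_X]
      decide
  have := congrArg Multiplicative.toAdd (key f)
  rw [hV, hV, hM] at this
  have h0 := congrFun this 0
  have h1 := congrFun this 1
  simp [Matrix.mulVec, dotProduct, Fin.sum_univ_two] at h0 h1
  exact ⟨h0, h1⟩

theorem z2_eq : z 2 = σ 2 1 * σ 2 0 ^ 2 * σ 2 1 * σ 2 0 ^ 2 := by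
  have hP0 : P 0 = X 1 0 := by rw [P, bp_succ]; simp [bp]
  have h1 : ιF 0 (P 0) = σ 1 0 ^ 2 := by
    rw [hP0, ιF_X le_rfl, bX_self]
  have hz1 : z 1 = σ 1 0 ^ 2 := by rw [z_succ, h1]; simp [z]
  rw [z_succ, ιF_P_succ, h1, hz1]
  simp (disch := omega) only [map_pow, incl_σ, mul_assoc]

theorem lin_z : lin (z 2) = -1 := by
  rw [z2_eq]
  simp only [map_mul, map_pow, lin_σ0, lin_σ1]
  decide

/-- The ping-pong generators. -/
def pp (j : ℕ) : SpecialLinearGroup (Fin 2) ℤ :=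
  if j = 0 then ⟨!![-1, -2; 0, -1], by simp⟩ else ⟨!![1, 0; 2, 1], by simp⟩

theorem flift_pp_injective : Function.Injective (flift (k := 2) pp) := by
  let p : SpecialLinearGroup (Fin 2) ℤ → ℤ := fun g => g.1 0 0
  let q : SpecialLinearGroup (Fin 2) ℤ → ℤ := fun g => g.1 1 0
  have hpq : ∀ g, p g ≠ 0 ∨ q g ≠ 0 := fun g => by
    by_contra! h
    have := g.2
    rw [Matrix.det_fin_two] at this
    simp only [p, q] at h
    rw [h.1, h.2] at this
    simp at this
  have sq : ∀ x : ℤ, x ≠ 0 → 0 < x ^ 2 := fun x hx => by positivity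
  have pmul : ∀ r g, p (r * g) = r.1 0 0 * p g + r.1 0 1 * q g := fun r g => by
    show (r.1 * g.1) 0 0 = _
    rw [Matrix.mul_apply, Fin.sum_univ_two]
  have qmul : ∀ r g, q (r * g) = r.1 1 0 * p g + r.1 1 1 * q g := fun r g => by
    show (r.1 * g.1) 1 0 = _
    rw [Matrix.mul_apply, Fin.sum_univ_two]
  have hX : ∀ g, q g ^ 2 ≤ p g * q g → p g ^ 2 < p g * q g ∨ p g = 0 → False := by
    rintro g h1 (h2 | h2)
    · have hq : q g ≠ 0 := fun h => by
        rw [h] at h2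
        nlinarith [sq_nonneg (p g)]
      nlinarith [sq_nonneg (p g - q g)]
    · rw [h2] at h1
      have := sq _ ((hpq g).resolve_left (not_not.2 h2))
      linarith
  have hY : ∀ g, p g * q g < - q g ^ 2 → p g * q g ≤ - p g ^ 2 → False := fun g h1 h2 => by
    nlinarith [sq_nonneg (p g + q g)]
  refine FreeGroup.injective_lift_of_ping_pong (α := SpecialLinearGroup (Fin 2) ℤ)
    (fun j : Fin 2 => pp j)
    (fun j => if j = 0 then {g | q g ^ 2 ≤ p g * q g} else {g | p g ^ 2 < p g * q g ∨ p g = 0})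
    (fun j => if j = 0 then {g | p g * q g < - q g ^ 2} else {g | p g * q g ≤ - p g ^ 2 ∧ p g ≠ 0})
    ?_ ?_ ?_ ?_ ?_ ?_
  · intro j
    fin_cases j
    · exact ⟨1, by simp [p, q]⟩
    · exact ⟨ModularGroup.S, Or.inr rfl⟩
  · intro i j hij
    rw [Function.onFun, Set.disjoint_left]
    fin_cases i <;> fin_cases j
    · exact absurd rfl hij
    · exact fun g h1 h2 => hX g h1 h2
    · exact fun g h1 h2 => hX g h2 h1
    · exact absurd rfl hij
  · intro i j hij
    rw [Function.onFun, Set.disjoint_left]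
    fin_cases i <;> fin_cases j
    · exact absurd rfl hij
    · exact fun g h1 h2 => hY g h1 h2.1
    · exact fun g h1 h2 => hY g h2 h1.1
    · exact absurd rfl hij
  · intro i j
    rw [Set.disjoint_left]
    fin_cases i <;> fin_cases j
    · exact fun g (h1 : q g ^ 2 ≤ p g * q g) (h2 : p g * q g < - q g ^ 2) => by
        nlinarith [sq_nonneg (q g)]
    · exact fun g (h1 : q g ^ 2 ≤ p g * q g) (h2 : p g * q g ≤ - p g ^ 2 ∧ p g ≠ 0) => by
        nlinarith [sq_nonneg (q g), sq _ h2.2]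
    · exact fun g (h1 : p g ^ 2 < p g * q g ∨ p g = 0) (h2 : p g * q g < - q g ^ 2) => by
        rcases h1 with h1 | h1
        · nlinarith [sq_nonneg (q g), sq_nonneg (p g)]
        · rw [h1] at h2
          nlinarith [sq_nonneg (q g)]
    · exact fun g (h1 : p g ^ 2 < p g * q g ∨ p g = 0)
          (h2 : p g * q g ≤ - p g ^ 2 ∧ p g ≠ 0) => by
        rcases h1 with h1 | h1
        · nlinarith [sq_nonneg (p g)]
        · exact h2.2 h1
  · intro i
    fin_cases i
    · rintro _ ⟨g, hg, rfl⟩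
      have hg' : ¬ (p g * q g < - q g ^ 2) := hg
      have hp : p (pp 0 * g) = - p g - 2 * q g := by
        rw [pmul, show (pp 0).1 0 0 = -1 by decide, show (pp 0).1 0 1 = -2 by decide]
        ring
      have hq : q (pp 0 * g) = - q g := by
        rw [qmul, show (pp 0).1 1 0 = 0 by decide, show (pp 0).1 1 1 = -1 by decide]
        ring
      show q (pp 0 * g) ^ 2 ≤ p (pp 0 * g) * q (pp 0 * g)
      rw [hp, hq]
      nlinarith
    · rintro _ ⟨g, hg, rfl⟩
      have hg' : ¬ (p g * q g ≤ - p g ^ 2 ∧ p g ≠ 0) := hg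
      have hp : p (pp 1 * g) = p g := by
        rw [pmul, show (pp 1).1 0 0 = 1 by decide, show (pp 1).1 0 1 = 0 by decide]
        ring
      have hq : q (pp 1 * g) = 2 * p g + q g := by
        rw [qmul, show (pp 1).1 1 0 = 2 by decide, show (pp 1).1 1 1 = 1 by decide]
        ring
      show p (pp 1 * g) ^ 2 < p (pp 1 * g) * q (pp 1 * g) ∨ p (pp 1 * g) = 0
      rw [hp, hq]
      by_cases h0 : p g = 0
      · exact Or.inr h0
      · refine Or.inl ?_
        have : - p g ^ 2 < p g * q g := not_le.1 fun h => hg' ⟨h, h0⟩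
        nlinarith
  · intro i
    fin_cases i
    · rintro _ ⟨g, hg, rfl⟩
      have hg' : ¬ (q g ^ 2 ≤ p g * q g) := hg
      have hp : p ((pp 0)⁻¹ * g) = - p g + 2 * q g := by
        rw [pmul, show (pp 0)⁻¹.1 0 0 = -1 by decide, show (pp 0)⁻¹.1 0 1 = 2 by decide]
        ring
      have hq : q ((pp 0)⁻¹ * g) = - q g := by
        rw [qmul, show (pp 0)⁻¹.1 1 0 = 0 by decide, show (pp 0)⁻¹.1 1 1 = -1 by decide]
        ring
      show p ((pp 0)⁻¹ * g) * q ((pp 0)⁻¹ * g) < - q ((pp 0)⁻¹ * g) ^ 2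
      rw [hp, hq]
      nlinarith
    · rintro _ ⟨g, hg, rfl⟩
      have hg' : ¬ (p g ^ 2 < p g * q g ∨ p g = 0) := hg
      have hp : p ((pp 1)⁻¹ * g) = p g := by
        rw [pmul, show (pp 1)⁻¹.1 0 0 = 1 by decide, show (pp 1)⁻¹.1 0 1 = 0 by decide]
        ring
      have hq : q ((pp 1)⁻¹ * g) = - 2 * p g + q g := by
        rw [qmul, show (pp 1)⁻¹.1 1 0 = -2 by decide, show (pp 1)⁻¹.1 1 1 = 1 by decide]
        ring
      show p ((pp 1)⁻¹ * g) * q ((pp 1)⁻¹ * g) ≤ - p ((pp 1)⁻¹ * g) ^ 2 ∧ p ((pp 1)⁻¹ * g) ≠ 0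
      rw [hp, hq]
      refine ⟨?_, fun h => hg' (Or.inr h)⟩
      have : p g * q g ≤ p g ^ 2 := not_lt.1 fun h => hg' (Or.inl h)
      nlinarith

end BraidGroup

namespace BraidGroup

open SemidirectProduct

theorem even_lin_sub {g h : BraidGroup 3} (hp : perm 3 g = perm 3 h) (i j : Fin 2) :
    Even ((lin (qd g)).1 i j - (lin (qd h)).1 i j) := by
  obtain ⟨u, hu⟩ := conj_jF g
  obtain ⟨v, hv⟩ := conj_jF h
  have key : ∀ f : F 2, ∀ j < 2, Even (ab (tw (qd g) f) j - ab (tw (qd h) f) j) := fun f j hj => by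
    have : perm 3 (jF (u * tw (qd g) f * u⁻¹)) = perm 3 (jF (v * tw (qd h) f * v⁻¹)) := by
      rw [← hu, ← hv]
      simp only [map_mul, map_inv, hp]
    simpa [ab_mul, ab_inv] using even_ab_of_perm_eq this hj
  have h00 := key (X 2 0) 0 (by omega)
  have h01 := key (X 2 1) 0 (by omega)
  have h10 := key (X 2 0) 1 (by omega)
  have h11 := key (X 2 1) 1 (by omega)
  simp (disch := omega) only [(ab_tw _ _).1, (ab_tw _ _).2, ab_X] at h00 h01 h10 h11
  fin_cases i <;> fin_cases j
  · simpa using h00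
  · simpa using h01
  · simpa using h10
  · simpa using h11

theorem vx_zpow_odd {n : ℤ} (h : Odd n) : vx ^ n = vx := by
  obtain ⟨k, rfl⟩ := h
  rw [zpow_add, zpow_mul, zpow_ofNat, vx_sq]; simp

theorem vx_zpow_even {n : ℤ} (h : Even n) : vx ^ n = 1 := by
  obtain ⟨k, rfl⟩ := h
  rw [← two_mul, zpow_mul, zpow_ofNat, vx_sq]; simp

theorem vy_zpow_odd {n : ℤ} (h : Odd n) : vy ^ n = vy := by
  obtain ⟨k, rfl⟩ := h
  rw [zpow_add, zpow_mul, zpow_ofNat, vy_sq]; simp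

theorem vy_zpow_even {n : ℤ} (h : Even n) : vy ^ n = 1 := by
  obtain ⟨k, rfl⟩ := h
  rw [← two_mul, zpow_mul, zpow_ofNat, vy_sq]; simp

theorem isPure_of_lin {b : BraidGroup 2} (h00 : Odd ((lin b).1 0 0)) (h01 : Even ((lin b).1 0 1))
    (h10 : Even ((lin b).1 1 0)) (h11 : Odd ((lin b).1 1 1)) : IsPure b := by
  have key : ∀ f : F 2, perm 2 b * perm 3 (jF f) = perm 3 (jF (tw b f)) * perm 2 b := fun f => by
    rw [incl_mul_jF, map_mul, map_mul, map_inv, perm_incl, inv_mul_cancel_right]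
  have hx : perm 2 b * vx = vx * perm 2 b := by
    have := key (X 2 0)
    rw [perm_jF, perm_jF, (ab_tw _ _).1, (ab_tw _ _).2] at this
    simp (disch := omega) only [ab_X] at this
    simpa [vx_zpow_odd h00, vy_zpow_even h10] using this
  have hy : perm 2 b * vy = vy * perm 2 b := by
    have := key (X 2 1)
    rw [perm_jF, perm_jF, (ab_tw _ _).1, (ab_tw _ _).2] at this
    simp (disch := omega) only [ab_X] at this
    simpa [vx_zpow_even h01, vy_zpow_odd h11] using this
  have h3 : perm 2 b 3 = 3 := perm_of_gt _ (by omega)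
  have h2 : perm 2 b 2 = 2 := by
    have := DFunLike.congr_fun hx 3
    rwa [Equiv.Perm.mul_apply, Equiv.Perm.mul_apply, h3, show vx 3 = 2 by decide] at this
  have h0 : perm 2 b 0 = 0 := by
    have := DFunLike.congr_fun hy 3
    rwa [Equiv.Perm.mul_apply, Equiv.Perm.mul_apply, h3, show vy 3 = 0 by decide] at this
  have h1 : perm 2 b 1 = 1 := by
    have := DFunLike.congr_fun hx 0
    rwa [Equiv.Perm.mul_apply, Equiv.Perm.mul_apply, h0, show vx 0 = 1 by decide] at this
  refine Equiv.ext fun k => ?_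
  rcases (show k = 0 ∨ k = 1 ∨ k = 2 ∨ 2 < k by omega) with rfl | rfl | rfl | h
  · exact h0
  · exact h1
  · exact h2
  · exact perm_of_gt _ h

theorem lin_ιF_injective : Function.Injective (lin.comp (ιF 1)) := by
  let θ : F 2 →* F 2 := flift fun k => if k = 0 then X 2 0 * X 2 1 else X 2 1
  let θ' : F 2 →* F 2 := flift fun k => if k = 0 then X 2 0 * (X 2 1)⁻¹ else X 2 1
  have hθ : θ.comp θ' = MonoidHom.id _ := fhom_ext fun k hk => by
    interval_cases k <;> simp (disch := omega) [θ, θ', flift_X]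
  have hP : P 1 = X 2 0 * X 2 1 := by simp [P, bp]
  have hz1 : z 1 = σ 1 0 ^ 2 := by
    rw [z_succ, P, bp_succ, show bp 1 0 = 1 from rfl, one_mul, ιF_X le_rfl, bX_self]; simp [z]
  have h0 : ιF 1 (P 1) = z 2 * (σ 2 0 ^ 2)⁻¹ := by
    rw [z_succ, hz1, map_pow, incl_σ (by omega), mul_inv_cancel_right]
  have hpp : (lin.comp (ιF 1)).comp θ = flift pp := fhom_ext fun k hk => by
    interval_cases k
    · show lin (ιF 1 (θ (X 2 0))) = _
      rw [flift_X (by omega), flift_X (by omega), if_pos rfl, ← hP, h0, map_mul, lin_z, map_inv,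
        map_pow, lin_σ0]
      decide
    · show lin (ιF 1 (θ (X 2 1))) = _
      rw [flift_X (by omega), flift_X (by omega), if_neg (by omega), ιF_X le_rfl, bX_self, map_pow,
        lin_σ1]
      decide
  rw [injective_iff_map_eq_one]
  intro w hw
  have hw' : w = θ (θ' w) := (DFunLike.congr_fun hθ w).symm
  have : flift pp (θ' w) = 1 := by
    rw [← hpp, MonoidHom.comp_apply, ← hw', hw]
  rw [(injective_iff_map_eq_one _).1 flift_pp_injective _ this, map_one] at hw'
  exact hw'

/-- The kernel of the linear representation. -/
theorem exists_of_lin_eq_one {b : BraidGroup 2} (h : lin b = 1) : ∃ l : ℤ, b = z 2 ^ (2 * l) := by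
  have hb : IsPure b := isPure_of_lin (by rw [h]; simp) (by rw [h]; simp) (by rw [h]; simp)
    (by rw [h]; simp)
  have hι := eq_ι_of_perm (m := 1) (g := b) (by rw [hb]; rfl)
  set v := coc b 2
  have ha : IsPure v.right := by
    rw [IsPure, ← perm_ι, ← hι]
    exact hb
  have hB : ∀ x y : BraidGroup 1, Commute x y := fun x y => by
    refine commute_of_σ (f := MonoidHom.id _) (fun i hi => ?_) y
    refine (commute_of_σ (f := MonoidHom.id _) (fun j hj => ?_) x).symm
    obtain rfl : i = 0 := by omega
    obtain rfl : j = 0 := by omega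
    exact Commute.refl _
  obtain ⟨l, hl⟩ := pure_central ha (hB _)
  have hz : incl 1 (z 1) = ιF 1 (P 1)⁻¹ * z 2 := by
    rw [z_succ (m := 1), map_inv, inv_mul_cancel_left]
  have hf : b = ιF 1 (v.left * (P 1)⁻¹ ^ l) * z 2 ^ l := by
    calc b = ι 1 (inl v.left * inr v.right) := by rw [inl_left_mul_inr_right, ← hι]
      _ = _ := by
        rw [map_mul, ι_inl, ι_inr, hl, map_zpow, hz, ((z_comm _).symm : Commute _ (z 2)).mul_zpow,
          map_mul, map_zpow, mul_assoc]
  generalize v.left * (P 1)⁻¹ ^ l = f at hf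
  have hlz : ∀ k : ℤ, lin (z 2 ^ (2 * k)) = 1 := fun k => by
    rw [map_zpow, lin_z, zpow_mul]
    have : (-1 : Matrix.SpecialLinearGroup (Fin 2) ℤ) ^ (2 : ℤ) = 1 := by decide
    rw [this, one_zpow]
  have hb2 : b ^ 2 = ιF 1 (f ^ 2) * z 2 ^ (2 * l) := by
    rw [hf, ((z_comm _).zpow_left l).symm.mul_pow, map_pow, ← zpow_natCast (z 2 ^ l), ← zpow_mul,
      mul_comm l]; rfl
  have h2 : (lin.comp (ιF 1)) (f ^ 2) = 1 := by
    have := congrArg lin hb2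
    rwa [map_pow, h, one_pow, map_mul, hlz, mul_one, eq_comm] at this
  have h3 : f ^ 2 = 1 := (injective_iff_map_eq_one _).1 lin_ιF_injective _ h2
  have h4 : f = 1 := (pow_eq_one_iff_left (by norm_num)).1 h3
  rw [h4, map_one, one_mul] at hf
  rcases Int.even_or_odd' l with ⟨k, rfl | rfl⟩
  · exact ⟨k, hf⟩
  · rw [hf, zpow_add, map_mul, hlz, zpow_one, lin_z] at h
    exact absurd h (by decide)

end BraidGroup

namespace BraidGroup

open SemidirectProduct

theorem exp_z2 : exp (z 2) = 6 := by
  rw [z2_eq]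
  simp (disch := omega) [exp_mul, exp_pow, exp_σ]

theorem exp_eq_of_isConj {m : ℕ} {g h : BraidGroup m} (H : IsConj g h) : exp g = exp h := by
  obtain ⟨c, rfl⟩ := isConj_iff.1 H
  simp

theorem eq_one_of_commute {k u v : F 2} (hu0 : ab u 0 ≠ 0) (hv0 : ab v 0 = 0) (hv1 : ab v 1 ≠ 0)
    (hu : Commute k u) (hv : Commute k v) : k = 1 := by
  obtain ⟨c, p, q, rfl, rfl⟩ := FreeGroup.exists_zpow_of_commute hu
  by_cases hp : p = 0
  · rw [hp, zpow_zero]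
  exfalso
  have h1 : Commute v (c ^ q) := (commute_of_commute_zpow hp hv.symm).zpow_right q
  obtain ⟨d, r, s, h2, h3⟩ := FreeGroup.exists_zpow_of_commute h1
  rw [h3, ab_zpow] at hu0
  rw [h2, ab_zpow] at hv0 hv1
  rcases mul_eq_zero.1 hv0 with h | h
  · exact hv1 (by rw [h, zero_mul])
  · exact hu0 (by rw [h, mul_zero])

/-- A square root of the central element of the braid group on four strands. -/
def jc : BraidGroup 3 := jx⁻¹ * incl 2 (z 2)

theorem ιF_P1 : ιF 1 (P 1) = σ 2 1 * σ 2 0 ^ 2 * σ 2 1 := by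
  have hz1 : z 1 = σ 1 0 ^ 2 := by
    rw [z_succ, P, bp_succ, show bp 1 0 = 1 from rfl, one_mul, ιF_X le_rfl, bX_self]; simp [z]
  have h0 : ιF 1 (P 1) = z 2 * (σ 2 0 ^ 2)⁻¹ := by
    rw [z_succ, hz1, map_pow, incl_σ (by omega), mul_inv_cancel_right]
  rw [h0, z2_eq, mul_inv_cancel_right]

theorem qd_jc : qd jc = z 2 := by
  rw [jc, map_mul, qd_incl, ← jF_zero, ← map_inv, qd_jF, one_mul]

theorem jc_comm : Commute jc (σ 3 0) := by
  have h1 : Commute (incl 2 (z 2)) (σ 3 0) := by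
    rw [← incl_σ (show 0 < 2 by omega)]
    exact (z_comm _).map (incl 2)
  have h2 : Commute jx (σ 3 0) := (Commute.refl _).mul_left comm3_02.symm.inv_left
  exact h2.inv_left.mul_left h1

theorem jc_sq : jc ^ 2 = z 3 := by
  have h1 : Commute (incl 2 (z 2)) (σ 3 0) := by
    rw [← incl_σ (show 0 < 2 by omega)]
    exact (z_comm _).map (incl 2)
  have hz : incl 2 (z 2) = σ 3 1 * σ 3 0 ^ 2 * σ 3 1 * σ 3 0 ^ 2 := by
    rw [z2_eq]
    simp (disch := omega) only [map_mul, map_pow, incl_σ]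
  rw [z_succ, ιF_P_succ, ιF_P1]
  simp (disch := omega) only [map_mul, map_pow, incl_σ]
  have h2 : (σ 3 0)⁻¹ * incl 2 (z 2) * (σ 3 0)⁻¹ = σ 3 1 * σ 3 0 ^ 2 * σ 3 1 := by
    rw [← h1.inv_right.eq, hz]; group
  have h3 : jx⁻¹ = σ 3 2 * (σ 3 0)⁻¹ := by rw [jx]; group
  have h4 : jx⁻¹ = (σ 3 0)⁻¹ * σ 3 2 := by rw [h3, comm3_02.inv_left.symm.eq]
  calc jc ^ 2 = jx⁻¹ * incl 2 (z 2) * (jx⁻¹ * incl 2 (z 2)) := pow_two _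
    _ = σ 3 2 * ((σ 3 0)⁻¹ * incl 2 (z 2) * (σ 3 0)⁻¹) * σ 3 2 * incl 2 (z 2) := by
      conv_lhs => enter [2, 1]; rw [h4]
      rw [h3]; group
    _ = _ := by rw [h2]

/-- Conjugation by `jc`, on the free group. -/
def γc : F 2 →* F 2 :=
  flift fun k => if k = 0 then X 2 1 * (X 2 0)⁻¹ * (X 2 1)⁻¹ else (X 2 1)⁻¹

theorem tw_z : tw (z 2) (X 2 0) = X 2 0 * X 2 1 * (X 2 0)⁻¹ * (X 2 1)⁻¹ * (X 2 0)⁻¹ ∧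
    tw (z 2) (X 2 1) = X 2 0 * (X 2 1)⁻¹ * (X 2 0)⁻¹ := by
  rw [z2_eq]
  simp only [map_mul, map_pow, tw_σ0, tw_σ1, MulAut.mul_apply, pow_two, twAut0_zero, twAut0_one,
    twAut1_zero, twAut1_one, map_inv]
  constructor <;> group

theorem jc_mul_jF (f : F 2) : jc * jF f * jc⁻¹ = jF (γc f) := by
  have h : ∀ f, jc * jF f * jc⁻¹ = jF ((X 2 0)⁻¹ * tw (z 2) f * X 2 0) := fun f => by
    rw [map_mul, map_mul, incl_mul_jF, map_inv, jF_zero, jc]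
    group
  rw [h]
  congr 1
  have key : (MulAut.conj (X 2 0)⁻¹).toMonoidHom.comp (tw (z 2)).toMonoidHom = γc := by
    refine fhom_ext fun k hk => ?_
    show (X 2 0)⁻¹ * tw (z 2) _ * (X 2 0)⁻¹⁻¹ = _
    interval_cases k
    · rw [tw_z.1, γc, flift_X (by omega), if_pos rfl]; group
    · rw [tw_z.2, γc, flift_X (by omega), if_neg (by omega)]; group
  have := DFunLike.congr_fun key f
  rw [← this]
  show _ = (X 2 0)⁻¹ * tw (z 2) _ * (X 2 0)⁻¹⁻¹
  rw [inv_inv]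

section

variable {Φ : BraidGroup 3 →* BraidGroup 3}

theorem qd_map_jF (Φ : BraidGroup 3 →* BraidGroup 3) (f : F 2) : qd (Φ (jF f)) = 1 := by
  have hJ : lin (qd (Φ (σ 3 0))) = lin (qd (Φ (σ 3 2))) := by
    refine Matrix.SpecialLinearGroup.eq_of_braid (b := lin (qd (Φ (σ 3 1)))) ?_ ?_ ?_
    · simp only [← map_mul, braid3_01]
    · simp only [← map_mul, braid3_12]
    · simp only [← map_mul, comm3_02.eq]
  have hx : qd (Φ jx) = 1 := by
    have h1 : lin (qd (Φ jx)) = 1 := by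
      rw [jx]
      simp only [map_mul, map_inv, hJ, mul_inv_cancel]
    obtain ⟨l, hl⟩ := exists_of_lin_eq_one h1
    have h2 : exp (qd (Φ jx)) = 0 := by
      rw [jx, map_mul, map_inv, map_mul, map_inv, exp_mul, exp_inv, exp_qd, exp_qd,
        exp_eq_of_isConj (MonoidHom.map_isConj Φ (σ_isConj (m := 3) (i := 2) (by omega))),
        add_neg_cancel]
    rw [hl, exp_zpow, exp_z2] at h2
    rw [hl, show l = 0 by omega]; simp
  refine DFunLike.congr_fun (f := (qd.comp Φ).comp jF) (g := 1) (fhom_ext fun k hk => ?_) f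
  show qd (Φ (jF _)) = 1
  interval_cases k
  · rw [jF_zero, hx]
  · rw [jF_one, jy]
    simp only [map_mul, map_inv, hx]
    group

theorem qd_map (Φ : BraidGroup 3 →* BraidGroup 3) (g : BraidGroup 3) :
    qd (Φ g) = qd (Φ (incl 2 (qd g))) := by
  obtain ⟨f, hf⟩ := eq_jF_mul g
  conv_lhs => rw [hf]
  rw [map_mul, map_mul, qd_map_jF, one_mul]

theorem exists_jF_descend (Φ : BraidGroup 3 →* BraidGroup 3) :
    ∃ φ : F 2 →* F 2, ∀ f, Φ (jF f) = jF (φ f) := by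
  choose u hu using fun k => exists_jF_of_qd (qd_map_jF Φ (X 2 k))
  refine ⟨flift u, DFunLike.congr_fun (f := Φ.comp jF) (g := jF.comp (flift u)) (fhom_ext fun k hk => ?_)⟩
  rw [MonoidHom.comp_apply, MonoidHom.comp_apply, flift_X hk, hu]

end

end BraidGroup

/-- A nonzero integral `2 × 2` matrix which normalises `SL(2, ℤ)` is a multiple of a unimodular
matrix. -/
theorem Int.exists_eq_mul_unimodular {a b c d : ℤ} (hD : a * d - b * c ≠ 0)
    (haa : a * d - b * c ∣ a * a) (hab : a * d - b * c ∣ a * b) (hac : a * d - b * c ∣ a * c)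
    (had : a * d - b * c ∣ a * d) (hbb : a * d - b * c ∣ b * b) (hbc : a * d - b * c ∣ b * c)
    (hbd : a * d - b * c ∣ b * d) (hcc : a * d - b * c ∣ c * c) (hcd : a * d - b * c ∣ c * d)
    (hdd : a * d - b * c ∣ d * d) :
    ∃ g a0 b0 c0 d0 : ℤ, a = g * a0 ∧ b = g * b0 ∧ c = g * c0 ∧ d = g * d0 ∧
      (a0 * d0 - b0 * c0 = 1 ∨ a0 * d0 - b0 * c0 = -1) := by
  have key : ∀ x y : ℤ, ∃ g x0 y0 u v, x = g * x0 ∧ y = g * y0 ∧ g = u * x + v * y := fun x y =>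
    ⟨Int.gcd x y, x / Int.gcd x y, y / Int.gcd x y, Int.gcdA x y, Int.gcdB x y,
      (Int.mul_ediv_cancel' (Int.gcd_dvd_left x y)).symm,
      (Int.mul_ediv_cancel' (Int.gcd_dvd_right x y)).symm, by rw [Int.gcd_eq_gcd_ab]; ring⟩
  obtain ⟨g1, a1, b1, u1, v1, h1, h2, h3⟩ := key a b
  obtain ⟨g2, c1, d1, u2, v2, h4, h5, h6⟩ := key c d
  obtain ⟨g, e1, e2, u, v, h7, h8, h9⟩ := key g1 g2
  have ha : a = g * (e1 * a1) := by rw [h1, h7]; ring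
  have hb : b = g * (e1 * b1) := by rw [h2, h7]; ring
  have hc : c = g * (e2 * c1) := by rw [h4, h8]; ring
  have hd : d = g * (e2 * d1) := by rw [h5, h8]; ring
  refine ⟨g, e1 * a1, e1 * b1, e2 * c1, e2 * d1, ha, hb, hc, hd, ?_⟩
  have hg : g = (u * u1) * a + (u * v1) * b + (v * u2) * c + (v * v2) * d := by
    rw [h3, h6] at h9
    rw [h9]; ring
  have hgg : a * d - b * c ∣ g * g := by
    generalize u * u1 = p at hg
    generalize u * v1 = q at hg
    generalize v * u2 = r at hg
    generalize v * v2 = s at hg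
    have : g * g = p * p * (a * a) + 2 * p * q * (a * b) + 2 * p * r * (a * c) +
        2 * p * s * (a * d) + q * q * (b * b) + 2 * q * r * (b * c) + 2 * q * s * (b * d) +
        r * r * (c * c) + 2 * r * s * (c * d) + s * s * (d * d) := by
      rw [hg]; ring
    rw [this]
    exact ((((((((((haa.mul_left _).add (hab.mul_left _)).add (hac.mul_left _)).add
      (had.mul_left _)).add (hbb.mul_left _)).add (hbc.mul_left _)).add (hbd.mul_left _)).add
      (hcc.mul_left _)).add (hcd.mul_left _)).add (hdd.mul_left _))
  set D0 := e1 * a1 * (e2 * d1) - e1 * b1 * (e2 * c1)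
  have hDD : a * d - b * c = g * g * D0 := by
    simp only [D0]
    rw [ha, hb, hc, hd]; ring
  rw [hDD] at hgg hD
  have hgg0 : g * g ≠ 0 := left_ne_zero_of_mul hD
  have : D0 ∣ 1 := by
    rw [← mul_dvd_mul_iff_left hgg0, mul_one]
    exact hgg
  exact Int.isUnit_iff.1 (isUnit_of_dvd_one this)

namespace BraidGroup

open SemidirectProduct

theorem ab_eq_of_flift (φ : F 2 →* F 2) (f : F 2) (j : ℕ) :
    ab (φ f) j = ab (φ (X 2 0)) j * ab f 0 + ab (φ (X 2 1)) j * ab f 1 := by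
  let S : Subgroup (F 2) :=
    { carrier := {f | ab (φ f) j = ab (φ (X 2 0)) j * ab f 0 + ab (φ (X 2 1)) j * ab f 1}
      one_mem' := by simp
      mul_mem' := fun {a b} (ha : _ = _) (hb : _ = _) => by
        show ab _ _ = _
        rw [map_mul, ab_mul, ha, hb, ab_mul, ab_mul]; ring
      inv_mem' := fun {a} (ha : _ = _) => by
        show ab _ _ = _
        rw [map_inv, ab_inv, ha, ab_inv, ab_inv]; ring }
  refine mem_of_X_mem (S := S) (fun i hi => ?_) f
  show ab _ _ = _
  interval_cases i <;> simp (disch := omega) [ab_X]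

section

variable {Φ : BraidGroup 3 →* BraidGroup 3} {φ : F 2 →* F 2}

/-- The linearised intertwining relation. -/
theorem ab_intertwine (hφ : ∀ f, Φ (jF f) = jF (φ f)) (b : BraidGroup 2) (f : F 2) {j : ℕ} :
    ab (φ (tw b f)) j = ab (tw (qd (Φ (incl 2 b))) (φ f)) j := by
  obtain ⟨u, hu⟩ := conj_jF (Φ (incl 2 b))
  have h1 : φ (tw b f) = u * tw (qd (Φ (incl 2 b))) (φ f) * u⁻¹ := by
    apply jF_injective
    rw [← hu, ← hφ, ← hφ, incl_mul_jF]
    simp only [map_mul, map_inv]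
  rw [h1, ab_mul, ab_mul, ab_inv]
  ring

theorem matrix_intertwine (hφ : ∀ f, Φ (jF f) = jF (φ f)) (b : BraidGroup 2) :
    !![ab (φ (X 2 0)) 0, ab (φ (X 2 1)) 0; ab (φ (X 2 0)) 1, ab (φ (X 2 1)) 1] * (lin b).1 =
    (lin (qd (Φ (incl 2 b)))).1 *
      !![ab (φ (X 2 0)) 0, ab (φ (X 2 1)) 0; ab (φ (X 2 0)) 1, ab (φ (X 2 1)) 1] := by
  have h : ∀ k < 2, ∀ j, ab (φ (X 2 0)) j * ab (tw b (X 2 k)) 0 +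
      ab (φ (X 2 1)) j * ab (tw b (X 2 k)) 1 = ab (tw (qd (Φ (incl 2 b))) (φ (X 2 k))) j :=
    fun k hk j => by rw [← ab_eq_of_flift, ab_intertwine hφ]
  have h00 := h 0 (by omega) 0
  have h01 := h 0 (by omega) 1
  have h10 := h 1 (by omega) 0
  have h11 := h 1 (by omega) 1
  simp (disch := omega) only [(ab_tw _ _).1, (ab_tw _ _).2, ab_X] at h00 h01 h10 h11
  refine Matrix.ext fun i j => ?_
  rw [Matrix.mul_apply, Matrix.mul_apply, Fin.sum_univ_two, Fin.sum_univ_two]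
  fin_cases i <;> fin_cases j
  · simpa using h00
  · simpa using h10
  · simpa using h01
  · simpa using h11

theorem exists_unimodular (hp : ∀ g, perm 3 (Φ g) = perm 3 g) (hφ : ∀ f, Φ (jF f) = jF (φ f)) :
    ∃ g a0 b0 c0 d0 : ℤ, ab (φ (X 2 0)) 0 = g * a0 ∧ ab (φ (X 2 1)) 0 = g * b0 ∧
      ab (φ (X 2 0)) 1 = g * c0 ∧ ab (φ (X 2 1)) 1 = g * d0 ∧
      (a0 * d0 - b0 * c0 = 1 ∨ a0 * d0 - b0 * c0 = -1) ∧
      Odd (ab (φ (X 2 0)) 0) ∧ Even (ab (φ (X 2 1)) 0) ∧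
      Even (ab (φ (X 2 0)) 1) ∧ Odd (ab (φ (X 2 1)) 1) := by
  have hpar : ∀ f, ∀ j < 2, Even (ab (φ f) j - ab f j) := fun f j hj =>
    even_ab_of_perm_eq (by rw [← hφ, hp]) hj
  have p00 := hpar (X 2 0) 0 (by omega)
  have p01 := hpar (X 2 0) 1 (by omega)
  have p10 := hpar (X 2 1) 0 (by omega)
  have p11 := hpar (X 2 1) 1 (by omega)
  simp (disch := omega) [ab_X, Int.even_sub_one] at p00 p01 p10 p11
  have hI := matrix_intertwine hφ
  set a := ab (φ (X 2 0)) 0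
  set b := ab (φ (X 2 1)) 0
  set c := ab (φ (X 2 0)) 1
  set d := ab (φ (X 2 1)) 1
  have hodd : Odd (a * d - b * c) := (p00.mul p11).sub_even (p10.mul_right _)
  have hD : a * d - b * c ≠ 0 := fun h => by rw [h] at hodd; exact absurd hodd (by decide)
  have key : ∀ r : Matrix.SpecialLinearGroup (Fin 2) ℤ,
      a * d - b * c ∣ (a * r.1 0 0 + b * r.1 1 0) * d - (a * r.1 0 1 + b * r.1 1 1) * c ∧
      a * d - b * c ∣ -(a * r.1 0 0 + b * r.1 1 0) * b + (a * r.1 0 1 + b * r.1 1 1) * a ∧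
      a * d - b * c ∣ (c * r.1 0 0 + d * r.1 1 0) * d - (c * r.1 0 1 + d * r.1 1 1) * c := by
    intro r
    obtain ⟨x, rfl⟩ := lin_surjective r
    have h := fun i j => congrFun (congrFun (hI x) i) j
    have h00 := h 0 0
    have h01 := h 0 1
    have h10 := h 1 0
    have h11 := h 1 1
    simp [Matrix.mul_apply, Fin.sum_univ_two] at h00 h01 h10 h11
    rw [h00, h01, h10, h11]
    exact ⟨⟨(lin (qd (Φ (incl 2 x)))).1 0 0, by ring⟩, ⟨(lin (qd (Φ (incl 2 x)))).1 0 1, by ring⟩,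
      ⟨(lin (qd (Φ (incl 2 x)))).1 1 0, by ring⟩⟩
  have hu := key ⟨!![1, 1; 0, 1], by simp⟩
  have hl := key ⟨!![1, 0; 1, 1], by simp⟩
  have hw := key ⟨!![0, 1; -1, 2], by simp⟩
  simp only [Matrix.of_apply, Matrix.cons_val', Matrix.cons_val_zero, Matrix.cons_val_one,
    Matrix.cons_val_fin_one] at hu hl hw
  obtain ⟨t, ht⟩ := hodd
  have half : ∀ x, a * d - b * c ∣ 2 * x → a * d - b * c ∣ x := fun x ⟨k, hk⟩ =>
    ⟨x - t * k, by linear_combination (-x) * ht + (-t) * hk⟩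
  obtain ⟨⟨u1, hu1⟩, ⟨u2, hu2⟩, ⟨u3, hu3⟩⟩ := hu
  obtain ⟨⟨l1, hl1⟩, ⟨l2, hl2⟩, ⟨l3, hl3⟩⟩ := hl
  obtain ⟨⟨w1, hw1⟩, ⟨w2, hw2⟩, ⟨w3, hw3⟩⟩ := hw
  have hac : a * d - b * c ∣ a * c := ⟨1 - u1, by linear_combination -hu1⟩
  have haa : a * d - b * c ∣ a * a := ⟨u2, by linear_combination hu2⟩
  have hcc : a * d - b * c ∣ c * c := ⟨-u3, by linear_combination -hu3⟩
  have hbd : a * d - b * c ∣ b * d := ⟨l1 - 1, by linear_combination hl1⟩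
  have hbb : a * d - b * c ∣ b * b := ⟨-l2, by linear_combination -hl2⟩
  have hdd : a * d - b * c ∣ d * d := ⟨l3, by linear_combination hl3⟩
  have hbc : a * d - b * c ∣ b * c :=
    half _ ⟨-w1 - (l1 - 1) - (1 - u1), by linear_combination -hw1 - hl1 + hu1⟩
  have hab : a * d - b * c ∣ a * b :=
    half _ ⟨w2 - u2 + l2, by linear_combination hw2 - hu2 + hl2⟩
  have hcd : a * d - b * c ∣ c * d :=
    half _ ⟨-w3 - l3 + u3, by linear_combination -hw3 - hl3 + hu3⟩
  have had : a * d - b * c ∣ a * d := by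
    have := hbc.add (dvd_refl (a * d - b * c))
    rwa [add_sub_cancel] at this
  obtain ⟨g, a0, b0, c0, d0, h1, h2, h3, h4, h5⟩ :=
    Int.exists_eq_mul_unimodular hD haa hab hac had hbb hbc hbd hcc hcd hdd
  exact ⟨g, a0, b0, c0, d0, h1, h2, h3, h4, h5, p00, p10, p01, p11⟩

end

end BraidGroup

namespace BraidGroup

open SemidirectProduct

variable {Φ : BraidGroup 3 →* BraidGroup 3} {φ : F 2 →* F 2}

theorem qd_z3 : qd (z 3) = z 2 ^ 2 := by rw [← jc_sq, map_pow, qd_jc]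

theorem isStd_of_unimodular
    (H : ∀ Φ : BraidGroup 3 →* BraidGroup 3, (∀ g, perm 3 (Φ g) = perm 3 g) →
      (∀ g, qd (Φ g) = qd g) → IsStd Φ)
    (hp : ∀ g, perm 3 (Φ g) = perm 3 g) (hφ : ∀ f, Φ (jF f) = jF (φ f))
    {g a0 b0 c0 d0 : ℤ} (ha : ab (φ (X 2 0)) 0 = g * a0) (hb : ab (φ (X 2 1)) 0 = g * b0)
    (hc : ab (φ (X 2 0)) 1 = g * c0) (hd : ab (φ (X 2 1)) 1 = g * d0)
    (hdet : a0 * d0 - b0 * c0 = 1)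
    (oa : Odd (ab (φ (X 2 0)) 0)) (eb : Even (ab (φ (X 2 1)) 0))
    (ec : Even (ab (φ (X 2 0)) 1)) (od : Odd (ab (φ (X 2 1)) 1)) : IsStd Φ := by
  have hI := matrix_intertwine hφ
  rw [ha, hb, hc, hd] at hI
  rw [ha, Int.odd_mul] at oa
  rw [hb, Int.even_mul] at eb
  rw [hc, Int.even_mul] at ec
  rw [hd, Int.odd_mul] at od
  have hge : ¬ Even g := Int.not_even_iff_odd.2 oa.1
  obtain ⟨b, hb⟩ := lin_surjective ⟨!![a0, b0; c0, d0], by rw [Matrix.det_fin_two_of, hdet]⟩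
  have hbp : IsPure b := isPure_of_lin (by rw [hb]; exact oa.2) (by rw [hb]; exact eb.resolve_left hge)
    (by rw [hb]; exact ec.resolve_left hge) (by rw [hb]; exact od.2)
  have hbp' : IsPure (incl 2 b) := by rw [IsPure, perm_incl]; exact hbp
  have hlin : ∀ c, lin (qd (Φ (incl 2 c))) = lin b * lin c * (lin b)⁻¹ := fun c => by
    rw [eq_mul_inv_iff_mul_eq]
    refine Subtype.ext ?_
    have hg : g ≠ 0 := fun h => hge (by rw [h]; exact Even.zero)
    have h1 : !![g * a0, g * b0; g * c0, g * d0] = g • (lin b).1 := by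
      rw [hb]
      ext i j
      fin_cases i <;> fin_cases j <;> simp
    have := hI c
    rw [h1, Matrix.smul_mul, Matrix.mul_smul] at this
    exact (smul_right_injective _ hg this).symm
  refine IsStd.of_conj hbp'.inv ?_
  set Ψ := (MulAut.conj (incl 2 b)⁻¹).toMonoidHom.comp Φ with hΨ
  have hΨ' : ∀ g, Ψ g = (incl 2 b)⁻¹ * Φ g * (incl 2 b)⁻¹⁻¹ := fun g => rfl
  have hΨp : ∀ g, perm 3 (Ψ g) = perm 3 g := fun g => by
    rw [hΨ', map_mul, map_mul, hbp'.inv, hbp'.inv.inv, hp, one_mul, mul_one]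
  have hlin' : ∀ c, lin (qd (Ψ (incl 2 c)) * c⁻¹) = 1 := fun c => by
    rw [hΨ']
    simp only [map_mul, map_inv, hlin, qd_incl]
    group
  choose l hl using fun c => exists_of_lin_eq_one (hlin' c)
  have hl' : ∀ c, qd (Ψ (incl 2 c)) = c * z 2 ^ (2 * l c) := fun c => by
    rw [← (z_zpow_comm _ c).eq, ← hl, inv_mul_cancel_right]
  have hl0 : l (σ 2 1) = l (σ 2 0) := by
    have h := exp_eq_of_isConj (MonoidHom.map_isConj (qd.comp (Ψ.comp (incl 2)))
      (σ_isConj (m := 2) (i := 1) (by omega)))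
    simp only [MonoidHom.comp_apply, hl', exp_mul, exp_zpow, exp_z2] at h
    rw [exp_σ (by omega), exp_σ (by omega)] at h
    omega
  refine IsStd.of_trv (l := -l (σ 2 0)) (H _ (fun g => by rw [perm_trv, hΨp]) ?_)
  have h1 : ∀ c, qd (trv Ψ (-l (σ 2 0)) (incl 2 c)) = c := by
    refine DFunLike.congr_fun (f := (qd.comp (trv Ψ (-l (σ 2 0)))).comp (incl 2))
      (g := MonoidHom.id _) (hom_ext fun i hi => ?_)
    show qd (trv Ψ _ (incl 2 _)) = _
    have hli : l (σ 2 i) = l (σ 2 0) := by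
      interval_cases i
      · rfl
      · exact hl0
    rw [trv_apply, map_mul, hl', hli, map_zpow, qd_z3, exp_incl, exp_σ hi, mul_assoc,
      ← zpow_natCast, ← zpow_mul, ← zpow_add,
      show 2 * l (σ 2 0) + ((2 : ℕ) : ℤ) * (-l (σ 2 0) * 1) = 0 by push_cast; ring, zpow_zero, mul_one]
    rfl
  intro g
  rw [qd_map, h1]

theorem mirror_jF_zero : mirror 3 jx = jF (X 2 0)⁻¹ := by
  rw [map_inv, jF_zero, jx, map_mul, map_inv, mirror_σ (by omega), mirror_σ (by omega), mul_inv_rev]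
  exact comm3_02.inv_left.inv_right.inv_right.eq

theorem mirror_jF_one : mirror 3 jy = jF (X 2 0 * X 2 1 * (X 2 0)⁻¹) := by
  have h : σ 3 1 * jF (X 2 1) * (σ 3 1)⁻¹ = jF (X 2 1) := by
    have := incl_mul_jF (σ 2 1) (X 2 1)
    rw [tw_σ1, twAut1_one, incl_σ (by omega)] at this
    exact this.symm
  have h0 : σ 3 1 * jF (X 2 0) * (σ 3 1)⁻¹ = jF (X 2 0 * X 2 1) := by
    have := incl_mul_jF (σ 2 1) (X 2 0)
    rw [tw_σ1, twAut1_zero, incl_σ (by omega)] at this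
    exact this.symm
  have h1 : (σ 3 1)⁻¹ * jF (X 2 0) * σ 3 1 = jF (X 2 0) * (jF (X 2 1))⁻¹ := by
    rw [map_mul] at h0
    calc (σ 3 1)⁻¹ * jF (X 2 0) * σ 3 1
        = (σ 3 1)⁻¹ * (jF (X 2 0) * jF (X 2 1)) * σ 3 1 * ((σ 3 1)⁻¹ * jF (X 2 1) * σ 3 1)⁻¹ := by
          group
      _ = jF (X 2 0) * ((σ 3 1)⁻¹ * jF (X 2 1) * σ 3 1)⁻¹ := by rw [← h0]; group
      _ = _ := by
        congr 2
        conv_lhs => rw [← h]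
        group
  rw [jy]
  simp only [map_mul, map_inv, mirror_jF_zero, mirror_σ (show 1 < 3 by omega)]
  calc _ = jF (X 2 0) * ((σ 3 1)⁻¹ * jF (X 2 0) * σ 3 1)⁻¹ := by group
    _ = _ := by rw [h1]; group

theorem rigid_three_of
    (H : ∀ Φ : BraidGroup 3 →* BraidGroup 3, (∀ g, perm 3 (Φ g) = perm 3 g) →
      (∀ g, qd (Φ g) = qd g) → IsStd Φ) : Rigid 3 := by
  intro Φ hp
  obtain ⟨φ, hφ⟩ := exists_jF_descend Φ
  obtain ⟨g, a0, b0, c0, d0, ha, hb, hc, hd, hdet, oa, eb, ec, od⟩ := exists_unimodular hp hφ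
  rcases hdet with hdet | hdet
  · exact isStd_of_unimodular H hp hφ ha hb hc hd hdet oa eb ec od
  · refine IsStd.of_mirror ?_
    obtain ⟨φ', hφ'⟩ := exists_jF_descend (Φ.comp (mirror 3))
    have h0 : φ' (X 2 0) = (φ (X 2 0))⁻¹ := by
      apply jF_injective
      rw [← hφ', MonoidHom.comp_apply, jF_zero, mirror_jF_zero, hφ, map_inv]
    have h1 : φ' (X 2 1) = φ (X 2 0) * φ (X 2 1) * (φ (X 2 0))⁻¹ := by
      apply jF_injective
      rw [← hφ', MonoidHom.comp_apply, jF_one, mirror_jF_one, hφ, map_mul φ, map_mul φ, map_inv φ]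
    have a0' : ∀ j, ab (φ' (X 2 0)) j = - ab (φ (X 2 0)) j := fun j => by rw [h0, ab_inv]
    have a1' : ∀ j, ab (φ' (X 2 1)) j = ab (φ (X 2 1)) j := fun j => by
      rw [h1, ab_mul, ab_mul, ab_inv]; ring
    refine isStd_of_unimodular (g := g) (a0 := -a0) (b0 := b0) (c0 := -c0) (d0 := d0) H
      (fun g => by rw [MonoidHom.comp_apply, hp, perm_mirror]) hφ' ?_ ?_ ?_ ?_ ?_ ?_ ?_ ?_ ?_
    · rw [a0', ha]; ring
    · rw [a1', hb]
    · rw [a0', hc]; ring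
    · rw [a1', hd]
    · linear_combination -hdet
    · rw [a0']; exact oa.neg
    · rw [a1']; exact eb
    · rw [a0']; exact ec.neg
    · rw [a1']; exact od

/-- The central element is fixed. -/
theorem map_z3_of_qd (hp : ∀ g, perm 3 (Φ g) = perm 3 g) (hq : ∀ g, qd (Φ g) = qd g) :
    Φ (z 3) = z 3 := by
  obtain ⟨φ, hφ⟩ := exists_jF_descend Φ
  obtain ⟨g, a0, b0, c0, d0, -, -, -, -, -, oa, eb, ec, od⟩ := exists_unimodular hp hφ
  have hI := matrix_intertwine hφ
  have h0 := congrFun (congrFun (hI (σ 2 0)) 0) 0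
  have h1 := congrFun (congrFun (hI (σ 2 1)) 0) 0
  simp [hq, qd_incl, lin_σ0, lin_σ1, r0, r1, Matrix.mul_apply, Fin.sum_univ_two] at h0 h1
  obtain ⟨k, hk⟩ := exists_jF_of_qd (g := Φ (z 3) * (z 3)⁻¹) (by rw [map_mul, hq, map_inv, mul_inv_cancel])
  have hc : ∀ f, Commute k (φ f) := fun f => by
    have : Commute (jF k) (jF (φ f)) := by
      rw [← hk, ← hφ]
      exact ((z_comm _).map Φ).mul_left (z_comm _).inv_left
    exact jF_injective (by simpa using this.eq)
  have := eq_one_of_commute (k := k) (u := φ (X 2 0)) (v := φ (X 2 1))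
    (fun h => by rw [h] at oa; exact absurd oa (by decide)) (by simpa using h1)
    (fun h => by rw [h] at od; exact absurd od (by decide)) (hc _) (hc _)
  rw [this, map_one] at hk
  exact mul_inv_eq_one.1 hk

end BraidGroup

namespace FreeGroup

variable {α : Type*}

/-- The endomorphism inverting the generators. -/
def flip : FreeGroup α →* FreeGroup α := lift fun a => (of a)⁻¹

theorem flip_mk (L : List (α × Bool)) : flip (mk L) = mk (L.map fun p => (p.1, !p.2)) := by
  induction L with
  | nil => exact _root_.map_one _
  | cons p L ih =>
    rw [show p :: L = [p] ++ L from rfl, ← mul_mk, _root_.map_mul, ih, List.map_append, ← mul_mk]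
    congr 1
    obtain ⟨a, b⟩ := p
    cases b <;> simp [flip, of, inv_mk, invRev]

theorem IsReduced.map_not {L : List (α × Bool)} (h : IsReduced L) :
    IsReduced (L.map fun p => (p.1, !p.2)) := by
  rw [IsReduced, List.isChain_map]
  exact h.imp fun a b hab e => by rw [hab e]

theorem toWord_flip [DecidableEq α] (k : FreeGroup α) :
    (flip k).toWord = k.toWord.map fun p => (p.1, !p.2) := by
  conv_lhs => rw [← mk_toWord (x := k), flip_mk, toWord_mk]
  exact isReduced_toWord.map_not.reduce_eq

theorem eq_one_of_flip_eq {k : FreeGroup α} (h : flip k = k) : k = 1 := by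
  classical
  have h1 := toWord_flip k
  rw [h] at h1
  rw [← toWord_eq_nil_iff]
  cases hk : k.toWord with
  | nil => rfl
  | cons p L =>
    rw [hk] at h1
    have := congrArg Prod.snd (List.cons.inj h1).1
    simp at this

theorem exists_of_palindrome {L : List (α × Bool)} (h : L.Palindrome) :
    ∃ u : FreeGroup α, mk L = u * (flip u)⁻¹ ∨
      ∃ a, mk L = u * of a * (flip u)⁻¹ ∨ mk L = u * (of a)⁻¹ * (flip u)⁻¹ := by
  induction h with
  | nil => exact ⟨1, .inl (by rw [_root_.map_one, inv_one, mul_one, one_eq_mk])⟩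
  | singleton p =>
    obtain ⟨a, b⟩ := p
    refine ⟨1, .inr ⟨a, ?_⟩⟩
    cases b
    · exact .inr (by simp [of, inv_mk, invRev])
    · exact .inl (by simp [of])
  | @cons_concat p L hL ih =>
    obtain ⟨u, hu⟩ := ih
    have e : (flip (mk [p]))⁻¹ = mk [p] := by
      obtain ⟨a, b⟩ := p
      simp [flip_mk, inv_mk, invRev]
    have key : mk (p :: (L ++ [p])) = mk [p] * mk L * (flip (mk [p]))⁻¹ := by
      rw [e, mul_mk, mul_mk]
      rfl
    refine ⟨mk [p] * u, ?_⟩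
    rw [key]
    rcases hu with hu | ⟨a, hu | hu⟩
    · exact .inl (by rw [hu, _root_.map_mul]; group)
    · exact .inr ⟨a, .inl (by rw [hu, _root_.map_mul]; group)⟩
    · exact .inr ⟨a, .inr (by rw [hu, _root_.map_mul]; group)⟩

theorem exists_of_mul_flip {k : FreeGroup α} (h : k * flip k = 1) :
    ∃ u : FreeGroup α, k = u * (flip u)⁻¹ ∨
      ∃ a, k = u * of a * (flip u)⁻¹ ∨ k = u * (of a)⁻¹ * (flip u)⁻¹ := by
  classical
  have h1 := toWord_flip k
  rw [← inv_eq_of_mul_eq_one_right h, toWord_inv, invRev] at h1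
  have h2 : k.toWord.reverse = k.toWord := by
    have h3 := congrArg (List.map fun p : α × Bool => (p.1, !p.2)) h1
    simpa [Function.comp_def] using h3
  have := exists_of_palindrome (List.Palindrome.of_reverse_eq h2)
  rwa [mk_toWord] at this

end FreeGroup

namespace BraidGroup

open SemidirectProduct

variable {Φ : BraidGroup 3 →* BraidGroup 3}

/-- A basis of the free group inverted by the conjugation by `jc`. -/
def ec : F 2 →* F 2 := flift fun j => if j = 0 then X 2 1 else X 2 1 * (X 2 0)⁻¹

/-- The inverse of the change of basis `ec`. -/
def ecInv : F 2 →* F 2 := flift fun j => if j = 0 then (X 2 1)⁻¹ * X 2 0 else X 2 0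

theorem ec_zero : ec (X 2 0) = X 2 1 := flift_X (by omega)
theorem ec_one : ec (X 2 1) = X 2 1 * (X 2 0)⁻¹ := flift_X (by omega)
theorem ecInv_zero : ecInv (X 2 0) = (X 2 1)⁻¹ * X 2 0 := flift_X (by omega)
theorem ecInv_one : ecInv (X 2 1) = X 2 0 := flift_X (by omega)

theorem γc_zero : γc (X 2 0) = X 2 1 * (X 2 0)⁻¹ * (X 2 1)⁻¹ := flift_X (by omega)
theorem γc_one : γc (X 2 1) = (X 2 1)⁻¹ := flift_X (by omega)

theorem ec_ecInv (f : F 2) : ec (ecInv f) = f := by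
  refine DFunLike.congr_fun (f := ec.comp ecInv) (g := MonoidHom.id _) (fhom_ext fun i hi => ?_) f
  show ec (ecInv _) = X 2 i
  interval_cases i
  · rw [ecInv_zero, map_mul, map_inv, ec_zero, ec_one]; group
  · rw [ecInv_one, ec_zero]

theorem ecInv_ec (f : F 2) : ecInv (ec f) = f := by
  refine DFunLike.congr_fun (f := ecInv.comp ec) (g := MonoidHom.id _) (fhom_ext fun i hi => ?_) f
  show ecInv (ec _) = X 2 i
  interval_cases i
  · rw [ec_zero, ecInv_one]
  · rw [ec_one, map_mul, map_inv, ecInv_zero, ecInv_one]; group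

theorem γc_ec (f : F 2) : γc (ec f) = ec (FreeGroup.flip f) := by
  have hX : ∀ i < 2, FreeGroup.flip (X 2 i) = (X 2 i)⁻¹ := fun i hi => by
    rw [X_of_lt hi, FreeGroup.flip, FreeGroup.lift_apply_of]
  refine DFunLike.congr_fun (f := γc.comp ec) (g := ec.comp FreeGroup.flip)
    (fhom_ext fun i hi => ?_) f
  show γc (ec _) = ec (FreeGroup.flip _)
  rw [hX i hi]
  interval_cases i
  · rw [ec_zero, map_inv, ec_zero, γc_one]
  · rw [ec_one, map_inv, ec_one, map_mul, map_inv, γc_zero, γc_one]; group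

theorem ab_γc (f : F 2) {j : ℕ} (hj : j < 2) : ab (γc f) j = - ab f j := by
  rw [ab_eq_of_flift γc f j, γc_zero, γc_one]
  interval_cases j <;> simp [ab_X]

theorem eq_one_of_γc {k : F 2} (h : γc k = k) : k = 1 := by
  have h1 : FreeGroup.flip (ecInv k) = ecInv k := by
    rw [← ecInv_ec (FreeGroup.flip (ecInv k)), ← γc_ec, ec_ecInv, h]
  rw [← ec_ecInv k, FreeGroup.eq_one_of_flip_eq h1, map_one]

theorem exists_of_mul_γc {k : F 2} (h : k * γc k = 1) (he : Even (ab k 1)) :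
    ∃ w, k = w * (γc w)⁻¹ := by
  have h1 : ecInv k * FreeGroup.flip (ecInv k) = 1 := by
    rw [← ecInv_ec (FreeGroup.flip (ecInv k)), ← γc_ec, ec_ecInv, ← map_mul, h, map_one]
  have hof : ∀ a : Fin 2, Odd (ab (ec (FreeGroup.of a)) 1) := fun a => by
    have e : FreeGroup.of a = X 2 a := by rw [X_of_lt a.2]
    rw [e]
    fin_cases a
    · simp [ec_zero, ab_X]
    · simp [ec_one, ab_X, ab_mul, ab_inv]
  obtain ⟨u, hu | ⟨a, hu⟩⟩ := FreeGroup.exists_of_mul_flip h1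
  · exact ⟨ec u, by rw [γc_ec, ← map_inv, ← map_mul, ← hu, ec_ecInv]⟩
  · exfalso
    have hk : ab k 1 = 2 * ab (ec u) 1 + ab (ec (FreeGroup.of a)) 1 ∨
        ab k 1 = 2 * ab (ec u) 1 - ab (ec (FreeGroup.of a)) 1 := by
      rcases hu with hu | hu
      · left
        rw [← ec_ecInv k, hu, map_mul, map_mul, map_inv, ← γc_ec, ab_mul, ab_mul, ab_inv, ab_γc _ one_lt_two]
        ring
      · right
        rw [← ec_ecInv k, hu, map_mul, map_mul, map_inv, map_inv, ← γc_ec, ab_mul, ab_mul, ab_inv,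
          ab_inv, ab_γc _ one_lt_two]
        ring
    have := hof a
    rw [Int.odd_iff] at this
    rw [Int.even_iff] at he
    omega

theorem conj_σ0_of_conj_jc (hq : ∀ g, qd (Φ g) = qd g) {v : BraidGroup 3}
    (hv : ∀ g, Commute (qd v) g) (hc : Φ jc = v * jc * v⁻¹) : v⁻¹ * Φ (σ 3 0) * v = σ 3 0 := by
  obtain ⟨k, hk⟩ := exists_jF_of_qd (g := v⁻¹ * Φ (σ 3 0) * v * (σ 3 0)⁻¹) (by
    rw [map_mul, map_mul, map_mul, map_inv, map_inv, hq, (hv _).inv_left.eq, inv_mul_cancel_right,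
      mul_inv_cancel])
  have h1 : Commute jc (v⁻¹ * Φ (σ 3 0) * v) := by
    have h2 : Commute (v * jc * v⁻¹) (Φ (σ 3 0)) := by rw [← hc]; exact jc_comm.map Φ
    have h3 := h2.eq
    rw [Commute, SemiconjBy]
    calc jc * (v⁻¹ * Φ (σ 3 0) * v) = v⁻¹ * (v * jc * v⁻¹ * Φ (σ 3 0)) * v := by group
      _ = _ := by rw [h3]; group
  have h2 : Commute jc (jF k) := by rw [← hk]; exact h1.mul_right jc_comm.inv_right
  have h3 : k = 1 := by
    refine eq_one_of_γc (jF_injective ?_)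
    rw [← jc_mul_jF, h2.eq, mul_inv_cancel_right]
  rw [h3, map_one] at hk
  exact mul_inv_eq_one.1 hk

/-- After a conjugation, the endomorphism fixes the first generator. -/
theorem exists_conj_fix_σ0 (hp : ∀ g, perm 3 (Φ g) = perm 3 g) (hq : ∀ g, qd (Φ g) = qd g) :
    ∃ v, IsPure v ∧ (∀ g, qd (v * Φ g * v⁻¹) = qd g) ∧ v * Φ (σ 3 0) * v⁻¹ = σ 3 0 := by
  obtain ⟨k, hk⟩ := exists_jF_of_qd (g := Φ jc * jc⁻¹) (by
    rw [map_mul, hq, map_inv, mul_inv_cancel])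
  have hk' : Φ jc = jF k * jc := mul_inv_eq_iff_eq_mul.1 hk
  have h1 : k * γc k = 1 := by
    apply jF_injective
    rw [map_mul, ← jc_mul_jF, map_one]
    have h := map_z3_of_qd hp hq
    rw [← jc_sq, map_pow, hk', pow_two, pow_two] at h
    calc jF k * (jc * jF k * jc⁻¹) = jF k * jc * (jF k * jc) * (jc * jc)⁻¹ := by group
      _ = 1 := by rw [h, mul_inv_cancel]
  have h2 : IsPure (jF k) := by rw [← hk, IsPure, map_mul, hp, map_inv, mul_inv_cancel]
  obtain ⟨w, hw⟩ := exists_of_mul_γc h1 (isPure_jF.1 h2).2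
  have hc : Φ jc = jF w * jc * (jF w)⁻¹ := by
    rw [hk', hw, map_mul, map_inv, ← jc_mul_jF]; group
  have hqw : qd (jF w) = 1 := qd_jF w
  suffices ∃ v, IsPure v ∧ (∀ g, Commute (qd v) g) ∧ Φ jc = v * jc * v⁻¹ by
    obtain ⟨v, hv, hvc, hv2⟩ := this
    refine ⟨v⁻¹, hv.inv, fun g => ?_, ?_⟩
    · rw [map_mul, map_mul, map_inv, hq, inv_inv, (hvc _).inv_left.eq, inv_mul_cancel_right]
    · rw [inv_inv]; exact conj_σ0_of_conj_jc hq hvc hv2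
  have h3 := conj_σ0_of_conj_jc hq (v := jF w) (fun g => by rw [hqw]; exact Commute.one_left g) hc
  have h4 : Commute (perm 3 (jF w)) (Equiv.swap 0 1) := by
    have := congrArg (perm 3) h3
    rw [map_mul, map_mul, map_inv, hp, perm_σ (by omega)] at this
    rw [Commute, SemiconjBy]
    nth_rewrite 1 [← this]
    group
  have hy : Even (ab w 1) := by
    by_contra ho
    rw [Int.not_even_iff_odd] at ho
    have h5 := DFunLike.congr_fun h4.eq 0
    rw [perm_jF, vy_zpow_odd ho] at h5
    rcases Int.even_or_odd (ab w 0) with he | ho'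
    · rw [vx_zpow_even he] at h5
      revert h5
      decide
    · rw [vx_zpow_odd ho'] at h5
      revert h5
      decide
  rcases Int.even_or_odd (ab w 0) with he | ho
  · exact ⟨jF w, isPure_jF.2 ⟨he, hy⟩, fun g => by rw [hqw]; exact Commute.one_left g, hc⟩
  · refine ⟨jF w * jc, ?_, fun g => ?_, by rw [hc]; group⟩
    · have : jc = jF (X 2 0)⁻¹ * incl 2 (z 2) := by rw [map_inv, jF_zero, jc]
      rw [this, ← mul_assoc, ← map_mul]
      refine IsPure.mul (isPure_jF.2 ?_) (by rw [IsPure, perm_incl]; exact isPure_z 2)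
      simp only [ab_mul, ab_inv, ab_X (show 0 < 2 by omega), if_true]
      refine ⟨?_, by simpa using hy⟩
      exact ho.add_odd (by decide)
    · rw [map_mul, hqw, one_mul, qd_jc]
      exact z_comm g

end BraidGroup

namespace BraidGroup

open SemidirectProduct

variable {Φ : BraidGroup 3 →* BraidGroup 3}

theorem ιF_P2 : ιF 2 (P 2) = σ 3 2 * (σ 3 1 * σ 3 0 ^ 2 * σ 3 1) * σ 3 2 := by
  rw [ιF_P_succ, ιF_P1]
  simp (disch := omega) only [map_mul, map_pow, incl_σ]

theorem ιF_X_last (m : ℕ) : ιF m (X (m + 1) m) = σ (m + 1) m ^ 2 := by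
  rw [ιF_X le_rfl, bX_self]

theorem incl_z2 : incl 2 (z 2) = σ 3 1 * σ 3 0 ^ 2 * σ 3 1 * σ 3 0 ^ 2 := by
  rw [z2_eq]
  simp (disch := omega) only [map_mul, map_pow, incl_σ]

theorem z1_eq : z 1 = σ 1 0 ^ 2 := by
  have : P 0 = X 1 0 := one_mul _
  rw [z_succ, this, ιF_X_last, z, map_one, mul_one]

theorem del_mul_pure {m : ℕ} (g : BraidGroup (m + 1)) {h : BraidGroup (m + 1)} (hh : IsPure h)
    (j : ℕ) : del (g * h) j = del g j * del h j := by
  rw [IsPure] at hh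
  rw [del_mul, hh]
  rfl

theorem del_inv_pure {m : ℕ} {h : BraidGroup (m + 1)} (hh : IsPure h)
    (j : ℕ) : del h⁻¹ j = (del h j)⁻¹ := by
  rw [IsPure] at hh
  rw [del_inv, hh]
  rfl

theorem del_z2_one : del (incl 2 (z 2)) 1 = σ 2 0 ^ 2 := by
  rw [incl_z2]
  simp (disch := omega) [pow_two, del_mul, del_σ, perm_σ, Equiv.swap_apply_def]

theorem del_z2_two : del (incl 2 (z 2)) 2 = σ 2 0 ^ 2 := by
  rw [incl_z2]
  simp (disch := omega) [pow_two, del_mul, del_σ, perm_σ, Equiv.swap_apply_def]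

theorem del_ιF_μ_one (w : F 2) : del (ιF 2 (μ 1 w)) 1 = ιF 1 w := by
  rw [del_ιF]
  congr 1
  refine DFunLike.congr_fun (f := (fdel 1).comp (μ 1)) (g := MonoidHom.id _)
    (fhom_ext fun i hi => ?_) w
  show fdel 1 (μ 1 _) = X 2 i
  interval_cases i
  · rw [μ_zero, fdel_Femb_P]
    exact one_mul _
  · rw [μ_one, fdel_last]

theorem del_ιF_μ_two (w : F 2) : del (ιF 2 (μ 1 w)) 2 = ιF 1 (P 1 ^ ab w 0) := by
  let S : Subgroup (F 2) :=
    { carrier := {w | del (ιF 2 (μ 1 w)) 2 = ιF 1 (P 1 ^ ab w 0)}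
      one_mem' := by
        simp
      mul_mem' := fun {a b} (ha : _ = _) (hb : _ = _) => by
        show _ = _
        rw [map_mul (μ 1), map_mul (ιF 2), del_mul_pure _ (isPure_ιF _), ha, hb, ab_mul, zpow_add,
          map_mul]
      inv_mem' := fun {a} (ha : _ = _) => by
        show _ = _
        rw [map_inv (μ 1), map_inv (ιF 2), del_inv_pure (isPure_ιF _), ha, ab_inv, zpow_neg,
          map_inv] }
  have h1 : del (ιF 2 (μ 1 (X 2 1))) 2 = 1 := by
    rw [μ_one, ιF_X_last]
    simp (disch := omega) [pow_two, del_mul, del_σ, perm_σ]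
  refine mem_of_X_mem (S := S) (fun i hi => ?_) w
  show _ = _
  interval_cases i
  · have : X 2 0 = X 2 0 * X 2 1 * (X 2 1)⁻¹ := by group
    rw [ab_X hi, if_pos rfl, zpow_one]
    conv_lhs => rw [this]
    rw [map_mul (μ 1), μ_mul, map_mul (ιF 2), map_inv (μ 1), map_inv (ιF 2),
      del_mul_pure _ (isPure_ιF _).inv, del_inv_pure (isPure_ιF _), h1, inv_one, mul_one, ιF_P2,
      ιF_P1]
    simp (disch := omega) [pow_two, del_mul, del_σ, perm_σ, Equiv.swap_apply_of_ne_of_ne]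
  · rw [h1, ab_X hi, if_neg (by omega), zpow_zero, map_one]

theorem ab_μ (w : F 2) : ab (μ 1 w) 0 = ab w 0 ∧ ab (μ 1 w) 2 = ab w 1 := by
  let S : Subgroup (F 2) :=
    { carrier := {w | ab (μ 1 w) 0 = ab w 0 ∧ ab (μ 1 w) 2 = ab w 1}
      one_mem' := by simp
      mul_mem' := fun {a b} (ha : _ ∧ _) (hb : _ ∧ _) => by
        show _ ∧ _
        rw [map_mul, ab_mul, ab_mul, ab_mul, ab_mul, ha.1, ha.2, hb.1, hb.2]
        exact ⟨rfl, rfl⟩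
      inv_mem' := fun {a} (ha : _ ∧ _) => by
        show _ ∧ _
        rw [map_inv, ab_inv, ab_inv, ab_inv, ab_inv, ha.1, ha.2]
        exact ⟨rfl, rfl⟩ }
  refine mem_of_X_mem (S := S) (fun i hi => ?_) w
  show _ ∧ _
  interval_cases i
  · rw [μ_zero, P, Femb_bp le_rfl, ab_bp (by omega), ab_bp (by omega), ab_X hi, ab_X hi]
    decide
  · rw [μ_one, ab_X (by omega) 0, ab_X (by omega) 2, ab_X hi, ab_X hi]
    decide

theorem artin_incl_μ {m : ℕ} (g : BraidGroup m) (w : F 2) :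
    artin (m + 1) (incl m g) (μ m w) = μ m w := by
  refine DFunLike.congr_fun (f := (artin (m + 1) (incl m g)).toMonoidHom.comp (μ m)) (g := μ m)
    (fhom_ext fun i hi => ?_) w
  show artin (m + 1) (incl m g) (μ m _) = _
  interval_cases i
  · rw [μ_zero, artin_incl_Femb, artin_P]
  · rw [μ_one, artin_incl_last]

theorem exists_map_z2 (hp : ∀ g, perm 3 (Φ g) = perm 3 g) (h0 : Φ (σ 3 0) = σ 3 0) :
    ∃ w : F 2, ab w 0 = 0 ∧ ab w 1 = 0 ∧ Φ (incl 2 (z 2)) = ι 2 (inl (μ 1 w) * inr (z 2)) := by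
  set Q := Φ (incl 2 (z 2)) with hQ
  have hzp : IsPure (incl 2 (z 2)) := by rw [IsPure, perm_incl]; exact isPure_z 2
  have hQp : IsPure Q := by rw [IsPure, hQ, hp]; exact hzp
  have hcr : ∀ a b, cr Q a b = cr (incl 2 (z 2)) a b :=
    cr_map hp (fun a b => by rw [map_pow, h0]) hzp
  obtain ⟨f, b, hfb⟩ : ∃ f b, Q = ι 2 (inl f * inr b) :=
    ⟨_, _, by
      rw [inl_left_mul_inr_right (coc Q 3)]
      refine eq_ι_of_perm ?_
      rw [IsPure] at hQp
      rw [hQp]; rfl⟩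
  have hbp : IsPure b := by
    rw [hfb, IsPure, perm_ι] at hQp
    rw [IsPure]
    simpa using hQp
  have hcomm : Commute (inr (σ 2 0) : A 2) (inl f * inr b) := by
    rw [← ι_comm_iff, ← hfb, ι_inr, incl_σ (by omega), hQ, ← h0]
    refine Commute.map ?_ Φ
    rw [← incl_σ (m := 2) (by omega)]
    exact ((z_comm _).symm : Commute (σ 2 0) (z 2)).map (incl 2)
  have h1 := hcomm.eq
  rw [← mul_assoc, inr_mul_inl, mul_assoc, mul_assoc, ← map_mul, ← map_mul] at h1
  have hf : artin 2 (σ 2 0) f = f := by simpa using congrArg SemidirectProduct.left h1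
  have hb : σ 2 0 * b = b * σ 2 0 := by simpa using congrArg SemidirectProduct.right h1
  obtain ⟨w, rfl⟩ := mem_range_μ_of_fixed (m := 1) (f := f) (by
    rw [z1_eq, map_pow, incl_σ (by omega), map_pow, pow_two, MulAut.mul_apply, hf, hf])
  obtain ⟨j, l, hjl⟩ := pure_commute_incl hbp (fun g => commute_of_σ (f := incl 1) (fun i hi => by
    obtain rfl : i = 0 := by omega
    rw [incl_σ hi]
    exact Commute.symm hb) g)
  have c01 := hcr 0 1
  have c02 := hcr 0 2
  have c03 := hcr 0 3
  have c23 := hcr 2 3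
  rw [cr_incl] at c01 c02 c03 c23
  rw [hfb, cr_ι _ (by omega) (by omega), cr_z (by omega) (by omega)] at c01 c02
  rw [hfb, cr_ι_last _ (by omega), cr_of_gt _ (by omega)] at c03 c23
  rw [IsPure] at hbp
  simp [hbp, (ab_μ w).1, (ab_μ w).2] at c03 c23
  rw [mul_right, right_inl, right_inr, one_mul, hjl] at c01 c02
  rw [cr_ι _ (by omega) (by omega), mul_right, right_inl, right_inr, one_mul,
    cr_zpow_pure (isPure_z 1), cr_z (by omega) (by omega)] at c01
  rw [cr_ι_last _ (by omega)] at c02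
  have hz1 := isPure_z 1
  rw [IsPure] at hz1
  simp only [mul_left, mul_right, left_inl, right_inl, left_inr, right_inr, map_one, one_mul, mul_one,
    map_zpow (perm 1), hz1, one_zpow, Equiv.Perm.one_apply, ab_zpow, ab_P (Nat.zero_le 1)] at c02
  refine ⟨w, c03, c23, ?_⟩
  rw [hfb, hjl, show j = 1 by omega, show l = 1 by omega, zpow_one, zpow_one]
  rfl

end BraidGroup

namespace BraidGroup

open SemidirectProduct

variable {Φ : BraidGroup 3 →* BraidGroup 3}

theorem del_map_σ1 {Q u : BraidGroup 3} (hQ : IsPure Q) (hu : perm 3 u = Equiv.swap 1 2)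
    (h : Commute Q u) : del Q 1 * del u 2 = del u 2 * del Q 2 := by
  rw [← del_mul_pure u hQ, ← h.eq, del_mul, hu, Equiv.swap_apply_right]

theorem perm_two_of_conj {v : BraidGroup 2} {w : F 2} (h0 : ab w 0 = 0) (h1 : ab w 1 = 0)
    (h : ιF 1 w * σ 2 0 ^ 2 * v = v * σ 2 0 ^ 2) : perm 2 v 2 = 2 := by
  have hs : IsPure (σ 2 0 ^ 2) := isPure_σ_sq
  have h2 : v * σ 2 0 ^ 2 * v⁻¹ = ιF 1 w * σ 2 0 ^ 2 := by rw [← h]; group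
  have hw : ∀ a b, cr (ιF 1 w) a b = 0 := fun a b => by
    rw [← cr_of_gt (1 : BraidGroup 2) (.inr (rfl : a = a)), cr_of_gt _ (.inr rfl)]
    have h3 : ∀ a b, a < b → b ≤ 2 → cr (ιF 1 w) a b = 0 := fun a b hab hb => by
      rcases hb.lt_or_eq with hb | rfl
      · rw [← ι_inl, cr_ι _ (by omega) (by omega), right_inl, ← cr_of_gt (1 : BraidGroup 1) (.inr (rfl : a = a))]
        simp
      · rw [cr_ιF _ (by omega)]
        rcases (show a = 0 ∨ a = 1 by omega) with rfl | rfl <;> simp [h0, h1]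
    rcases lt_trichotomy a b with hab | hab | hab
    · rcases le_or_gt b 2 with hb | hb
      · exact h3 a b hab hb
      · exact cr_of_gt _ (.inl hb)
    · exact cr_of_gt _ (.inr hab)
    · rw [cr_symm]
      rcases le_or_gt a 2 with hb | hb
      · exact h3 b a hab hb
      · exact cr_of_gt _ (.inl hb)
  have key : ∀ a, cr (σ 2 0 ^ 2) (perm 2 v a) (perm 2 v 2) = 0 := fun a => by
    have h3 := cr_conj (g := v) hs a 2
    rw [h2, cr_mul_pure _ hs, hw, zero_add, cr_σ_sq (by omega), cr_σ_sq (by omega)] at h3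
    rw [cr_σ_sq (by omega), h3, if_neg (by omega)]
  have hv := perm_le v (le_refl 2)
  by_contra hne
  have h3 := key ((perm 2 v)⁻¹ (1 - perm 2 v 2))
  rw [show ∀ c, perm 2 v ((perm 2 v)⁻¹ c) = c from (perm 2 v).apply_symm_apply, cr_σ_sq (by omega), if_pos (by omega)] at h3
  omega

theorem exists_conj_z2 (hp : ∀ g, perm 3 (Φ g) = perm 3 g) (h0 : Φ (σ 3 0) = σ 3 0) :
    ∃ g, IsPure g ∧ Commute g (σ 3 0) ∧ Φ (incl 2 (z 2)) = g * incl 2 (z 2) * g⁻¹ := by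
  obtain ⟨w, w0, w1, hw⟩ := exists_map_z2 hp h0
  have hzp : IsPure (incl 2 (z 2)) := by rw [IsPure, perm_incl]; exact isPure_z 2
  have hQp : IsPure (Φ (incl 2 (z 2))) := by rw [IsPure, hp]; exact hzp
  have hQF : Φ (incl 2 (z 2)) = ιF 2 (μ 1 w) * incl 2 (z 2) := by
    rw [hw, map_mul, ι_inl, ι_inr]
  have hc : Commute (Φ (incl 2 (z 2))) (Φ (σ 3 1)) := by
    refine Commute.map ?_ Φ
    rw [← incl_σ (m := 2) (by omega)]
    exact (z_comm _ : Commute (z 2) (σ 2 1)).map (incl 2)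
  have h1 := del_map_σ1 hQp (by rw [hp, perm_σ (by omega)]) hc
  rw [hQF, del_mul_pure _ hzp, del_mul_pure _ hzp, del_ιF_μ_one, del_ιF_μ_two, w0, zpow_zero,
    map_one, one_mul, del_z2_one, del_z2_two] at h1
  set v := del (Φ (σ 3 1)) 2 with hv
  have h2 := perm_two_of_conj w0 w1 h1
  obtain ⟨f, b, hfb⟩ : ∃ f b, v = ι 1 (inl f * inr b) :=
    ⟨_, _, by
      rw [inl_left_mul_inr_right (coc v 2)]
      exact eq_ι_of_perm h2⟩
  have hs : σ 2 0 ^ 2 = ι 1 (inr (z 1)) := by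
    rw [z1_eq, ι_inr, map_pow, incl_σ (by omega)]
  rw [hfb, hs, ← ι_inl, ← map_mul, ← map_mul, ← map_mul] at h1
  have h3 := congrArg SemidirectProduct.left (ι_injective h1)
  simp at h3
  rw [artin_z] at h3
  refine ⟨ι 2 (inl (μ 1 f)), ?_, ?_, ?_⟩
  · rw [ι_inl]; exact isPure_ιF _
  · rw [← incl_σ (m := 2) (by omega), ← ι_inr, ι_comm_iff]
    have := inr_mul_inl (σ 2 0) (μ 1 f)
    have e := artin_incl_μ (m := 1) (σ 1 0) f
    rw [incl_σ (by omega)] at e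
    rw [e] at this
    exact this.symm
  · have e : w = f * (P 1)⁻¹ * f⁻¹ * P 1 := by
      calc w = w * ((P 1)⁻¹ * f * P 1) * ((P 1)⁻¹ * f * P 1)⁻¹ := by group
        _ = _ := by rw [h3]; group
    rw [hw, ← ι_inr, ← map_mul, ← map_inv, ← map_mul, ← map_inv]
    congr 1
    rw [mul_assoc (inl _), inr_mul_inl, ← mul_assoc, ← map_mul, artin_z, e]
    have hP : P 1 = X 2 0 * X 2 1 := by simp [P, bp]
    have : μ 1 (P 1) = P 2 := by rw [hP, μ_mul]
    rw [← this]
    congr 2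
    simp only [map_mul, map_inv]
    group

/-- An endomorphism over the symmetric group which fixes `σ 3 0` and the full twist of the first
three strands, and is inner modulo `qd`, is standard. -/
theorem isStd_of_fix_z2 (hp : ∀ g, perm 3 (Φ g) = perm 3 g) (h0 : Φ (σ 3 0) = σ 3 0)
    (h2 : Φ (incl 2 (z 2)) = incl 2 (z 2)) {v : BraidGroup 3} (hv : IsPure v)
    (hq : ∀ g, qd (Φ g) = qd v * qd g * (qd v)⁻¹) : IsStd Φ := by
  have hv' : IsPure (incl 2 (qd v)) := by
    have h1 := fun i j => even_lin_sub (g := v) (h := 1) (by rw [hv, map_one]) i j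
    rw [IsPure, perm_incl]
    have h00 := h1 0 0
    have h01 := h1 0 1
    have h10 := h1 1 0
    have h11 := h1 1 1
    simp at h00 h01 h10 h11
    exact isPure_of_lin h00 h01 h10 h11
  have h1 : ∃ b, Φ (σ 3 1) = incl 2 b := by
    have hp1 := hp (σ 3 1)
    obtain ⟨f, b, hfb⟩ : ∃ f b, Φ (σ 3 1) = ι 2 (inl f * inr b) :=
      ⟨_, _, by
        rw [inl_left_mul_inr_right (coc (Φ (σ 3 1)) 3)]
        refine eq_ι_of_perm ?_
        rw [hp, perm_σ (by omega)]
        decide⟩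
    have hc : Commute (Φ (incl 2 (z 2))) (Φ (σ 3 1)) := by
      refine Commute.map ?_ Φ
      rw [← incl_σ (m := 2) (by omega)]
      exact (z_comm _ : Commute (z 2) (σ 2 1)).map (incl 2)
    rw [h2, hfb, ← ι_inr, ι_comm_iff] at hc
    have hc' := hc.eq
    rw [← mul_assoc, inr_mul_inl] at hc'
    have hc2 := congrArg SemidirectProduct.left hc'
    simp at hc2
    rw [artin_z] at hc2
    have hfP : Commute f (P 2) := by
      rw [Commute, SemiconjBy]
      nth_rewrite 2 [← hc2]
      group
    obtain ⟨i, rfl⟩ := exists_eq_zpow_of_commute (ab_P (Nat.zero_le 2)) hfP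
    have h3 : Φ (σ 3 1 ^ 2) = ι 2 (inl (P 2 ^ (2 * i)) * inr (b ^ 2)) := by
      rw [map_pow, hfb, ← map_pow]
      congr 1
      have : (inl (P 2 ^ (2 * i)) : A 2) = inl (P 2 ^ i) * inl (P 2 ^ i) := by
        rw [← map_mul, ← zpow_add]; congr 2; ring
      rw [pow_two, mul_assoc, ← mul_assoc (inr b), inr_mul_inl, map_zpow (artin 2 b), artin_P, this,
        pow_two, map_mul inr, mul_assoc, mul_assoc]
    have h4 := cr_map hp (fun a b => by rw [map_pow, h0]) (isPure_σ_sq (m := 3) (i := 1)) 0 3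
    rw [h3, cr_ι_last _ (by omega), cr_σ_sq (by omega), if_neg (by omega)] at h4
    simp only [mul_left, left_inl, left_inr, right_inl, map_one, mul_one, ab_zpow] at h4
    rw [ab_P (perm_le _ (by omega))] at h4
    have hi : i = 0 := by omega
    exact ⟨b, by rw [hfb, hi, zpow_zero, map_one, one_mul, ι_inr]⟩
  obtain ⟨b, hb⟩ := h1
  have key : ∀ x, Φ (incl 2 x) = incl 2 (qd v) * incl 2 x * (incl 2 (qd v))⁻¹ := by
    have : ∀ i < 2, ∃ c, Φ (σ 3 i) = incl 2 c := fun i hi => by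
      interval_cases i
      · exact ⟨σ 2 0, by rw [h0, incl_σ hi]⟩
      · exact ⟨b, hb⟩
    refine DFunLike.congr_fun (f := Φ.comp (incl 2))
      (g := (MulAut.conj (incl 2 (qd v))).toMonoidHom.comp (incl 2)) (hom_ext fun i hi => ?_)
    show Φ (incl 2 _) = incl 2 (qd v) * incl 2 _ * (incl 2 (qd v))⁻¹
    obtain ⟨c, hc⟩ := this i hi
    have h3 := hq (incl 2 (σ 2 i))
    rw [incl_σ hi, hc, qd_incl, ← incl_σ hi, qd_incl] at h3
    rw [incl_σ hi, hc, h3, ← incl_σ hi]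
    simp only [map_mul, map_inv]
  refine IsStd.of_conj hv'.inv ?_
  obtain ⟨u, hu, hu'⟩ := eq_conj_of_fix_incl (k := 1)
    (Φ := (MulAut.conj (incl 2 (qd v))⁻¹).toMonoidHom.comp Φ) le_rfl (fun g => by
      show perm 3 ((incl 2 (qd v))⁻¹ * Φ g * (incl 2 (qd v))⁻¹⁻¹) = _
      rw [map_mul, map_mul, hv'.inv, hv'.inv.inv, hp, one_mul, mul_one]) (fun g => by
      show (incl 2 (qd v))⁻¹ * Φ (incl 2 g) * (incl 2 (qd v))⁻¹⁻¹ = _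
      rw [key]; group)
  exact ⟨u, hu, 1, .inl rfl, 0, fun i hi => by rw [hu', zpow_one, zpow_zero, mul_one]⟩

theorem rigid_three : Rigid 3 := by
  refine rigid_three_of fun Φ hp hq => ?_
  obtain ⟨v, hv, hq1, h0⟩ := exists_conj_fix_σ0 hp hq
  refine IsStd.of_conj hv ?_
  set Ψ := (MulAut.conj v).toMonoidHom.comp Φ with hΨ
  have hΨ' : ∀ g, Ψ g = v * Φ g * v⁻¹ := fun g => rfl
  have hΨp : ∀ g, perm 3 (Ψ g) = perm 3 g := fun g => by
    rw [hΨ', map_mul, map_mul, hv, hv.inv, hp, one_mul, mul_one]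
  rw [← hΨ'] at h0
  obtain ⟨g, hg, hg0, hg2⟩ := exists_conj_z2 hΨp h0
  refine IsStd.of_conj hg.inv ?_
  refine isStd_of_fix_z2 (v := g⁻¹) (fun x => ?_) ?_ ?_ hg.inv (fun x => ?_)
  · show perm 3 (g⁻¹ * Ψ x * g⁻¹⁻¹) = _
    rw [map_mul, map_mul, hg.inv, hg.inv.inv, hΨp, one_mul, mul_one]
  · show g⁻¹ * Ψ (σ 3 0) * g⁻¹⁻¹ = _
    rw [h0, inv_inv, hg0.inv_left.eq, inv_mul_cancel_right]
  · show g⁻¹ * Ψ (incl 2 (z 2)) * g⁻¹⁻¹ = _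
    rw [hg2]; group
  · show qd (g⁻¹ * Ψ x * g⁻¹⁻¹) = _
    rw [map_mul, map_mul, hΨ', hq1, map_inv (qd) g⁻¹]

theorem rigid {n : ℕ} (hn : 3 ≤ n) : Rigid n := by
  induction n, hn using Nat.le_induction with
  | base => exact rigid_three
  | succ n hn ih =>
    obtain ⟨k, rfl⟩ : ∃ k, n = k + 1 := ⟨n - 1, by omega⟩
    exact Rigid.succ (by omega) ih

end BraidGroup

/-! ### Torsion-freeness of braid groups -/

namespace FreeGroup

variable {α R : Type*} [CommRing R]

/-- A crossed homomorphism with values in a commutative ring on which the group acts through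
a character. -/
def IsCrossed (u : FreeGroup α →* R) (D : FreeGroup α → R) : Prop :=
  ∀ g h, D (g * h) = D g + u g * D h

namespace IsCrossed

variable {u : FreeGroup α →* R} {D E : FreeGroup α → R}

theorem map_one (hD : IsCrossed u D) : D 1 = 0 := by simpa using hD 1 1

theorem map_inv (hD : IsCrossed u D) (g : FreeGroup α) : D g⁻¹ = -(u g⁻¹ * D g) := by
  have := hD g⁻¹ g
  rw [inv_mul_cancel, hD.map_one] at this
  linear_combination -this

theorem sub (hD : IsCrossed u D) (hE : IsCrossed u E) : IsCrossed u (fun g => D g - E g) :=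
  fun g h => by
    simp only [hD g h, hE g h]
    ring

theorem mem_of_forall_of (hD : IsCrossed u D) {J : Ideal R} (h : ∀ a, D (of a) ∈ J)
    (g : FreeGroup α) : D g ∈ J := by
  induction g using FreeGroup.induction_on with
  | C1 => simp [hD.map_one]
  | of a => exact h a
  | inv_of a _ => rw [hD.map_inv]; exact J.neg_mem (J.mul_mem_left _ (h a))
  | mul a b ha hb => rw [hD]; exact J.add_mem ha (J.mul_mem_left _ hb)

theorem mem_mul_of_commutator (hD : IsCrossed u D) {I J : Ideal R} (hu : ∀ g, u g - 1 ∈ I)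
    (h : ∀ g, D g ∈ J) {c : FreeGroup α} (hc : c ∈ commutator (FreeGroup α)) :
    u c = 1 ∧ D c ∈ I * J := by
  rw [commutator_eq_closure] at hc
  induction hc using Subgroup.closure_induction with
  | mem c hc =>
    obtain ⟨a, b, rfl⟩ := hc
    have h1 : u a * u a⁻¹ = 1 := by rw [← _root_.map_mul, mul_inv_cancel, _root_.map_one]
    have h2 : u b * u b⁻¹ = 1 := by rw [← _root_.map_mul, mul_inv_cancel, _root_.map_one]
    rw [commutatorElement_def]
    constructor
    · simp only [_root_.map_mul]
      linear_combination u b * u b⁻¹ * h1 + h2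
    · have : D (a * b * a⁻¹ * b⁻¹) = (u a - 1) * D b - (u b - 1) * D a := by
        rw [hD, hD, hD, hD.map_inv, hD.map_inv]
        simp only [_root_.map_mul]
        linear_combination -(u b * D a) * h1 - (u a * u a⁻¹) * D b * h2 - D b * h1
      rw [this]
      exact Ideal.sub_mem _ (Ideal.mul_mem_mul (hu a) (h b)) (Ideal.mul_mem_mul (hu b) (h a))
  | one => simp [hD.map_one]
  | mul a b _ _ ha hb =>
    rw [_root_.map_mul, ha.1, hb.1, hD, ha.1]
    exact ⟨one_mul 1, Ideal.add_mem _ ha.2 (by simpa using hb.2)⟩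
  | inv a _ ha =>
    have h1 : u a⁻¹ = 1 := by
      have : u a * u a⁻¹ = 1 := by rw [← _root_.map_mul, mul_inv_cancel, _root_.map_one]
      rwa [ha.1, one_mul] at this
    rw [h1, hD.map_inv, h1]
    exact ⟨rfl, Submodule.neg_mem _ (by simpa using ha.2)⟩

/-- A crossed homomorphism into a unipotent module is determined by its values on elements which
are congruent to the generators modulo commutators. -/
theorem eq_zero (hD : IsCrossed u D) {I : Ideal R} (hI : IsNilpotent I) (hu : ∀ g, u g - 1 ∈ I)
    {y : α → FreeGroup α} (hy : ∀ a, of a * (y a)⁻¹ ∈ commutator (FreeGroup α))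
    (h : ∀ a, D (y a) = 0) (g : FreeGroup α) : D g = 0 := by
  have key : ∀ n : ℕ, ∀ g, D g ∈ I ^ n := by
    intro n
    induction n with
    | zero => simp
    | succ n ih =>
      refine hD.mem_of_forall_of fun a => ?_
      have : of a = of a * (y a)⁻¹ * y a := by group
      rw [this, hD, h, mul_zero, add_zero, pow_succ']
      exact (hD.mem_mul_of_commutator hu ih (hy a)).2
  obtain ⟨n, hn⟩ := hI
  simpa [hn] using key n g

theorem ext (hD : IsCrossed u D) (hE : IsCrossed u E) {I : Ideal R} (hI : IsNilpotent I)
    (hu : ∀ g, u g - 1 ∈ I) {y : α → FreeGroup α}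
    (hy : ∀ a, of a * (y a)⁻¹ ∈ commutator (FreeGroup α)) (h : ∀ a, D (y a) = E (y a))
    (g : FreeGroup α) : D g = E g :=
  sub_eq_zero.1 ((hD.sub hE).eq_zero hI hu hy (fun a => sub_eq_zero.2 (h a)) g)

theorem exists_of (u : FreeGroup α →* R) (c : α → R) :
    ∃ D, IsCrossed u D ∧ ∀ a, D (of a) = c a := by
  have hu (a : FreeGroup α) : u a * u a⁻¹ = 1 := by
    rw [← _root_.map_mul, mul_inv_cancel, _root_.map_one]
  let A : FreeGroup α →* Equiv.Perm R := FreeGroup.lift fun a =>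
    { toFun := fun r => u (of a) * r + c a
      invFun := fun r => u (of a)⁻¹ * (r - c a)
      left_inv := fun r => by linear_combination r * hu (of a)
      right_inv := fun r => by linear_combination (r - c a) * hu (of a) }
  have hA (g : FreeGroup α) : ∀ r, A g r = u g * r + A g 0 := by
    induction g using FreeGroup.induction_on with
    | C1 => simp
    | of a => simp [A]
    | inv_of a _ =>
      intro r
      simp only [A, _root_.map_inv, lift_apply_of, Equiv.Perm.inv_def, Equiv.coe_fn_symm_mk]
      ring
    | mul a b ha hb =>
      intro r
      simp only [_root_.map_mul, Equiv.Perm.mul_apply]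
      rw [hb r, ha (u b * r + _), ha (A b 0)]
      ring
  refine ⟨fun g => A g 0, fun g h => ?_, fun a => by simp [A]⟩
  simp only [_root_.map_mul, Equiv.Perm.mul_apply]
  rw [hA g (A h 0), add_comm]

/-- Crossed homomorphisms may be prescribed on elements congruent to the generators. -/
theorem exists_apply_eq [Finite α] [Finite R] (u : FreeGroup α →* R) {I : Ideal R}
    (hI : IsNilpotent I) (hu : ∀ g, u g - 1 ∈ I) {y : α → FreeGroup α}
    (hy : ∀ a, of a * (y a)⁻¹ ∈ commutator (FreeGroup α)) (c : α → R) :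
    ∃ D, IsCrossed u D ∧ ∀ a, D (y a) = c a := by
  choose D hD hDc using exists_of u
  have : Function.Injective fun (c : α → R) a => D c (y a) := fun c c' h => funext fun a => by
    rw [← hDc c, ← hDc c', (hD c).ext (hD c') hI hu hy (fun a => congrFun h a)]
  obtain ⟨c', hc'⟩ := Finite.surjective_of_injective this c
  exact ⟨D c', hD c', fun a => congrFun hc' a⟩

end IsCrossed

end FreeGroup

namespace FreeGroup

variable {α R : Type*} [CommRing R]

theorem isCrossed_sub_one (u : FreeGroup α →* R) : IsCrossed u fun g => u g - 1 := fun g h => by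
  simp only [_root_.map_mul]
  ring

theorem mul_inv_mem_commutator {G : Type*} [Group G] {g h : G}
    (H : Abelianization.of g = Abelianization.of h) : g * h⁻¹ ∈ commutator G := by
  rw [← QuotientGroup.eq_one_iff]
  exact (map_mul_inv Abelianization.of g h).trans (mul_inv_eq_one.2 H)

section

variable {d : ℕ} {φ : MulAut (FreeGroup α)} {π : Equiv.Perm α}
  {k : α → ZMod d}

theorem abelianization_pow_apply
    (hφπ : ∀ a, Abelianization.of (φ (of a)) = Abelianization.of (of (π a))) (n : ℕ) (a : α) :
    Abelianization.of ((φ ^ n) (of a)) = Abelianization.of (of ((π ^ n) a)) := by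
  induction n with
  | zero => rfl
  | succ n ih =>
    rw [pow_succ', pow_succ', MulAut.mul_apply, Equiv.Perm.mul_apply, ← hφπ]
    simpa using congrArg (Abelianization.map φ.toMonoidHom) ih

/-- Elements congruent to the generators and permuted by the automorphism `φ`. -/
def equivariantLift (φ : MulAut (FreeGroup α)) (π : Equiv.Perm α) (k : α → ZMod d) (a : α) :
    FreeGroup α :=
  (φ ^ (k a).val) (of ((π ^ (k a).val)⁻¹ a))

theorem of_mul_equivariantLift_inv
    (hφπ : ∀ a, Abelianization.of (φ (of a)) = Abelianization.of (of (π a))) (a : α) :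
    of a * (equivariantLift φ π k a)⁻¹ ∈ commutator (FreeGroup α) := by
  refine mul_inv_mem_commutator ?_
  rw [equivariantLift, abelianization_pow_apply hφπ, ← Equiv.Perm.mul_apply, mul_inv_cancel,
    Equiv.Perm.one_apply]

theorem apply_equivariantLift [hd : Fact d.Prime] (hφ : φ ^ d = 1) (hπ : π ^ d = 1) (hk : ∀ a, k (π a) = k a + 1)
    (a : α) : φ (equivariantLift φ π k a) = equivariantLift φ π k (π a) := by
  have hd1 : Fact (1 < d) := ⟨hd.out.one_lt⟩
  have h1 : (k (π a)).val = ((k a).val + 1) % d := by rw [hk, ZMod.val_add, ZMod.val_one]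
  rw [equivariantLift, equivariantLift, h1, ← pow_eq_pow_mod _ hφ, ← pow_eq_pow_mod _ hπ,
    ← MulAut.mul_apply, ← pow_succ', pow_succ' π, mul_inv_rev, Equiv.Perm.mul_apply]
  simp

theorem exists_crossed_family [Fact d.Prime] [Fintype α] [Finite R] {u : FreeGroup α →* R} {I : Ideal R}
    (hI : IsNilpotent I) (hu : ∀ g, u g - 1 ∈ I) (hφ : φ ^ d = 1) (hπ : π ^ d = 1)
    (hφπ : ∀ a, Abelianization.of (φ (of a)) = Abelianization.of (of (π a)))
    (hk : ∀ a, k (π a) = k a + 1) {t : R →+* R} (ht : ∀ g, t (u g) = u (φ g)) :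
    ∃ D : α → FreeGroup α → R, (∀ a g, D (π a) (φ g) = t (D a g)) ∧
      ∀ g, ∑ a, D a g * (u (of a) - 1) = u g - 1 := by
  classical
  have hy := of_mul_equivariantLift_inv (k := k) hφπ
  choose D hD hDy using fun a : α => IsCrossed.exists_apply_eq u hI hu hy
    (fun b => if b = a then 1 else 0)
  refine ⟨D, fun a g => ?_, fun g => ?_⟩
  · refine IsCrossed.ext (u := u.comp φ.toMonoidHom) (D := fun g => D (π a) (φ g))
      (E := fun g => t (D a g)) (fun g h => ?_) (fun g h => ?_) hI (fun g => hu _) hy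
      (fun b => ?_) g
    · simp [hD (π a) (φ g)]
    · simp [hD a g, ht]
    · simp only [apply_equivariantLift hφ hπ hk, hDy, π.injective.eq_iff]
      split_ifs <;> simp
  · refine IsCrossed.ext (u := u) (D := fun g => ∑ a, D a g * (u (of a) - 1)) (fun g h => ?_)
      (isCrossed_sub_one u) hI hu hy (fun b => ?_) g
    · simp only [hD _ g, add_mul, Finset.sum_add_distrib, Finset.mul_sum, mul_assoc]
    · have := ((isCrossed_sub_one u).mem_mul_of_commutator hu hu (hy b)).1
      have h2 : u (of b) = u (equivariantLift φ π k b) := by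
        conv_lhs => rw [← inv_mul_cancel_right (of b) (equivariantLift φ π k b)]
        rw [inv_mul_cancel_right, ← one_mul (u (equivariantLift φ π k b)), ← this,
          ← _root_.map_mul, inv_mul_cancel_right]
      simp [hDy, h2]

end

/-- A function which is invariant under a free action of a group of order `d` has sum zero
modulo `d`. -/
theorem sum_eq_zero_of_invariant [Fintype α] {d : ℕ} [NeZero d] {π : Equiv.Perm α}
    {k : α → ZMod d} (hk : ∀ a, k (π a) = k a + 1) {w : α → ZMod d} (hw : ∀ a, w (π a) = w a) :
    ∑ a, w a = 0 := by
  classical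
  rw [← Finset.sum_fiberwise Finset.univ k w]
  have step (c : ZMod d) : ∑ a with k a = c + 1, w a = ∑ a with k a = c, w a := by
    symm
    refine Finset.sum_equiv π (fun a => by simp [hk]) fun a _ => (hw a).symm
  have (n : ℕ) : ∑ a with k a = (n : ZMod d), w a = ∑ a with k a = 0, w a := by
    induction n with
    | zero => simp
    | succ n ih => rw [Nat.cast_succ, step, ih]
  have (c : ZMod d) : ∑ a with k a = c, w a = ∑ a with k a = 0, w a := by
    rw [← this c.val, ZMod.natCast_zmod_val]
  simp [this]

/-- An automorphism of prime order `d` permuting freely the generators modulo commutators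
has no fixed point with a nontrivial image in homology modulo `d`. -/
theorem eq_one_of_fixed [Fintype α] [DecidableEq α] {d : ℕ} [hd : Fact d.Prime]
    {φ : MulAut (FreeGroup α)}
    {π : Equiv.Perm α} {k : α → ZMod d} (hφ : φ ^ d = 1) (hπ : π ^ d = 1)
    (hφπ : ∀ a, Abelianization.of (φ (of a)) = Abelianization.of (of (π a)))
    (hk : ∀ a, k (π a) = k a + 1) {g : FreeGroup α} (hg : φ g = g) :
    FreeGroup.lift (fun a => Multiplicative.ofAdd (Pi.single a (1 : ZMod d))) g = 1 := by
  classical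
  let V := Multiplicative (α → ZMod d)
  let χ : FreeGroup α →* V :=
    FreeGroup.lift (fun a => Multiplicative.ofAdd (Pi.single a (1 : ZMod d)))
  let R := MonoidAlgebra (ZMod d) V
  let u : FreeGroup α →* R := (MonoidAlgebra.of (ZMod d) V).comp χ
  let τ : V ≃* V := AddEquiv.toMultiplicative
    (LinearEquiv.funCongrLeft (ZMod d) (ZMod d) π.symm).toAddEquiv
  have hτ (g : FreeGroup α) : τ (χ g) = χ (φ g) := by
    have : (τ.toMonoidHom.comp χ) = χ.comp φ.toMonoidHom := by
      ext a : 1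
      have := congrArg (Abelianization.lift χ) (hφπ a)
      simp only [Abelianization.lift_apply_of] at this
      show τ (χ (of a)) = χ (φ (of a))
      rw [this]
      simp only [χ, lift_apply_of]
      refine congrArg Multiplicative.ofAdd (funext fun b => ?_)
      show (Pi.single a 1 : α → ZMod d) (π.symm b) = (Pi.single (π a) 1 : α → ZMod d) b
      simp [Pi.single_apply, Equiv.symm_apply_eq]
    exact DFunLike.congr_fun this g
  by_contra hs
  let t : R →+* R := (MonoidAlgebra.domCongr (ZMod d) (ZMod d) τ : R →+* R)
  have ht (g : FreeGroup α) : t (u g) = u (φ g) := by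
    show MonoidAlgebra.domCongr (ZMod d) (ZMod d) τ (MonoidAlgebra.single (χ g) 1)
      = MonoidAlgebra.single (χ (φ g)) 1
    rw [MonoidAlgebra.domCongr_single, hτ]
  let I : Ideal R := nilradical R
  have : Finite V := inferInstanceAs (Finite (α → ZMod d))
  have : Finite R := Finite.of_equiv _ (MonoidAlgebra.coeffEquiv (R := ZMod d) (M := V)).symm
  have hI : IsNilpotent I := IsNoetherianRing.isNilpotent_nilradical R
  have : CharP R d := charP_of_injective_algebraMap
    (FaithfulSMul.algebraMap_injective (ZMod d) R) d
  have hu (g : FreeGroup α) : u g - 1 ∈ I := by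
    refine (mem_nilradical).2 ⟨d, ?_⟩
    have h : (χ g) ^ d = 1 := by
      show d • (χ g).toAdd = 0
      ext a
      simp
    rw [sub_pow_char, one_pow, ← _root_.map_pow, MonoidHom.comp_apply, _root_.map_pow, h,
      _root_.map_one, sub_self]
  obtain ⟨D, hD1, hD2⟩ := exists_crossed_family hI hu hφ hπ hφπ hk ht
  let s : V := χ g
  have hts (r : R) : (t r).coeff s = r.coeff s := by
    show (MonoidAlgebra.domCongr (ZMod d) (ZMod d) τ r).coeff s = _
    rw [MonoidAlgebra.coeff_domCongr, τ.symm_apply_eq.2 ((hτ g).trans (by rw [hg])).symm]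
  have h1 : (u g - 1).coeff s = 1 := by
    show (MonoidAlgebra.single s 1 - 1 : R).coeff s = 1
    rw [MonoidAlgebra.coeff_sub, MonoidAlgebra.one_def, MonoidAlgebra.coeff_single,
      MonoidAlgebra.coeff_single, Finsupp.sub_apply, Finsupp.single_eq_same,
      Finsupp.single_eq_of_ne hs, sub_zero]
  have h2 : ∑ a, (D a g * (u (of a) - 1)).coeff s = 0 := by
    refine sum_eq_zero_of_invariant hk fun a => ?_
    have : u (φ (of a)) = u (of (π a)) := by
      have := congrArg (Abelianization.lift χ) (hφπ a)
      simp only [Abelianization.lift_apply_of] at this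
      exact congrArg (MonoidAlgebra.of (ZMod d) V) this
    rw [← hts (D a g * _), _root_.map_mul, ← hD1, hg, map_sub, ht, _root_.map_one, this]
  rw [← hD2 g, MonoidAlgebra.coeff_sum, Finsupp.finsetSum_apply, h2] at h1
  exact zero_ne_one h1

end FreeGroup

theorem Equiv.Perm.exists_zmod_translation {α : Type*} {d : ℕ} (hd : d.Prime)
    {π : Equiv.Perm α} (hπ : π ^ d = 1) (h : ∀ a, π a ≠ a) :
    ∃ k : α → ZMod d, ∀ a, k (π a) = k a + 1 := by
  have hdvd {a : α} {n : ℤ} (hn : (π ^ n) a = a) : (d : ℤ) ∣ n := by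
    by_contra hdn
    obtain ⟨u, v, huv⟩ := (Nat.Prime.coprime_iff_not_dvd hd).2 (fun H => hdn (Int.natCast_dvd.2 H))
      |>.isCoprime
    refine h a ?_
    have h1 : ((π ^ n) ^ (v * n.sign)) a = a := Equiv.Perm.zpow_apply_eq_self_of_apply_eq_self hn _
    rw [← zpow_mul] at h1
    have h2 : π ^ (u * d) = 1 := by rw [mul_comm, zpow_mul, zpow_natCast, hπ, one_zpow]
    have h3 : u * d + n * (v * n.sign) = 1 := by
      rw [← huv, ← Int.sign_mul_self_eq_natAbs]
      ring
    rw [← zpow_one π, ← h3, zpow_add, h2, one_mul, h1]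
  let r (a : α) : α := (Quotient.mk (Equiv.Perm.SameCycle.setoid π) a).out
  have hr (a : α) : π.SameCycle (r a) a :=
    Quotient.exact (s := Equiv.Perm.SameCycle.setoid π) (Quotient.out_eq _)
  have hr' (a : α) : r (π a) = r a :=
    congrArg Quotient.out (Quotient.sound (s := Equiv.Perm.SameCycle.setoid π)
      ((Equiv.Perm.sameCycle_apply_left (f := π)).2 (Equiv.Perm.SameCycle.refl π a)))
  choose n hn using hr
  refine ⟨fun a => (n a : ZMod d), fun a => ?_⟩
  have h1 := hn (π a)
  rw [hr'] at h1
  have h2 : (π ^ (-(n a + 1) + n (π a))) (r a) = r a := by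
    rw [zpow_add, Equiv.Perm.mul_apply, h1, zpow_neg, Equiv.Perm.inv_eq_iff_eq, add_comm,
      zpow_add, Equiv.Perm.mul_apply, hn, zpow_one]
  have h3 := (ZMod.intCast_zmod_eq_zero_iff_dvd _ d).2 (hdvd h2)
  push_cast at h3
  linear_combination h3

namespace BraidGroup

variable {m : ℕ}

theorem exists_perm_apply_eq {p : ℕ} (hp : p ≤ m) : ∃ g : BraidGroup m, perm m g p = m := by
  induction hp using Nat.decreasingInduction with
  | self => exact ⟨1, by simp⟩
  | of_succ p hp ih =>
    obtain ⟨g, hg⟩ := ih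
    exact ⟨g * σ m p, by rw [map_mul, Equiv.Perm.mul_apply, perm_σ hp, Equiv.swap_apply_left, hg]⟩

theorem exists_perm_eq : ∀ {m : ℕ} (π : Equiv.Perm ℕ), (∀ k, m < k → π k = k) →
    ∃ g : BraidGroup m, perm m g = π
  | 0, π, h => by
    refine ⟨1, ?_⟩
    rw [map_one]
    ext k
    rcases Nat.eq_zero_or_pos k with rfl | hk
    · by_contra h0
      have h1 : 0 < π 0 := Nat.pos_of_ne_zero fun H => h0 H.symm
      exact h1.ne' (π.injective (h _ h1))
    · rw [h k hk, Equiv.Perm.one_apply]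
  | m + 1, π, h => by
    have hle : π (m + 1) ≤ m + 1 := by
      by_contra H
      exact H (π.injective (h _ (not_le.1 H))).le
    obtain ⟨g, hg⟩ := exists_perm_apply_eq hle
    obtain ⟨b, hb⟩ := exists_perm_eq (m := m) (perm _ g * π) fun k hk => by
      rcases (Nat.succ_le_of_lt hk).eq_or_lt with rfl | hk
      · exact hg
      · rw [Equiv.Perm.mul_apply, h k hk, perm_of_gt _ hk]
    exact ⟨g⁻¹ * incl m b, by rw [map_mul, perm_incl, hb, map_inv, inv_mul_cancel_left]⟩

/-- The permutation of the strands. -/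
def permFin (m : ℕ) : BraidGroup m →* Equiv.Perm (Fin (m + 1)) where
  toFun g :=
    { toFun := fun i => ⟨perm m g i, Nat.lt_succ_of_le (perm_le g (Nat.le_of_lt_succ i.2))⟩
      invFun := fun i => ⟨perm m g⁻¹ i, Nat.lt_succ_of_le (perm_le _ (Nat.le_of_lt_succ i.2))⟩
      left_inv := fun i => by simp
      right_inv := fun i => by simp }
  map_one' := by ext; simp
  map_mul' g h := by ext; simp

theorem permFin_apply (g : BraidGroup m) (i : Fin (m + 1)) : (permFin m g i : ℕ) = perm m g i := rfl

theorem abelianization_artin_X (g : BraidGroup m) {k : ℕ} (hk : k ≤ m) :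
    Abelianization.of (artin m g (X (m + 1) k)) = Abelianization.of (X (m + 1) (perm m g k)) := by
  let S : Subgroup (BraidGroup m) :=
    { carrier := {g | ∀ k ≤ m, Abelianization.of (artin m g (X (m + 1) k)) =
        Abelianization.of (X (m + 1) (perm m g k))}
      one_mem' := fun k _ => by simp
      mul_mem' := fun {a b} ha hb k hk => by
        rw [map_mul, map_mul, MulAut.mul_apply, Equiv.Perm.mul_apply, ← ha _ (perm_le b hk)]
        exact congrArg (Abelianization.map (artin m a).toMonoidHom) (hb k hk)
      inv_mem' := fun {a} ha k hk => by
        have := congrArg (Abelianization.map (artin m a⁻¹).toMonoidHom) (ha _ (perm_le a⁻¹ hk))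
        simpa using this.symm }
  refine mem_of_σ_mem (S := S) (fun i hi k hk => ?_) g k hk
  rw [perm_σ hi]
  rcases eq_or_ne k i with rfl | h1
  · rw [artin_X_self hi, Equiv.swap_apply_left]
  · rcases eq_or_ne k (i + 1) with rfl | h2
    · rw [artin_X_succ hi, Equiv.swap_apply_right]
      simp
    · rw [artin_X_ne hi hk h1 h2, Equiv.swap_apply_of_ne_of_ne h1 h2]

theorem lift_single_apply {k d : ℕ} (f : F k) (j : Fin k) :
    (FreeGroup.lift (fun a : Fin k => Multiplicative.ofAdd (Pi.single a (1 : ZMod d))) f).toAdd j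
      = (ab f j : ZMod d) := by
  induction f using FreeGroup.induction_on with
  | C1 => simp
  | of a =>
    rw [FreeGroup.lift_apply_of, toAdd_ofAdd, ← X_of_lt a.2, ab_X a.2, Pi.single_apply]
    simp [Fin.ext_iff, eq_comm]
  | inv_of a h => rw [_root_.map_inv, toAdd_inv, Pi.neg_apply, h, ab_inv, Int.cast_neg]
  | mul a b ha hb => simp [ha, hb]

theorem eq_one_of_pow_prime {d : ℕ} (hd : d.Prime) : ∀ {m : ℕ} {w : BraidGroup m}, w ^ d = 1 → w = 1
  | 0, w, _ => mem_of_σ_mem (S := ⊥) (fun i hi => absurd hi (Nat.not_lt_zero i)) w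
  | m + 1, w, hw => by
    by_cases hfix : ∃ p ≤ m + 1, perm _ w p = p
    · obtain ⟨p, hp, hwp⟩ := hfix
      obtain ⟨u, hu⟩ := exists_perm_apply_eq hp
      have h1 : perm _ (u * w * u⁻¹) (m + 1) = m + 1 := by
        have : (perm _ u)⁻¹ (m + 1) = p := by rw [Equiv.Perm.inv_eq_iff_eq, hu]
        rw [map_mul, map_mul, map_inv, Equiv.Perm.mul_apply, Equiv.Perm.mul_apply, this, hwp, hu]
      have h2 := eq_ι_of_perm h1
      have h3 : (u * w * u⁻¹) ^ d = 1 := by rw [conj_pow, hw]; group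
      generalize coc (u * w * u⁻¹) (m + 1) = c at h2
      rw [h2, ← map_pow] at h3
      have h4 : c ^ d = 1 := ι_injective (h3.trans (map_one _).symm)
      have h5 : c.right = 1 := eq_one_of_pow_prime hd (by
        have := congrArg SemidirectProduct.rightHom h4
        rwa [map_pow, map_one] at this)
      have h6 : c = SemidirectProduct.inl c.left := SemidirectProduct.ext (by simp) (by simp [h5])
      have h7 : c.left = 1 := by
        rw [h6, ← map_pow] at h4
        have h8 := SemidirectProduct.inl_injective (h4.trans (map_one _).symm)
        exact pow_left_injective hd.ne_zero (h8.trans (one_pow d).symm)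
      rw [h6, h7, map_one, map_one] at h2
      simpa using h2
    · exfalso
      push Not at hfix
      have : Fact d.Prime := ⟨hd⟩
      have hπ : permFin _ w ^ d = 1 := by rw [← map_pow, hw, map_one]
      obtain ⟨k, hk⟩ := Equiv.Perm.exists_zmod_translation hd hπ fun i hi =>
        hfix i (Nat.le_of_lt_succ i.2) (congrArg Fin.val hi)
      have h1 := FreeGroup.eq_one_of_fixed (φ := artin _ w) (by rw [← map_pow, hw, map_one]) hπ
        (fun a => by
          have h2 := abelianization_artin_X w (Nat.le_of_lt_succ a.2)
          rwa [X_of_lt a.2, ← permFin_apply, X_of_lt (permFin _ w a).2] at h2) hk (artin_P w)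
      have h2 := lift_single_apply (d := d) (P (m + 1)) 0
      rw [h1, ab_P (Nat.le_of_lt_succ (Fin.is_lt _))] at h2
      simp at h2

theorem eq_one_of_pow {n : ℕ} (hn : n ≠ 0) {w : BraidGroup m} (hw : w ^ n = 1) : w = 1 := by
  induction n using Nat.recOnMul generalizing w with
  | zero => exact absurd rfl hn
  | one => simpa using hw
  | prime p hp => exact eq_one_of_pow_prime hp hw
  | mul a b ha hb =>
    rw [pow_mul] at hw
    exact ha (left_ne_zero_of_mul hn) (hb (right_ne_zero_of_mul hn) hw)

end BraidGroup

/-! ### The periodic elements -/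

namespace BraidGroup

variable {m : ℕ}

theorem isPure_of_mem_center (hm : 2 ≤ m) {g : BraidGroup m}
    (hg : g ∈ Subgroup.center (BraidGroup m)) : IsPure g := by
  refine Equiv.ext fun a => ?_
  by_contra hab
  rw [Equiv.Perm.one_apply] at hab
  have ha : a ≤ m := by
    by_contra h
    exact hab (perm_of_gt g (not_le.1 h))
  have hb := perm_le g ha
  obtain ⟨c, hc, hca, hcb⟩ : ∃ c ≤ m, c ≠ a ∧ c ≠ perm m g a := by
    by_contra! H
    have h0 := H 0
    have h1 := H 1
    have h2 := H 2
    lia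
  obtain ⟨h, hh⟩ := exists_perm_eq (m := m) (Equiv.swap (perm m g a) c) fun k hk =>
    Equiv.swap_apply_of_ne_of_ne (by lia) (by lia)
  have := DFunLike.congr_fun (congrArg (perm m) (Subgroup.mem_center_iff.1 hg h)) a
  rw [map_mul, map_mul, Equiv.Perm.mul_apply, Equiv.Perm.mul_apply, hh, Equiv.swap_apply_left,
    Equiv.swap_apply_of_ne_of_ne (Ne.symm hab) hca.symm] at this
  exact hcb this

theorem mem_center_iff (hm : 2 ≤ m) {g : BraidGroup m} :
    g ∈ Subgroup.center (BraidGroup m) ↔ ∃ k : ℤ, g = z m ^ k := by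
  constructor
  · exact fun hg => pure_central (isPure_of_mem_center hm hg) fun h =>
      (Subgroup.mem_center_iff.1 hg h).symm
  · rintro ⟨k, rfl⟩
    exact Subgroup.mem_center_iff.2 fun h => ((z_comm h).zpow_left k).symm

theorem cr_pow_of_fixed {g : BraidGroup m} {p q : ℕ} (hp : perm m g p = p) (hq : perm m g q = q)
    (n : ℕ) : cr (g ^ n) p q = n * cr g p q := by
  induction n with
  | zero => simp
  | succ n ih =>
    rw [pow_succ, cr_mul, hp, hq, ih]
    push_cast
    ring

/-- A power of a periodic element which fixes two strands is central. -/
theorem exists_pow_eq_of_fixed {g : BraidGroup m} {n : ℕ} (hn : n ≠ 0) {k : ℤ}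
    (hg : g ^ n = z m ^ k) {a p q : ℕ} (hpq : p < q) (hq : q ≤ m)
    (hp' : perm m (g ^ a) p = p) (hq' : perm m (g ^ a) q = q) : ∃ c : ℤ, g ^ a = z m ^ c := by
  have heven : Even (cr (g ^ a) p q) :=
    (even_cr_iff _ hpq.ne).2 (by rw [hp', hq'])
  obtain ⟨c, hc⟩ := heven
  have h1 := cr_pow_of_fixed hp' hq' n
  have h0 : (g ^ a) ^ n = z m ^ (k * a) := by
    rw [← pow_mul, mul_comm, pow_mul, hg, zpow_mul, zpow_natCast]
  rw [h0, cr_zpow_pure (isPure_z m), cr_z hpq hq, hc] at h1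
  refine ⟨c, ?_⟩
  rw [← mul_inv_eq_one]
  refine eq_one_of_pow hn ?_
  have hcomm : Commute (g ^ a) (z m ^ c)⁻¹ := ((z_comm (g ^ a)).zpow_left c).symm.inv_right
  rw [hcomm.mul_pow, h0, inv_pow, ← zpow_natCast, ← zpow_mul, mul_inv_eq_one]
  congr 1
  linarith

/-- The product of the first `k` generators. -/
def prodσ (m : ℕ) : ℕ → BraidGroup m
  | 0 => 1
  | k + 1 => prodσ m k * σ m k

/-- The product of `k` generators starting from the second one. -/
def prodσ' (m : ℕ) : ℕ → BraidGroup m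
  | 0 => 1
  | k + 1 => prodσ' m k * σ m (k + 1)

theorem prodσ_comm {j k : ℕ} (h : k + 1 ≤ j) : Commute (prodσ m k) (σ m j) := by
  induction k with
  | zero => exact Commute.one_left _
  | succ k ih => exact (ih (by lia)).mul_left (σ_comm (by lia))

theorem prodσ_mul_σ {i k : ℕ} (h : i + 1 < k) (hk : k ≤ m) :
    prodσ m k * σ m i = σ m (i + 1) * prodσ m k := by
  induction k, h using Nat.le_induction with
  | base =>
    calc _ = prodσ m i * (σ m i * σ m (i + 1) * σ m i) := by simp only [prodσ, mul_assoc]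
      _ = _ := by
        rw [σ_braid (by lia), ← mul_assoc, ← mul_assoc, (prodσ_comm le_rfl).eq]
        simp only [prodσ, mul_assoc]
  | succ k h ih =>
    rw [prodσ, mul_assoc, ← (σ_comm (m := m) (show i + 2 ≤ k by lia)).eq, ← mul_assoc,
      ih (by lia), mul_assoc]

theorem prodσ_mul_prodσ {j : ℕ} (h : j + 1 ≤ m) :
    prodσ m m * prodσ m j = prodσ' m j * prodσ m m := by
  induction j with
  | zero => simp [prodσ, prodσ']
  | succ j ih =>
    rw [prodσ, ← mul_assoc, ih (by lia), mul_assoc, prodσ_mul_σ (by lia) le_rfl, prodσ', mul_assoc]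

theorem σ_mul_prodσ' (j : ℕ) : σ m 0 * prodσ' m j = prodσ m (j + 1) := by
  induction j with
  | zero => simp [prodσ, prodσ']
  | succ j ih => rw [prodσ', ← mul_assoc, ih, prodσ, prodσ, prodσ]

/-- The rotation `σ₀ ⋯ σₘ₋₁` of all the strands. -/
def δ (m : ℕ) : BraidGroup m := prodσ m m

/-- The rotation `δ σ₀` of all the strands but one. -/
def ε (m : ℕ) : BraidGroup m := δ m * σ m 0

theorem δ_mul_σ {i : ℕ} (h : i + 1 < m) : δ m * σ m i = σ m (i + 1) * δ m := prodσ_mul_σ h le_rfl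

theorem σ_eq_conj_δ {i : ℕ} (h : i < m) : σ m i = δ m ^ i * σ m 0 * (δ m ^ i)⁻¹ := by
  induction i with
  | zero => simp
  | succ i ih =>
    rw [← mul_inv_eq_of_eq_mul (δ_mul_σ h), ih (by lia), pow_succ']
    group

theorem δ_sq_mul_σ_last : δ (m + 1) ^ 2 * σ (m + 1) m = σ (m + 1) 0 * δ (m + 1) ^ 2 := by
  have h1 := prodσ_mul_prodσ (m := m + 1) (j := m) le_rfl
  have h2 : σ (m + 1) 0 * (δ (m + 1) * prodσ (m + 1) m) = δ (m + 1) ^ 2 := by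
    rw [δ, h1, ← mul_assoc, σ_mul_prodσ', sq]
  have h3 : δ (m + 1) ^ 2 = δ (m + 1) * prodσ (m + 1) m * σ (m + 1) m := by
    rw [sq, mul_assoc]; rfl
  nth_rw 2 [h3]
  rw [← mul_assoc, h2]

theorem δ_pow_mem_center : δ m ^ (m + 1) ∈ Subgroup.center (BraidGroup m) := by
  refine Subgroup.mem_center_iff.2 fun g => ?_
  refine mem_of_σ_mem (S := Subgroup.centralizer {δ m ^ (m + 1)}) (fun i hi => ?_) g |>
    Subgroup.mem_centralizer_singleton_iff.1
  obtain _ | m := m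
  · lia
  rw [Subgroup.mem_centralizer_singleton_iff]
  have h0 : Commute (σ (m + 1) 0) (δ (m + 1) ^ (m + 1 + 1)) := by
    have h1 := δ_sq_mul_σ_last (m := m)
    rw [σ_eq_conj_δ (Nat.lt_succ_self m)] at h1
    have h2 : δ (m + 1) ^ (m + 1 + 1) = δ (m + 1) ^ 2 * δ (m + 1) ^ m := by
      rw [← pow_add]; congr 1; lia
    show _ * _ = _ * _
    rw [h2, ← mul_assoc, ← h1]
    group
  rw [σ_eq_conj_δ hi]
  have h1 : Commute (δ (m + 1) ^ i) (δ (m + 1) ^ (m + 1 + 1)) := Commute.pow_pow_self _ _ _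
  exact (h1.mul_left h0).mul_left h1.inv_left

theorem ε_pow {j : ℕ} (h : j + 1 ≤ m) : ε m ^ j = prodσ' m j * δ m ^ j := by
  induction j with
  | zero => simp [prodσ']
  | succ j ih =>
    rw [pow_succ', ih (by lia), ε, mul_assoc, ← mul_assoc (σ m 0), σ_mul_prodσ', ← mul_assoc, δ,
      prodσ_mul_prodσ h, mul_assoc, ← pow_succ']

theorem ε_pow_self (hm : m ≠ 0) : ε m ^ m = δ m ^ (m + 1) := by
  obtain ⟨m, rfl⟩ := Nat.exists_eq_succ_of_ne_zero hm
  rw [Nat.succ_eq_add_one, pow_succ', ε_pow le_rfl, ε, mul_assoc, ← mul_assoc (σ _ 0),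
    σ_mul_prodσ', pow_succ', pow_succ']
  rfl

theorem perm_prodσ {k : ℕ} (hk : k ≤ m) (p : ℕ) :
    perm m (prodσ m k) p = if p < k then p + 1 else if p = k then 0 else p := by
  induction k generalizing p with
  | zero => simp +contextual [prodσ]
  | succ k ih =>
    rw [prodσ, map_mul, Equiv.Perm.mul_apply, perm_σ hk, Equiv.swap_apply_def, ih (by lia)]
    split_ifs <;> lia

theorem perm_δ {p : ℕ} (hp : p < m) : perm m (δ m) p = p + 1 := by
  rw [δ, perm_prodσ le_rfl, if_pos hp]

theorem perm_δ_last : perm m (δ m) m = 0 := by simp [δ, perm_prodσ]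

theorem perm_δ_pow {a : ℕ} (ha : a ≤ m) : perm m (δ m ^ a) 0 = a := by
  induction a with
  | zero => simp
  | succ a ih => rw [pow_succ', map_mul, Equiv.Perm.mul_apply, ih (by lia), perm_δ ha]

theorem perm_ε_pow (hm : 2 ≤ m) {a : ℕ} (ha : a + 2 ≤ m) : perm m (ε m ^ a) 2 = a + 2 := by
  induction a with
  | zero => simp
  | succ a ih =>
    rw [pow_succ', map_mul, Equiv.Perm.mul_apply, ih (by lia), ε, map_mul, Equiv.Perm.mul_apply,
      perm_σ (by lia), Equiv.swap_apply_of_ne_of_ne (by lia) (by lia), perm_δ (by lia)]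

theorem dvd_of_δ_pow_mem_center (hm : 2 ≤ m) {a : ℕ}
    (h : δ m ^ a ∈ Subgroup.center (BraidGroup m)) : m + 1 ∣ a := by
  have h1 : δ m ^ (a % (m + 1)) ∈ Subgroup.center (BraidGroup m) := by
    have h2 : δ m ^ (a % (m + 1)) = δ m ^ a * ((δ m ^ (m + 1)) ^ (a / (m + 1)))⁻¹ := by
      rw [eq_mul_inv_iff_mul_eq, ← pow_mul, ← pow_add, Nat.mod_add_div]
    rw [h2]
    exact mul_mem h (inv_mem (pow_mem δ_pow_mem_center _))
  have h2 := perm_δ_pow (Nat.le_of_lt_succ (Nat.mod_lt a m.succ_pos))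
  rw [Nat.succ_eq_add_one, isPure_of_mem_center hm h1, Equiv.Perm.one_apply] at h2
  exact Nat.dvd_of_mod_eq_zero h2.symm

theorem dvd_of_ε_pow_mem_center (hm : 2 ≤ m) {a : ℕ}
    (h : ε m ^ a ∈ Subgroup.center (BraidGroup m)) : m ∣ a := by
  have hm0 : m ≠ 0 := by lia
  have h1 : ε m ^ (a % m) ∈ Subgroup.center (BraidGroup m) := by
    have h2 : ε m ^ (a % m) = ε m ^ a * ((ε m ^ m) ^ (a / m))⁻¹ := by
      rw [eq_mul_inv_iff_mul_eq, ← pow_mul, ← pow_add, Nat.mod_add_div]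
    rw [h2, ε_pow_self hm0]
    exact mul_mem h (inv_mem (pow_mem δ_pow_mem_center _))
  have hlt := Nat.mod_lt a (Nat.pos_of_ne_zero hm0)
  refine Nat.dvd_of_mod_eq_zero ?_
  generalize a % m = b at *
  have hb := isPure_of_mem_center hm h1
  rw [IsPure] at hb
  rcases Nat.lt_or_ge m (b + 2) with hb' | hb'
  · obtain ⟨b, rfl⟩ : ∃ c, b = c + 1 := ⟨b - 1, by lia⟩
    have h2 := perm_ε_pow hm (show b + 2 ≤ m by lia)
    have h3 : perm m (ε m ^ (b + 1)) 2 = 0 := by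
      rw [pow_succ', map_mul, Equiv.Perm.mul_apply, h2, ε, map_mul, Equiv.Perm.mul_apply,
        perm_σ (by lia), Equiv.swap_apply_of_ne_of_ne (by lia) (by lia),
        show b + 2 = m by lia, perm_δ_last]
    rw [hb] at h3
    simp at h3
  · have h2 := perm_ε_pow hm hb'
    rw [hb, Equiv.Perm.one_apply] at h2
    lia

end BraidGroup

/-! ### Permutations satisfying cyclic commutation relations -/

/-- The relations satisfied by a permutation which, together with its conjugates by a cyclic
rotation, defines a representation of a braid group such that its product with the rotation
fixes `1` and permutes cyclically the other points. -/
structure IsCyclicBraid {N : ℕ} (f : ZMod N → ZMod N) : Prop where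
  injective : Function.Injective f
  apply_one : f 1 = 0
  comm : ∀ j, j ≠ 0 → j ≠ 1 → j ≠ -1 → ∀ p, f (f (p - j) + j) = f (f p - j) + j
  free : ∀ v ≠ 0, ∀ k, 0 < k → k + 1 < N → (fun v => f (v + 1))^[k] v ≠ v

namespace IsCyclicBraid

variable {N : ℕ} {f : ZMod N → ZMod N}

theorem cast_ne {a b : ℕ} (ha : a < N) (hb : b < N) (hab : a ≠ b) : (a : ZMod N) ≠ b := by
  rwa [Ne, ZMod.natCast_eq_natCast_iff', Nat.mod_eq_of_lt ha, Nat.mod_eq_of_lt hb]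

theorem exists_cast [NeZero N] {t : ZMod N} (h0 : t ≠ 0) (h1 : t ≠ 1) :
    ∃ i : ℕ, 2 ≤ i ∧ i < N ∧ t = i := by
  refine ⟨t.val, ?_, t.val_lt, (ZMod.natCast_zmod_val t).symm⟩
  by_contra h
  rw [← ZMod.natCast_zmod_val t] at h0 h1
  have h2 : t.val < 2 := not_le.1 h
  interval_cases t.val <;> simp at h0 h1

theorem comm_sub (hf : IsCyclicBraid f) {p q : ZMod N} (h0 : p - q ≠ 0) (h1 : p - q ≠ 1)
    (h2 : p - q ≠ -1) : f (p + (f q - q)) = f (q + (f p - p)) + p - q := by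
  have := hf.comm _ h0 h1 h2 p
  rw [sub_sub_cancel] at this
  rw [show p + (f q - q) = f q + (p - q) by ring, this, show f p - (p - q) = q + (f p - p) by ring]
  ring

theorem apply_sub (hf : IsCyclicBraid f) {t : ZMod N} (h0 : t ≠ 0) (h1 : t ≠ 1) (h2 : t ≠ 2) :
    f (f t - t + 1) = f (t - 1) - (t - 1) := by
  have := hf.comm_sub (p := 1) (q := t) (fun h => h1 (by linear_combination -h))
    (fun h => h0 (by linear_combination -h)) (fun h => h2 (by linear_combination -h))
  rw [add_comm, this, hf.apply_one, show t + (0 - 1) = t - 1 by ring]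
  ring

theorem two_ne_cast {i : ℕ} (hi : 2 < i) (hN : i < N) : (i : ZMod N) ≠ 2 := by
  have := cast_ne (N := N) hN (hi.trans hN) hi.ne'
  exact_mod_cast this

theorem cast_ne_zero {i : ℕ} (hi : 0 < i) (hN : i < N) : (i : ZMod N) ≠ 0 := by
  have := cast_ne (N := N) hN (hi.trans hN) hi.ne'
  exact_mod_cast this

theorem cast_ne_one {i : ℕ} (hi : 1 < i) (hN : i < N) : (i : ZMod N) ≠ 1 := by
  have := cast_ne (N := N) hN (hi.trans hN) hi.ne'
  exact_mod_cast this

theorem apply_sub_cast (hf : IsCyclicBraid f) {i : ℕ} (hi : 2 ≤ i) (hN : i + 1 < N) :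
    f (f (i + 1 : ℕ) - (i + 1 : ℕ) + 1) = f i - i := by
  have := hf.apply_sub (cast_ne_zero (N := N) (i := i + 1) (by lia) hN)
    (cast_ne_one (N := N) (i := i + 1) (by lia) hN) (two_ne_cast (N := N) (i := i + 1) (by lia) hN)
  rw [this]
  push_cast
  ring_nf

/-- If one point apart from `0` and `1` is fixed, then all are. -/
theorem eq_of_fixed [NeZero N] (hf : IsCyclicBraid f) {t : ZMod N} (h0 : t ≠ 0) (h1 : t ≠ 1)
    (ht : f t = t) {t' : ZMod N} (h0' : t' ≠ 0) (h1' : t' ≠ 1) : f t' = t' := by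
  have step {i : ℕ} (hi : 2 ≤ i) (hN : i + 1 < N) :
      f (i + 1 : ℕ) = (i + 1 : ℕ) ↔ f (i : ZMod N) = i := by
    have := hf.apply_sub_cast hi hN
    constructor
    · intro h
      rw [h, sub_self, zero_add, hf.apply_one] at this
      linear_combination -this
    · intro h
      rw [h, sub_self, ← hf.apply_one] at this
      linear_combination hf.injective this
  have all {i : ℕ} (hi : 2 ≤ i) (hN : i < N) :
      f (i : ZMod N) = i ↔ f ((2 : ℕ) : ZMod N) = (2 : ℕ) := by
    induction i, hi using Nat.le_induction with
    | base => rfl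
    | succ i hi ih => rw [step hi hN, ih (by lia)]
  obtain ⟨i, hi, hiN, rfl⟩ := exists_cast h0 h1
  obtain ⟨j, hj, hjN, rfl⟩ := exists_cast h0' h1'
  exact (all hj hjN).2 ((all hi hiN).1 ht)

theorem iterate_sub (hf : IsCyclicBraid f) {i k : ℕ} (hi : 2 ≤ i) (hN : i + k < N) :
    (fun v => f (v + 1))^[k] (f (i + k : ℕ) - (i + k : ℕ)) = f i - i := by
  induction k with
  | zero => simp
  | succ k ih =>
    rw [Function.iterate_succ_apply, ← add_assoc, hf.apply_sub_cast (i := i + k) (by lia) hN]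
    exact ih (by lia)

theorem sub_injOn [NeZero N] (hf : IsCyclicBraid f) (hfp : ∀ t, f t ≠ t) {s t : ZMod N} (hs0 : s ≠ 0) (hs1 : s ≠ 1) (ht0 : t ≠ 0)
    (ht1 : t ≠ 1) (h : f s - s = f t - t) : s = t := by
  obtain ⟨i, hi, hiN, rfl⟩ := exists_cast hs0 hs1
  obtain ⟨j, hj, hjN, rfl⟩ := exists_cast ht0 ht1
  wlog hij : i ≤ j generalizing i j
  · exact (this j hj hjN ht0 ht1 i hi hiN hs0 hs1 h.symm (by lia)).symm
  obtain ⟨k, rfl⟩ := Nat.exists_eq_add_of_le hij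
  by_contra hne
  have h1 := hf.iterate_sub hi hjN
  rw [h] at h1
  refine hf.free _ (sub_ne_zero.2 (hfp _)) k (Nat.pos_of_ne_zero ?_) (by lia) h1
  rintro rfl
  exact hne (by simp)

theorem exists_sub_eq_neg_one [NeZero N] (hN : 5 ≤ N) (hf : IsCyclicBraid f)
    (hfp : ∀ t, f t ≠ t) : ∃ t, t ≠ 0 ∧ t ≠ 1 ∧ f t - t = -1 := by
  by_contra! H
  have two : (2 : ZMod N) ≠ 0 := by exact_mod_cast cast_ne_zero (N := N) (i := 2) (by lia) (by lia)
  have three : (3 : ZMod N) ≠ 0 := by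
    exact_mod_cast cast_ne_zero (N := N) (i := 3) (by lia) (by lia)
  have four : (4 : ZMod N) ≠ 0 := by
    exact_mod_cast cast_ne_zero (N := N) (i := 4) (by lia) (by lia)
  have one : (1 : ZMod N) ≠ 0 := by
    exact_mod_cast cast_ne_zero (N := N) (i := 1) (by lia) (by lia)
  have hm0 : (-1 : ZMod N) ≠ 0 := neg_ne_zero.2 one
  have hm1 : (-1 : ZMod N) ≠ 1 := fun h => two (by linear_combination -h)
  have h21 : (2 : ZMod N) ≠ 1 := fun h => one (by linear_combination h)
  obtain ⟨a, ha⟩ := Finite.surjective_of_injective hf.injective (f (-1) - -1)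
  obtain ⟨w, rfl⟩ : ∃ w, a = w + 1 := ⟨a - 1, by ring⟩
  have hw0 : w ≠ 0 := by
    rintro rfl
    rw [zero_add, hf.apply_one] at ha
    exact hfp (-1) (by linear_combination -ha)
  have hwS {t : ZMod N} (ht0 : t ≠ 0) (ht1 : t ≠ 1) : f t - t ≠ w := by
    rintro rfl
    by_cases ht2 : t = 2
    · subst ht2
      have h1 := hf.iterate_sub (i := 2) (k := N - 3) le_rfl (by lia)
      have h2 : ((2 + (N - 3) : ℕ) : ZMod N) = -1 := by
        rw [eq_neg_iff_add_eq_zero, ← Nat.cast_succ, show (2 + (N - 3)).succ = N by lia,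
          ZMod.natCast_self]
      rw [h2] at h1
      have h3 := hf.free (f (-1) - -1) (sub_ne_zero.2 (hfp _)) (N - 3 + 1) (by lia) (by lia)
      rw [Function.iterate_succ_apply', h1] at h3
      exact h3 ha
    · rw [hf.apply_sub ht0 ht1 ht2] at ha
      have := hf.sub_injOn hfp (fun h => ht1 (by linear_combination h))
        (fun h => ht2 (by linear_combination h)) hm0 hm1 ha
      exact ht0 (by linear_combination this)
  have hw : w = -1 := by
    by_contra hw
    let S : Finset (ZMod N) := ({0, 1}ᶜ : Finset (ZMod N)).image fun t => f t - t
    have hS : S.card = N - 2 := by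
      rw [Finset.card_image_of_injOn, Finset.card_compl, ZMod.card, Finset.card_pair one.symm]
      intro s hs t ht h
      simp only [Finset.coe_compl, Finset.coe_insert, Finset.coe_singleton, Set.mem_compl_iff,
        Set.mem_insert_iff, Set.mem_singleton_iff, not_or] at hs ht
      exact hf.sub_injOn hfp hs.1 hs.2 ht.1 ht.2 h
    have hdisj : Disjoint S {0, -1, w} := by
      rw [Finset.disjoint_right]
      intro x hx hxS
      obtain ⟨t, ht, rfl⟩ := Finset.mem_image.1 hxS
      simp only [Finset.mem_compl, Finset.mem_insert, Finset.mem_singleton, not_or] at ht hx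
      rcases hx with hx | hx | hx
      · exact hfp t (sub_eq_zero.1 hx)
      · exact H t ht.1 ht.2 hx
      · exact hwS ht.1 ht.2 hx
    have h3 : ({0, -1, w} : Finset (ZMod N)).card = 3 :=
      Finset.card_eq_three.2 ⟨0, -1, w, hm0.symm, hw0.symm, Ne.symm hw, rfl⟩
    have := Finset.card_le_univ (S ∪ {0, -1, w})
    rw [Finset.card_union_of_disjoint hdisj, hS, h3, ZMod.card] at this
    lia
  subst hw
  rw [neg_add_cancel] at ha
  have e1 := hf.comm_sub (p := 2) (q := 0) (fun h => two (by linear_combination h))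
    (fun h => one (by linear_combination h)) (fun h => three (by linear_combination h))
  have e2 := hf.comm_sub (p := 2) (q := -1) (fun h => three (by linear_combination h))
    (fun h => two (by linear_combination h)) (fun h => four (by linear_combination h))
  rw [sub_zero, zero_add, ha, e2] at e1
  generalize hv : f 2 - 2 = v at e1
  have hv0 : v ≠ 0 := by
    rintro rfl
    exact hfp 2 (sub_eq_zero.1 hv)
  by_cases hv1 : v = 1
  · subst hv1
    rw [neg_add_cancel, ha, hf.apply_one] at e1
    exact H (-1) hm0 hm1 (by linear_combination e1)
  by_cases hv2 : v = 2
  · subst hv2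
    rw [show (-1 + 2 : ZMod N) = 1 by ring, hf.apply_one] at e1
    exact H 2 two h21 (by linear_combination -e1)
  have := hf.sub_injOn hfp hv0 hv1 (t := -1 + v) (fun h => hv1 (by linear_combination h))
    (fun h => hv2 (by linear_combination h)) (by linear_combination -e1)
  exact one (by linear_combination this)

theorem lt_nine [NeZero N] (hN : 5 ≤ N) (hf : IsCyclicBraid f) (hfp : ∀ t, f t ≠ t) : N < 9 := by
  obtain ⟨t, ht0, ht1, ht⟩ := hf.exists_sub_eq_neg_one hN hfp
  have h1 := Finset.card_le_card_of_injOn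
    (s := ({0, 1, 2, t - 1, t, t + 1} : Finset (ZMod N))ᶜ) (t := {-t, 1 - t}) (fun p => f p - p)
    (fun p hp => ?_) (fun p hp q hq h => ?_)
  · have h2 := Finset.card_le_six (a := (0 : ZMod N)) (b := 1) (c := 2) (d := t - 1) (e := t)
      (f := t + 1)
    have h3 := Finset.card_le_two (a := -t) (b := 1 - t)
    rw [Finset.card_compl, ZMod.card] at h1
    lia
  · simp only [Finset.coe_compl, Finset.coe_insert, Finset.coe_singleton, Set.mem_compl_iff,
      Set.mem_insert_iff, Set.mem_singleton_iff, not_or] at hp ⊢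
    obtain ⟨hp0, hp1, hp2, hp3, hp4, hp5⟩ := hp
    have e1 := hf.comm_sub (p := p) (q := 1) (fun h => hp1 (by linear_combination h))
      (fun h => hp2 (by linear_combination h)) (fun h => hp0 (by linear_combination h))
    have e2 := hf.comm_sub (p := p) (q := t) (fun h => hp4 (by linear_combination h))
      (fun h => hp5 (by linear_combination h)) (fun h => hp3 (by linear_combination h))
    rw [hf.apply_one, zero_sub, ← ht, e2] at e1
    by_contra! hv
    have := hf.sub_injOn hfp (s := 1 + (f p - p)) (t := t + (f p - p)) (fun h => ?_) (fun h => ?_)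
      (fun h => hv.1 (by linear_combination h)) (fun h => hv.2 (by linear_combination h))
      (by linear_combination -e1)
    · exact ht1 (by linear_combination -this)
    · exact hp4 (hf.sub_injOn hfp hp0 hp1 ht0 ht1 (by linear_combination h - ht))
    · exact hfp p (by linear_combination h)
  · simp only [Finset.coe_compl, Finset.coe_insert, Finset.coe_singleton, Set.mem_compl_iff,
      Set.mem_insert_iff, Set.mem_singleton_iff, not_or] at hp hq
    exact hf.sub_injOn hfp hp.1 hp.2.1 hq.1 hq.2.1 h

end IsCyclicBraid

namespace IsCyclicBraid

set_option maxRecDepth 100000 in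
set_option synthInstance.maxSize 100000 in
set_option synthInstance.maxHeartbeats 0 in
set_option maxHeartbeats 0 in
theorem not_cyclic_5 :
    ∀ b : Fin 5, b ≠ 0 → b ≠ 2 →
    ∀ c : Fin 5, c ≠ 0 → c ≠ b → c ≠ 3 → c - 3 ≠ b - 2 →
    ∀ d : Fin 5, d ≠ 0 → d ≠ b → d ≠ c → d ≠ 4 → d - 4 ≠ b - 2 → d - 4 ≠ c - 3 →
    ∀ a : Fin 5, a ≠ 0 → a ≠ b → a ≠ c → a ≠ d →
    ¬ ∀ j : Fin 5, j ≠ 0 → j ≠ 1 → j ≠ -1 → ∀ p : Fin 5, (![a, 0, b, c, d] : Fin 5 → Fin 5) ((![a, 0, b, c, d] : Fin 5 → Fin 5) (p - j) + j) =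
      (![a, 0, b, c, d] : Fin 5 → Fin 5) ((![a, 0, b, c, d] : Fin 5 → Fin 5) p - j) + j := by decide

set_option maxRecDepth 100000 in
set_option synthInstance.maxSize 100000 in
set_option synthInstance.maxHeartbeats 0 in
set_option maxHeartbeats 0 in
theorem not_cyclic_6 :
    ∀ b : Fin 6, b ≠ 0 → b ≠ 2 →
    ∀ c : Fin 6, c ≠ 0 → c ≠ b → c ≠ 3 → c - 3 ≠ b - 2 →
    ∀ d : Fin 6, d ≠ 0 → d ≠ b → d ≠ c → d ≠ 4 → d - 4 ≠ b - 2 → d - 4 ≠ c - 3 →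
    ∀ e : Fin 6, e ≠ 0 → e ≠ b → e ≠ c → e ≠ d → e ≠ 5 → e - 5 ≠ b - 2 → e - 5 ≠ c - 3 → e - 5 ≠ d - 4 →
    ∀ a : Fin 6, a ≠ 0 → a ≠ b → a ≠ c → a ≠ d → a ≠ e →
    ¬ ∀ j : Fin 6, j ≠ 0 → j ≠ 1 → j ≠ -1 → ∀ p : Fin 6, (![a, 0, b, c, d, e] : Fin 6 → Fin 6) ((![a, 0, b, c, d, e] : Fin 6 → Fin 6) (p - j) + j) =
      (![a, 0, b, c, d, e] : Fin 6 → Fin 6) ((![a, 0, b, c, d, e] : Fin 6 → Fin 6) p - j) + j := by decide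

set_option maxRecDepth 100000 in
set_option synthInstance.maxSize 100000 in
set_option synthInstance.maxHeartbeats 0 in
set_option maxHeartbeats 0 in
theorem not_cyclic_7 :
    ∀ b : Fin 7, b ≠ 0 → b ≠ 2 →
    ∀ c : Fin 7, c ≠ 0 → c ≠ b → c ≠ 3 → c - 3 ≠ b - 2 →
    ∀ d : Fin 7, d ≠ 0 → d ≠ b → d ≠ c → d ≠ 4 → d - 4 ≠ b - 2 → d - 4 ≠ c - 3 →
    ∀ e : Fin 7, e ≠ 0 → e ≠ b → e ≠ c → e ≠ d → e ≠ 5 → e - 5 ≠ b - 2 → e - 5 ≠ c - 3 → e - 5 ≠ d - 4 →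
    ∀ i : Fin 7, i ≠ 0 → i ≠ b → i ≠ c → i ≠ d → i ≠ e → i ≠ 6 → i - 6 ≠ b - 2 → i - 6 ≠ c - 3 → i - 6 ≠ d - 4 → i - 6 ≠ e - 5 →
    ∀ a : Fin 7, a ≠ 0 → a ≠ b → a ≠ c → a ≠ d → a ≠ e → a ≠ i →
    ¬ ∀ j : Fin 7, j ≠ 0 → j ≠ 1 → j ≠ -1 → ∀ p : Fin 7, (![a, 0, b, c, d, e, i] : Fin 7 → Fin 7) ((![a, 0, b, c, d, e, i] : Fin 7 → Fin 7) (p - j) + j) =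
      (![a, 0, b, c, d, e, i] : Fin 7 → Fin 7) ((![a, 0, b, c, d, e, i] : Fin 7 → Fin 7) p - j) + j := by decide

set_option maxRecDepth 100000 in
set_option synthInstance.maxSize 100000 in
set_option synthInstance.maxHeartbeats 0 in
set_option maxHeartbeats 0 in
theorem not_cyclic_8 :
    ∀ b : Fin 8, b ≠ 0 → b ≠ 2 →
    ∀ c : Fin 8, c ≠ 0 → c ≠ b → c ≠ 3 → c - 3 ≠ b - 2 →
    ∀ d : Fin 8, d ≠ 0 → d ≠ b → d ≠ c → d ≠ 4 → d - 4 ≠ b - 2 → d - 4 ≠ c - 3 →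
    ∀ e : Fin 8, e ≠ 0 → e ≠ b → e ≠ c → e ≠ d → e ≠ 5 → e - 5 ≠ b - 2 → e - 5 ≠ c - 3 → e - 5 ≠ d - 4 →
    ∀ i : Fin 8, i ≠ 0 → i ≠ b → i ≠ c → i ≠ d → i ≠ e → i ≠ 6 → i - 6 ≠ b - 2 → i - 6 ≠ c - 3 → i - 6 ≠ d - 4 → i - 6 ≠ e - 5 →
    ∀ l : Fin 8, l ≠ 0 → l ≠ b → l ≠ c → l ≠ d → l ≠ e → l ≠ i → l ≠ 7 → l - 7 ≠ b - 2 → l - 7 ≠ c - 3 → l - 7 ≠ d - 4 → l - 7 ≠ e - 5 → l - 7 ≠ i - 6 →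
    ∀ a : Fin 8, a ≠ 0 → a ≠ b → a ≠ c → a ≠ d → a ≠ e → a ≠ i → a ≠ l →
    ¬ ∀ j : Fin 8, j ≠ 0 → j ≠ 1 → j ≠ -1 → ∀ p : Fin 8, (![a, 0, b, c, d, e, i, l] : Fin 8 → Fin 8) ((![a, 0, b, c, d, e, i, l] : Fin 8 → Fin 8) (p - j) + j) =
      (![a, 0, b, c, d, e, i, l] : Fin 8 → Fin 8) ((![a, 0, b, c, d, e, i, l] : Fin 8 → Fin 8) p - j) + j := by decide

set_option maxHeartbeats 0 in
theorem exists_fixed {N : ℕ} {f : ZMod N → ZMod N} (hN : 5 ≤ N) (hf : IsCyclicBraid f) :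
    ∃ t, f t = t := by
  by_contra! hfp
  have : NeZero N := ⟨by lia⟩
  have h9 := hf.lt_nine hN hfp
  have h1 := hf.apply_one
  have hsub : ∀ s t : ZMod N, s ≠ 0 → s ≠ 1 → t ≠ 0 → t ≠ 1 → s ≠ t → f s - s ≠ f t - t :=
    fun s t hs0 hs1 ht0 ht1 hst h => hst (hf.sub_injOn hfp hs0 hs1 ht0 ht1 h)
  have hinj : ∀ s t : ZMod N, s ≠ t → f s ≠ f t := fun s t hst h => hst (hf.injective h)
  have hzero : ∀ s : ZMod N, s ≠ 1 → f s ≠ 0 := fun s hs h => hs (hf.injective (h.trans h1.symm))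
  have hc : ∀ g : ZMod N → ZMod N, g = f → ∀ j, j ≠ 0 → j ≠ 1 → j ≠ -1 →
      ∀ p, g (g (p - j) + j) = g (g p - j) + j := by
    rintro _ rfl
    exact hf.comm
  interval_cases N
  · refine not_cyclic_5 (f 2) ?_ ?_ (f 3) ?_ ?_ ?_ ?_ (f 4) ?_ ?_ ?_ ?_ ?_ ?_ (f 0) ?_ ?_ ?_ ?_ ?_
    any_goals first
      | exact hfp _
      | exact hzero _ (by decide)
      | exact hinj _ _ (by decide)
      | exact hsub _ _ (by decide) (by decide) (by decide) (by decide) (by decide)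
    have h : (![f 0, 0, f 2, f 3, f 4] : ZMod 5 → ZMod 5) = f :=
      (congrArg (fun x => ![f 0, x, f 2, f 3, f 4]) h1.symm).trans
        (FinVec.etaExpand_eq (m := 5) f)
    exact hc _ h
  · refine not_cyclic_6 (f 2) ?_ ?_ (f 3) ?_ ?_ ?_ ?_ (f 4) ?_ ?_ ?_ ?_ ?_ ?_ (f 5) ?_ ?_ ?_ ?_ ?_ ?_ ?_ ?_ (f 0) ?_ ?_ ?_ ?_ ?_ ?_
    any_goals first
      | exact hfp _
      | exact hzero _ (by decide)
      | exact hinj _ _ (by decide)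
      | exact hsub _ _ (by decide) (by decide) (by decide) (by decide) (by decide)
    have h : (![f 0, 0, f 2, f 3, f 4, f 5] : ZMod 6 → ZMod 6) = f :=
      (congrArg (fun x => ![f 0, x, f 2, f 3, f 4, f 5]) h1.symm).trans
        (FinVec.etaExpand_eq (m := 6) f)
    exact hc _ h
  · refine not_cyclic_7 (f 2) ?_ ?_ (f 3) ?_ ?_ ?_ ?_ (f 4) ?_ ?_ ?_ ?_ ?_ ?_ (f 5) ?_ ?_ ?_ ?_ ?_ ?_ ?_ ?_ (f 6) ?_ ?_ ?_ ?_ ?_ ?_ ?_ ?_ ?_ ?_ (f 0) ?_ ?_ ?_ ?_ ?_ ?_ ?_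
    any_goals first
      | exact hfp _
      | exact hzero _ (by decide)
      | exact hinj _ _ (by decide)
      | exact hsub _ _ (by decide) (by decide) (by decide) (by decide) (by decide)
    have h : (![f 0, 0, f 2, f 3, f 4, f 5, f 6] : ZMod 7 → ZMod 7) = f :=
      (congrArg (fun x => ![f 0, x, f 2, f 3, f 4, f 5, f 6]) h1.symm).trans
        (FinVec.etaExpand_eq (m := 7) f)
    exact hc _ h
  · refine not_cyclic_8 (f 2) ?_ ?_ (f 3) ?_ ?_ ?_ ?_ (f 4) ?_ ?_ ?_ ?_ ?_ ?_ (f 5) ?_ ?_ ?_ ?_ ?_ ?_ ?_ ?_ (f 6) ?_ ?_ ?_ ?_ ?_ ?_ ?_ ?_ ?_ ?_ (f 7) ?_ ?_ ?_ ?_ ?_ ?_ ?_ ?_ ?_ ?_ ?_ ?_ (f 0) ?_ ?_ ?_ ?_ ?_ ?_ ?_ ?_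
    any_goals first
      | exact hfp _
      | exact hzero _ (by decide)
      | exact hinj _ _ (by decide)
      | exact hsub _ _ (by decide) (by decide) (by decide) (by decide) (by decide)
    have h : (![f 0, 0, f 2, f 3, f 4, f 5, f 6, f 7] : ZMod 8 → ZMod 8) = f :=
      (congrArg (fun x => ![f 0, x, f 2, f 3, f 4, f 5, f 6, f 7]) h1.symm).trans
        (FinVec.etaExpand_eq (m := 8) f)
    exact hc _ h

/-- A cyclic braid permutation on at least five points is a transposition. -/
theorem apply_eq_self {N : ℕ} {f : ZMod N → ZMod N} (hN : 5 ≤ N) (hf : IsCyclicBraid f)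
    {t : ZMod N} (h0 : t ≠ 0) (h1 : t ≠ 1) : f t = t := by
  have : NeZero N := ⟨by lia⟩
  have one : (0 : ZMod N) ≠ 1 := by
    exact_mod_cast (cast_ne_zero (N := N) (i := 1) (by lia) (by lia)).symm
  obtain ⟨s, hs⟩ := hf.exists_fixed hN
  refine hf.eq_of_fixed (fun h => ?_) (fun h => ?_) hs h0 h1
  · subst h
    exact one (hf.injective (hs.trans hf.apply_one.symm))
  · rw [h, hf.apply_one] at hs
    exact one hs

set_option maxRecDepth 100000 in
set_option synthInstance.maxSize 100000 in
set_option synthInstance.maxHeartbeats 0 in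
set_option maxHeartbeats 0 in
theorem fourCycle : ∀ a : Fin 4, ∀ b : Fin 4, ∀ c : Fin 4, a ≠ 0 → b ≠ 0 → c ≠ 0 → a ≠ b →
    a ≠ c → b ≠ c → b ≠ 2 → c ≠ 3 →
    (∀ v : Fin 4, v ≠ 0 → (![a, 0, b, c] : Fin 4 → Fin 4) (v + 1) ≠ v) →
    (∀ v : Fin 4, v ≠ 0 → (![a, 0, b, c] : Fin 4 → Fin 4)
      ((![a, 0, b, c] : Fin 4 → Fin 4) (v + 1) + 1) ≠ v) →
    (∀ p : Fin 4, (![a, 0, b, c] : Fin 4 → Fin 4) ((![a, 0, b, c] : Fin 4 → Fin 4) (p - 2) + 2) =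
      (![a, 0, b, c] : Fin 4 → Fin 4) ((![a, 0, b, c] : Fin 4 → Fin 4) p - 2) + 2) →
    a = 2 ∧ b = 3 ∧ c = 1 := by
  decide

/-- The exceptional permutation of four points. -/
theorem apply_eq_self_or_eq_four {f : ZMod 4 → ZMod 4} (hf : IsCyclicBraid f) :
    (f 2 = 2 ∧ f 3 = 3) ∨ f = ![2, 0, 3, 1] := by
  by_cases h2 : f 2 = 2
  · exact Or.inl ⟨h2, hf.eq_of_fixed (t := 2) (by decide) (by decide) h2 (by decide) (by decide)⟩
  by_cases h3 : f 3 = 3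
  · exact Or.inl ⟨hf.eq_of_fixed (t := 3) (by decide) (by decide) h3 (by decide) (by decide), h3⟩
  right
  have h1 := hf.apply_one
  have h : (![f 0, 0, f 2, f 3] : ZMod 4 → ZMod 4) = f :=
    (congrArg (fun x => ![f 0, x, f 2, f 3]) h1.symm).trans (FinVec.etaExpand_eq (m := 4) f)
  have hinj : ∀ s t : ZMod 4, s ≠ t → f s ≠ f t := fun s t hst h => hst (hf.injective h)
  have hzero : ∀ s : ZMod 4, s ≠ 1 → f s ≠ 0 := fun s hs h => hs (hf.injective (h.trans h1.symm))
  have hc := hf.comm 2 (by decide) (by decide) (by decide)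
  obtain ⟨ha, hb, hc⟩ := fourCycle (f 0) (f 2) (f 3) (hzero _ (by decide)) (hzero _ (by decide))
    (hzero _ (by decide)) (hinj _ _ (by decide)) (hinj _ _ (by decide)) (hinj _ _ (by decide)) h2 h3
    (fun v hv => h ▸ hf.free v hv 1 (by decide) (by decide))
    (fun v hv => h ▸ hf.free v hv 2 (by decide) (by decide))
    (fun p => h ▸ hc p)
  rw [← h, ha, hb, hc]
  rfl

end IsCyclicBraid

namespace Equiv.Perm

variable {m : ℕ}

/-- A permutation of `m + 1` points whose nontrivial orbits have `m` elements fixes a point. -/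
theorem exists_fixed_of_dvd {y : Perm (Fin (m + 1))} (hm : 2 ≤ m) (h1 : y ^ m = 1)
    (hy : ∀ a p q, p ≠ q → (y ^ a) p = p → (y ^ a) q = q → m ∣ a) : ∃ q, y q = q := by
  by_contra! hq
  let T : Finset (Fin (m + 1)) := (Finset.range m).image fun i => (y ^ i) 0
  have hT : T.card = m := by
    rw [Finset.card_image_of_injOn, Finset.card_range]
    have key {i j : ℕ} (hj : j < m) (hij : i ≤ j) (h : (y ^ i) 0 = (y ^ j) 0) : i = j := by
      obtain ⟨k, rfl⟩ := Nat.exists_eq_add_of_le hij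
      rw [pow_add, mul_apply] at h
      have h2 := ((y ^ i).injective h).symm
      have h3 := hy k 0 (y 0) (hq 0).symm h2 (by
        rw [← mul_apply, ← pow_succ, pow_succ', mul_apply, h2])
      have := Nat.eq_zero_of_dvd_of_lt h3 (by lia)
      lia
    intro i hi j hj h
    rw [Finset.mem_coe, Finset.mem_range] at hi hj
    rcases le_total i j with hij | hij
    · exact key hj hij h
    · exact (key hi hij h.symm).symm
  have hmem (i : ℕ) : (y ^ i) 0 ∈ T := by
    rw [pow_eq_pow_mod i h1]
    exact Finset.mem_image_of_mem _ (Finset.mem_range.2 (Nat.mod_lt _ (by lia)))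
  have hTc : Tᶜ.card = 1 := by rw [Finset.card_compl, hT, Fintype.card_fin]; lia
  obtain ⟨q, hT'⟩ := Finset.card_eq_one.1 hTc
  have hqT : q ∉ T := Finset.mem_compl.1 (hT' ▸ Finset.mem_singleton_self q)
  refine hq q ?_
  rw [← Finset.mem_singleton, ← hT', Finset.mem_compl]
  intro h
  obtain ⟨i, -, hi⟩ := Finset.mem_image.1 h
  refine hqT ?_
  have h2 : q = (y ^ (m - 1 + i)) 0 := by
    rw [pow_add, mul_apply, hi, ← mul_apply, ← pow_succ, Nat.sub_add_cancel (by lia), h1, one_apply]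
  rw [h2]
  exact hmem _

/-- Coordinates in which a cyclic permutation is a translation. -/
theorem exists_zmod_equiv {x : Perm (Fin (m + 1))} (hm : 2 ≤ m) (h1 : x ^ (m + 1) = 1)
    (hx : ∀ a p q, p ≠ q → (x ^ a) p = p → (x ^ a) q = q → m + 1 ∣ a) (q : Fin (m + 1)) :
    ∃ e : ZMod (m + 1) ≃ Fin (m + 1), e 1 = q ∧ ∀ i, e (i + 1) = x (e i) := by
  have hne : x ≠ 1 := fun h => by
    have := Nat.le_of_dvd one_pos (hx 1 ⟨0, by lia⟩ ⟨1, by lia⟩ (by simp)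
      (by rw [h]; simp) (by rw [h]; simp))
    lia
  obtain ⟨p, hp⟩ : ∃ p, x p ≠ p := by
    by_contra! h
    exact hne (Equiv.ext h)
  let e₀ : ZMod (m + 1) → Fin (m + 1) := fun t => (x ^ t.val) p
  have h2 (i : ℕ) : e₀ i = (x ^ i) p := by
    simp only [e₀]
    rw [ZMod.val_natCast, ← pow_eq_pow_mod i h1]
  have h3 (t : ZMod (m + 1)) : e₀ (t + 1) = x (e₀ t) := by
    obtain ⟨i, rfl⟩ : ∃ i : ℕ, t = i := ⟨t.val, (ZMod.natCast_zmod_val t).symm⟩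
    rw [← Nat.cast_succ, h2, h2, pow_succ', mul_apply]
  have key {i j : ℕ} (hj : j < m + 1) (hij : i ≤ j) (h : (x ^ i) p = (x ^ j) p) : i = j := by
    obtain ⟨k, rfl⟩ := Nat.exists_eq_add_of_le hij
    rw [pow_add, mul_apply] at h
    have h4 := ((x ^ i).injective h).symm
    have h3 := hx k p (x p) hp.symm h4 (by
      rw [← mul_apply, ← pow_succ, pow_succ', mul_apply, h4])
    have := Nat.eq_zero_of_dvd_of_lt h3 (by lia)
    lia
  have hinj : Function.Injective e₀ := by
    intro s t h
    refine ZMod.val_injective _ ?_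
    rcases le_total s.val t.val with hst | hst
    · exact key t.val_lt hst h
    · exact (key s.val_lt hst h.symm).symm
  have hbij : Function.Bijective e₀ :=
    (Fintype.bijective_iff_injective_and_card _).2 ⟨hinj, by rw [ZMod.card, Fintype.card_fin]⟩
  obtain ⟨t₀, rfl⟩ := hbij.2 q
  refine ⟨(Equiv.addRight (t₀ - 1)).trans (Equiv.ofBijective e₀ hbij), ?_, fun i => ?_⟩
  · simp
  · simp only [Equiv.trans_apply, Equiv.coe_addRight, Equiv.ofBijective_apply]
    rw [← h3]
    congr 1
    ring

end Equiv.Perm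

namespace BraidGroup

variable {m : ℕ}

theorem permFin_eq_one {g : BraidGroup m} (hm : 2 ≤ m) (hg : g ∈ Subgroup.center (BraidGroup m)) :
    permFin m g = 1 := by
  ext i
  rw [permFin_apply, isPure_of_mem_center hm hg]
  rfl

theorem pow_mem_center_of_fixed (hm : 2 ≤ m) {g : BraidGroup m} {n : ℕ} (hn : n ≠ 0)
    (hg : g ^ n ∈ Subgroup.center (BraidGroup m)) {a : ℕ} {p q : Fin (m + 1)} (hpq : p ≠ q)
    (hp : (permFin m g ^ a) p = p) (hq : (permFin m g ^ a) q = q) :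
    g ^ a ∈ Subgroup.center (BraidGroup m) := by
  wlog h : p < q generalizing p q
  · exact this hpq.symm hq hp (lt_of_le_of_ne (not_lt.1 h) hpq.symm)
  obtain ⟨k, hk⟩ := (mem_center_iff hm).1 hg
  rw [← map_pow] at hp hq
  exact (mem_center_iff hm).2 (exists_pow_eq_of_fixed hn hk (Fin.lt_def.1 h)
    (Nat.le_of_lt_succ q.2) (congrArg Fin.val hp) (congrArg Fin.val hq))

variable {Φ : BraidGroup m →* BraidGroup m}

theorem exists_isCyclicBraid (hm : 3 ≤ m)
    (hΦ : ∀ g, Φ g ∈ Subgroup.center (BraidGroup m) ↔ g ∈ Subgroup.center (BraidGroup m)) :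
    ∃ e : ZMod (m + 1) ≃ Fin (m + 1), (∀ i, e (i + 1) = permFin m (Φ (δ m)) (e i)) ∧
      IsCyclicBraid fun v => e.symm (permFin m (Φ (σ m 0)) (e v)) := by
  have hx0 : Φ (δ m) ^ (m + 1) ∈ Subgroup.center (BraidGroup m) := by
    rw [← map_pow, hΦ]
    exact δ_pow_mem_center
  have hy0 : Φ (ε m) ^ m ∈ Subgroup.center (BraidGroup m) := by
    rw [← map_pow, hΦ, ε_pow_self (by lia)]
    exact δ_pow_mem_center
  have hx1 := permFin_eq_one (by lia) hx0
  have hy1 := permFin_eq_one (by lia) hy0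
  have hx (a : ℕ) (p q : Fin (m + 1)) (hpq : p ≠ q) (hp : (permFin m (Φ (δ m)) ^ a) p = p)
      (hq : (permFin m (Φ (δ m)) ^ a) q = q) : m + 1 ∣ a := by
    have := pow_mem_center_of_fixed (by lia) (by lia) hx0 hpq hp hq
    rw [← map_pow, hΦ] at this
    exact dvd_of_δ_pow_mem_center (by lia) this
  have hy (a : ℕ) (p q : Fin (m + 1)) (hpq : p ≠ q) (hp : (permFin m (Φ (ε m)) ^ a) p = p)
      (hq : (permFin m (Φ (ε m)) ^ a) q = q) : m ∣ a := by
    have := pow_mem_center_of_fixed (by lia) (by lia) hy0 hpq hp hq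
    rw [← map_pow, hΦ] at this
    exact dvd_of_ε_pow_mem_center (by lia) this
  rw [map_pow] at hx1 hy1
  obtain ⟨q, hq⟩ := Equiv.Perm.exists_fixed_of_dvd (by lia) hy1 hy
  obtain ⟨e, he1, he⟩ := Equiv.Perm.exists_zmod_equiv (by lia) hx1 hx q
  have hε (v : ZMod (m + 1)) :
      permFin m (Φ (ε m)) (e v) = e (e.symm (permFin m (Φ (σ m 0)) (e v)) + 1) := by
    rw [he, e.apply_symm_apply, ε, map_mul, map_mul, Equiv.Perm.mul_apply]
  have hδ (k : ℕ) (v : ZMod (m + 1)) : permFin m (Φ (δ m ^ k)) (e v) = e (v + k) := by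
    induction k with
    | zero => simp
    | succ k ih =>
      rw [pow_succ', map_mul, map_mul, Equiv.Perm.mul_apply, ih, ← he, Nat.cast_succ, add_assoc]
  have hδ' (k : ℕ) (v : ZMod (m + 1)) : permFin m (Φ (δ m ^ k)⁻¹) (e v) = e (v - k) := by
    rw [map_inv, map_inv, Equiv.Perm.inv_eq_iff_eq, hδ, sub_add_cancel]
  refine ⟨e, he, e.symm.injective.comp ((Equiv.injective _).comp e.injective), ?_, ?_, ?_⟩
  · rw [← he1, hε] at hq
    have := e.injective hq
    linear_combination this
  · intro j h0 h1 h2 p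
    obtain ⟨i, hi, hiN, rfl⟩ := IsCyclicBraid.exists_cast h0 h1
    have him : i < m := by
      refine lt_of_le_of_ne (by lia) ?_
      rintro rfl
      refine h2 ?_
      rw [eq_neg_iff_add_eq_zero, ← Nat.cast_succ, ZMod.natCast_self]
    have hc : σ m 0 * (δ m ^ i * σ m 0 * (δ m ^ i)⁻¹) = δ m ^ i * σ m 0 * (δ m ^ i)⁻¹ * σ m 0 := by
      rw [← σ_eq_conj_δ him]
      exact (σ_comm (by lia)).eq
    have h3 := congrArg (fun g => e.symm (permFin m (Φ g) (e p))) hc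
    simp only [map_mul, Equiv.Perm.mul_apply] at h3
    have hs (v : ZMod (m + 1)) : permFin m (Φ (σ m 0)) (e v) =
      e (e.symm (permFin m (Φ (σ m 0)) (e v))) := (e.apply_symm_apply _).symm
    generalize hf : (fun v => e.symm (permFin m (Φ (σ m 0)) (e v))) = f
    have hs' (v : ZMod (m + 1)) : permFin m (Φ (σ m 0)) (e v) = e (f v) := by rw [← hf, ← hs]
    rw [hδ', hs', hδ, hs', hs', hδ', hs', hδ, e.symm_apply_apply, e.symm_apply_apply] at h3
    rw [← hf] at h3
    exact h3
  · intro v hv k hk hkN h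
    have h1 (l : ℕ) : permFin m (Φ (ε m) ^ l) (e (v + 1)) =
        e ((fun v => e.symm (permFin m (Φ (σ m 0)) (e (v + 1))))^[l] v + 1) := by
      induction l with
      | zero => simp
      | succ l ih =>
        rw [pow_succ', map_mul, Equiv.Perm.mul_apply, ih, hε, Function.iterate_succ_apply']
    have h2 := h1 k
    rw [h, map_pow] at h2
    have h3 := hy k (e (v + 1)) q (fun H => hv (by
      rw [← he1] at H
      linear_combination e.injective H)) h2
      (Equiv.Perm.pow_apply_eq_self_of_apply_eq_self hq k)
    have := Nat.eq_zero_of_dvd_of_lt h3 (by lia)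
    lia

end BraidGroup

namespace BraidGroup

variable {m : ℕ}

theorem _root_.Equiv.sum_sum_comp {α β M : Type*} [Fintype α] [Fintype β] [AddCommMonoid M]
    (e : α ≃ β) (F : β → β → M) : ∑ a, ∑ b, F (e a) (e b) = ∑ a, ∑ b, F a b := by
  rw [← Equiv.sum_comp e fun a => ∑ b, F a b]
  exact Finset.sum_congr rfl fun a _ => Equiv.sum_comp e (F (e a))

theorem sum_cr (g : BraidGroup 3) : ∑ a : Fin 4, ∑ b : Fin 4, cr g a b = 2 * exp g := by
  let S : Subgroup (BraidGroup 3) :=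
    { carrier := {g | ∑ a : Fin 4, ∑ b : Fin 4, cr g a b = 2 * exp g}
      one_mem' := by simp [cr_one]
      mul_mem' := fun {g h} hg hh => by
        rw [Set.mem_ofPred_eq] at hg hh ⊢
        have h1 : ∑ a : Fin 4, ∑ b : Fin 4, cr g (perm 3 h a) (perm 3 h b) = 2 * exp g := by
          rw [← hg]
          exact Equiv.sum_sum_comp (permFin 3 h) fun a b : Fin 4 => cr g a b
        simp only [cr_mul, Finset.sum_add_distrib, h1, hh, exp_mul]
        ring
      inv_mem' := fun {g} hg => by
        rw [Set.mem_ofPred_eq] at hg ⊢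
        have h1 : ∑ a : Fin 4, ∑ b : Fin 4, cr (g⁻¹ * g) a b = 0 := by simp [cr_one]
        have h2 : ∑ a : Fin 4, ∑ b : Fin 4, cr g⁻¹ (perm 3 g a) (perm 3 g b) =
            ∑ a : Fin 4, ∑ b : Fin 4, cr g⁻¹ a b :=
          Equiv.sum_sum_comp (permFin 3 g) fun a b : Fin 4 => cr g⁻¹ a b
        simp only [cr_mul, Finset.sum_add_distrib, h2, hg] at h1
        rw [exp_inv]
        lia }
  refine mem_of_σ_mem (S := S) (fun i hi => ?_) g
  show ∑ a : Fin 4, ∑ b : Fin 4, cr (σ 3 i) a b = 2 * exp (σ 3 i)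
  simp only [cr_σ hi, exp_σ hi, Fin.sum_univ_four]
  interval_cases i <;> decide

theorem exp_z_three : exp (z 3) = 12 := by
  have h := sum_cr (z 3)
  have h1 (a b : ℕ) (hab : a < b) (hb : b ≤ 3) : cr (z 3) a b = 2 ∧ cr (z 3) b a = 2 :=
    ⟨cr_z hab hb, by rw [cr_symm, cr_z hab hb]⟩
  have h2 (a : ℕ) : cr (z 3) a a = 0 := cr_of_gt _ (Or.inr rfl)
  simp [Fin.sum_univ_four, h2, h1 0 1, h1 0 2, h1 0 3, h1 1 2, h1 1 3, h1 2 3] at h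
  lia

theorem exp_apply_eq {k : ℕ} (Φ : BraidGroup m →* BraidGroup k) (g : BraidGroup m) :
    exp (Φ g) = exp (Φ (σ m 0)) * exp g := by
  let S : Subgroup (BraidGroup m) :=
    { carrier := {g | exp (Φ g) = exp (Φ (σ m 0)) * exp g}
      one_mem' := by simp
      mul_mem' := fun {g h} hg hh => by
        rw [Set.mem_ofPred_eq] at hg hh ⊢
        rw [map_mul, exp_mul, exp_mul, hg, hh, mul_add]
      inv_mem' := fun {g} hg => by
        rw [Set.mem_ofPred_eq] at hg ⊢
        rw [map_inv, exp_inv, exp_inv, hg, mul_neg] }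
  refine mem_of_σ_mem (S := S) (fun i hi => ?_) g
  show exp (Φ (σ m i)) = exp (Φ (σ m 0)) * exp (σ m i)
  rw [exp_σ hi, mul_one]
  exact (exp_eq_of_isConj (MonoidHom.map_isConj Φ (σ_isConj hi))).symm

/-- The exceptional permutation of four points does not come from a homomorphism that induces
an injective map modulo the center. -/
theorem ne_exceptional {Φ : BraidGroup 3 →* BraidGroup 3}
    (hΦ : ∀ g, Φ g ∈ Subgroup.center (BraidGroup 3) ↔ g ∈ Subgroup.center (BraidGroup 3))
    {e : ZMod 4 ≃ Fin 4} (he : ∀ i, e (i + 1) = permFin 3 (Φ (δ 3)) (e i))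
    {f : ZMod 4 → ZMod 4} (hs : ∀ v, permFin 3 (Φ (σ 3 0)) (e v) = e (f v))
    (hf : f = ![2, 0, 3, 1]) : False := by
  have hδ (v : ZMod 4) : permFin 3 (Φ (δ 3 ^ 2)) (e v) = e (v + 2) := by
    rw [map_pow, map_pow, sq, Equiv.Perm.mul_apply, ← he, ← he, add_assoc, one_add_one_eq_two]
  have hδ' (v : ZMod 4) : permFin 3 (Φ (δ 3 ^ 2)⁻¹) (e v) = e (v - 2) := by
    rw [map_inv, map_inv, Equiv.Perm.inv_eq_iff_eq, hδ, sub_add_cancel]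
  have hs2 (v : ZMod 4) : permFin 3 (Φ (σ 3 2)) (e v) =
      e (f (v - 2) + 2) := by
    rw [σ_eq_conj_δ (by lia), map_mul, map_mul, map_mul, map_mul, Equiv.Perm.mul_apply,
      Equiv.Perm.mul_apply, hδ', hs, hδ]
  set g := Φ (σ 3 0 * σ 3 2) with hg
  have hpure (v : ZMod 4) : permFin 3 g (e v) = e v := by
    rw [hg, map_mul, map_mul, Equiv.Perm.mul_apply, hs2, hs]
    congr 1
    clear * - hf
    subst hf
    revert v
    decide
  have hgp : IsPure g := by
    refine Equiv.ext fun a => ?_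
    rw [Equiv.Perm.one_apply]
    by_cases ha : 3 < a
    · exact perm_of_gt _ ha
    · have := hpure (e.symm ⟨a, by lia⟩)
      rw [e.apply_symm_apply] at this
      exact congrArg Fin.val this
  have hcomm : Φ (σ 3 0) * g * (Φ (σ 3 0))⁻¹ = g := by
    rw [mul_inv_eq_iff_eq_mul, hg, ← map_mul, ← map_mul]
    congr 1
    rw [mul_assoc, (σ_comm (m := 3) (i := 0) (j := 2) le_rfl).eq]
  let c (v w : ZMod 4) : ℤ := cr g (e v) (e w)
  have hc (v w : ZMod 4) : c (f v)
      (f w) = c v w := by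
    have := cr_conj (g := Φ (σ 3 0)) hgp (e v) (e w)
    rwa [hcomm, ← permFin_apply, ← permFin_apply, hs, hs] at this
  have hsymm (v w : ZMod 4) : c v w = c w v := cr_symm _ _ _
  have hdiag (v : ZMod 4) : c v v = 0 := cr_of_gt _ (Or.inr rfl)
  have heven : Even (c 0 3) := by
    refine (even_cr_iff _ fun h => ?_).2 (by rw [hgp]; rfl)
    have := e.injective (Fin.ext h)
    revert this
    decide
  have hsum : ∑ v, ∑ w, c v w = 2 * exp g := by
    rw [← sum_cr]
    exact Equiv.sum_sum_comp e fun a b : Fin 4 => cr g a b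
  have h4 (F : ZMod 4 → ℤ) : ∑ v, F v = F 0 + F 1 + F 2 + F 3 := Fin.sum_univ_four F
  simp only [h4] at hsum
  have c1 : c 2 0 = c 0 1 := by
    have := hc 0 1
    rwa [hf] at this
  have c2 : c 3 2 = c 2 0 := by
    have := hc 2 0
    rwa [hf] at this
  have c3 : c 1 3 = c 3 2 := by
    have := hc 3 2
    rwa [hf] at this
  have c4 : c 2 1 = c 0 3 := by
    have := hc 0 3
    rwa [hf] at this
  rw [hsymm 0 2, hsymm 1 0, hsymm 1 2, hsymm 2 3, hsymm 3 0, hsymm 3 1, hdiag, hdiag, hdiag,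
    hdiag, c3, c2, c1, c4] at hsum
  have hexp : exp g = 2 * exp (Φ (σ 3 0)) := by
    rw [hg, exp_apply_eq, exp_mul, exp_σ (by lia), exp_σ (by lia)]
    ring
  obtain ⟨b, hb⟩ := heven
  have he2 : exp (Φ (σ 3 0)) = 2 * (c 0 1 + b) := by lia
  have hx : Φ (δ 3) ^ 4 ∈ Subgroup.center (BraidGroup 3) := by
    rw [← map_pow, hΦ]
    exact δ_pow_mem_center
  obtain ⟨k, hk⟩ := (mem_center_iff (by lia)).1 hx
  have hk2 : k = 2 * (c 0 1 + b) := by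
    have h1 := congrArg exp hk
    have h2 : exp (δ 3) = 3 := by simp [δ, prodσ, exp_σ]
    rw [exp_pow, exp_zpow, exp_z_three, exp_apply_eq, h2, he2] at h1
    lia
  have h1 : (Φ (δ 3) ^ 2 * z 3 ^ (-(c 0 1 + b))) ^ 2 = 1 := by
    rw [((z_comm _).zpow_left _).symm.mul_pow, ← pow_mul, hk, hk2, ← zpow_natCast, ← zpow_mul,
      ← zpow_add]
    convert zpow_zero (z 3) using 2
    push_cast
    ring
  have h2 := eq_one_of_pow two_ne_zero h1
  rw [mul_eq_one_iff_eq_inv, ← zpow_neg] at h2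
  have h3 := (mem_center_iff (by lia)).2 ⟨_, h2⟩
  rw [← map_pow, hΦ] at h3
  have := dvd_of_δ_pow_mem_center (by lia) h3
  lia

end BraidGroup

namespace BraidGroup

variable {m : ℕ}

theorem exp_prodσ {k : ℕ} (hk : k ≤ m) : exp (prodσ m k) = k := by
  induction k with
  | zero => simp [prodσ]
  | succ k ih =>
    rw [prodσ, exp_mul, ih (by lia), exp_σ hk]
    rfl

theorem eq_one_of_mem_center (hm : 2 ≤ m) {g : BraidGroup m}
    (hg : g ∈ Subgroup.center (BraidGroup m)) (h : exp g = 0) : g = 1 := by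
  obtain ⟨k, rfl⟩ := (mem_center_iff hm).1 hg
  obtain ⟨l, hl⟩ := (mem_center_iff hm).1 (δ_pow_mem_center (m := m))
  have hz : exp (z m) ≠ 0 := fun h0 => by
    have h1 := congrArg exp hl
    rw [exp_zpow, h0, exp_pow, δ, exp_prodσ le_rfl, mul_zero] at h1
    have : (0 : ℤ) < ((m + 1 : ℕ) : ℤ) * m := by positivity
    lia
  rw [exp_zpow] at h
  rw [(mul_eq_zero.1 h).resolve_right hz, zpow_zero]

theorem exists_lift (hm : 2 ≤ m)
    (f : BraidGroup m ⧸ Subgroup.center (BraidGroup m) →*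
      BraidGroup m ⧸ Subgroup.center (BraidGroup m)) :
    ∃ Φ : BraidGroup m →* BraidGroup m, ∀ g : BraidGroup m,
      (Φ g : BraidGroup m ⧸ Subgroup.center (BraidGroup m)) = f g := by
  obtain ⟨S, hS⟩ := QuotientGroup.mk_surjective (f (σ m 0))
  obtain ⟨D, hD⟩ := QuotientGroup.mk_surjective (f (δ m))
  obtain ⟨s, hs, hexp⟩ : ∃ s : ℕ → BraidGroup m, (∀ i < m,
      (s i : BraidGroup m ⧸ Subgroup.center (BraidGroup m)) = f (σ m i)) ∧
      ∀ i, exp (s i) = exp S := by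
    refine ⟨fun i => D ^ i * S * (D ^ i)⁻¹, fun i hi => ?_, fun i => by simp⟩
    rw [σ_eq_conj_δ hi]
    simp only [QuotientGroup.mk_mul, QuotientGroup.mk_inv, QuotientGroup.mk_pow, map_mul, map_inv,
      map_pow, hS, hD]
  have key {a b : BraidGroup m} (hab : exp a = exp b)
      (h : (a : BraidGroup m ⧸ Subgroup.center (BraidGroup m)) = b) : a = b := by
    rw [← inv_mul_eq_one]
    exact eq_one_of_mem_center hm (QuotientGroup.eq.1 h) (by simp [hab])
  let Φ : BraidGroup m →* BraidGroup m := lift s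
    (fun i hi => key (by simp only [exp_mul, hexp]) (by
      simp only [QuotientGroup.mk_mul, hs _ hi, hs i (by lia)]
      simp only [← map_mul, ← QuotientGroup.mk_mul, σ_braid hi]))
    (fun i j hij hj => key (by simp only [exp_mul, hexp]) (by
      simp only [QuotientGroup.mk_mul, hs _ hj, hs i (by lia)]
      simp only [← map_mul, ← QuotientGroup.mk_mul, (σ_comm hij).eq]))
  refine ⟨Φ, fun g => DFunLike.congr_fun (f := (QuotientGroup.mk' _).comp Φ)
    (g := f.comp (QuotientGroup.mk' _)) (hom_ext fun i hi => ?_) g⟩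
  show (Φ (σ m i) : BraidGroup m ⧸ Subgroup.center (BraidGroup m)) = f (σ m i)
  rw [← hs i hi]
  exact congrArg _ (lift_σ hi)

theorem apply_mem_center_iff
    {f : BraidGroup m ⧸ Subgroup.center (BraidGroup m) →*
      BraidGroup m ⧸ Subgroup.center (BraidGroup m)} (hf : Function.Injective f)
    {Φ : BraidGroup m →* BraidGroup m} (hΦ : ∀ g : BraidGroup m,
      (Φ g : BraidGroup m ⧸ Subgroup.center (BraidGroup m)) = f g) (g : BraidGroup m) :
    Φ g ∈ Subgroup.center (BraidGroup m) ↔ g ∈ Subgroup.center (BraidGroup m) := by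
  rw [← QuotientGroup.eq_one_iff, ← QuotientGroup.eq_one_iff, hΦ, map_eq_one_iff f hf]

theorem permFin_surjective : Function.Surjective (permFin m) := by
  intro ρ
  obtain ⟨u, hu⟩ := exists_perm_eq (m := m) (ρ.extendDomain Fin.equivSubtype) fun k hk =>
    Equiv.Perm.extendDomain_apply_not_subtype _ _ (by lia)
  refine ⟨u, Equiv.ext fun i => Fin.ext ?_⟩
  rw [permFin_apply, hu]
  exact Equiv.Perm.extendDomain_apply_image ρ Fin.equivSubtype i

theorem exists_cyclic_coordinates (hm : 3 ≤ m) {Φ : BraidGroup m →* BraidGroup m}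
    (hΦ : ∀ g, Φ g ∈ Subgroup.center (BraidGroup m) ↔ g ∈ Subgroup.center (BraidGroup m)) :
    ∃ e : ZMod (m + 1) ≃ Fin (m + 1), (∀ i, e (i + 1) = permFin m (Φ (δ m)) (e i)) ∧
      ∃ f : ZMod (m + 1) → ZMod (m + 1), (∀ v, permFin m (Φ (σ m 0)) (e v) = e (f v)) ∧
        f 0 = 1 ∧ f 1 = 0 ∧ ∀ v, v ≠ 0 → v ≠ 1 → f v = v := by
  obtain ⟨e, he, hf⟩ := exists_isCyclicBraid hm hΦ
  generalize hfe : (fun v => e.symm (permFin m (Φ (σ m 0)) (e v))) = f at hf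
  have hs (v : ZMod (m + 1)) : permFin m (Φ (σ m 0)) (e v) = e (f v) := by
    rw [← hfe, e.apply_symm_apply]
  have h : ∀ v, v ≠ 0 → v ≠ 1 → f v = v := by
    rcases hm.eq_or_lt with rfl | hm
    · rcases hf.apply_eq_self_or_eq_four with ⟨h2, h3⟩ | h
      · intro v h0 h1
        have : ∀ v : ZMod 4, v ≠ 0 → v ≠ 1 → v = 2 ∨ v = 3 := by decide
        rcases this v h0 h1 with rfl | rfl
        exacts [h2, h3]
      · exact (ne_exceptional hΦ he hs h).elim
    · exact fun v h0 h1 => hf.apply_eq_self (by lia) h0 h1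
  refine ⟨e, he, f, hs, ?_, hf.apply_one, h⟩
  have one : (0 : ZMod (m + 1)) ≠ 1 := by
    exact_mod_cast (IsCyclicBraid.cast_ne_zero (N := m + 1) (i := 1) (by lia) (by lia)).symm
  by_contra h1
  by_cases h0 : f 0 = 0
  · exact one (hf.injective (h0.trans hf.apply_one.symm))
  · exact h0 (hf.injective (h _ h0 h1))

/-- Up to conjugation, the permutations of the strands are preserved. -/
theorem exists_perm_conj_apply (hm : 3 ≤ m) {Φ : BraidGroup m →* BraidGroup m}
    (hΦ : ∀ g, Φ g ∈ Subgroup.center (BraidGroup m) ↔ g ∈ Subgroup.center (BraidGroup m)) :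
    ∃ u, ∀ g, perm m (u * Φ g * u⁻¹) = perm m g := by
  obtain ⟨e, he, f, hs, hf0, hf1, hf⟩ := exists_cyclic_coordinates hm hΦ
  have hδ (k : ℕ) (v : ZMod (m + 1)) : permFin m (Φ (δ m ^ k)) (e v) = e (v + k) := by
    induction k with
    | zero => simp
    | succ k ih =>
      rw [pow_succ', map_mul, map_mul, Equiv.Perm.mul_apply, ih, ← he, Nat.cast_succ, add_assoc]
  have hδ' (k : ℕ) (v : ZMod (m + 1)) : permFin m (Φ (δ m ^ k)⁻¹) (e v) = e (v - k) := by
    rw [map_inv, map_inv, Equiv.Perm.inv_eq_iff_eq, hδ, sub_add_cancel]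
  have hσ {i : ℕ} (hi : i < m) (v : ZMod (m + 1)) :
      permFin m (Φ (σ m i)) (e v) = e (f (v - i) + i) := by
    rw [σ_eq_conj_δ hi, map_mul, map_mul, map_mul, map_mul, Equiv.Perm.mul_apply,
      Equiv.Perm.mul_apply, hδ', hs, hδ]
  have hσ' {i k : ℕ} (hi : i < m) (hk : k ≤ m) :
      permFin m (Φ (σ m i)) (e k) = e (Equiv.swap i (i + 1) k : ℕ) := by
    rw [hσ hi]
    congr 1
    rcases eq_or_ne k i with rfl | h1
    · rw [sub_self, hf0, Equiv.swap_apply_left, Nat.cast_succ]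
      ring
    · rcases eq_or_ne k (i + 1) with rfl | h2
      · rw [Nat.cast_succ, add_sub_cancel_left, hf1, Equiv.swap_apply_right, zero_add]
      · rw [Equiv.swap_apply_of_ne_of_ne h1 h2, hf, sub_add_cancel]
        · exact sub_ne_zero.2 (IsCyclicBraid.cast_ne (by lia) (by lia) h1)
        · intro h
          refine IsCyclicBraid.cast_ne (N := m + 1) (by lia) (by lia) h2 ?_
          rw [Nat.cast_succ]
          linear_combination h
  obtain ⟨u, hu⟩ := permFin_surjective (m := m) (e.symm.trans (Equiv.refl (Fin (m + 1))))
  have hu' {k : ℕ} (hk : k ≤ m) : perm m u (e k) = k := by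
    rw [← permFin_apply, hu]
    show (e.symm (e k)).val = k
    rw [e.symm_apply_apply, ZMod.val_natCast, Nat.mod_eq_of_lt (by lia)]
  refine ⟨u, DFunLike.congr_fun (f := (perm m).comp ((MulAut.conj u).toMonoidHom.comp Φ))
    (g := perm m) (hom_ext fun i hi => ?_)⟩
  show perm m (u * Φ (σ m i) * u⁻¹) = perm m (σ m i)
  refine Equiv.ext fun k => ?_
  by_cases hk : m < k
  · rw [perm_of_gt _ hk, perm_of_gt _ hk]
  · have hk' : k ≤ m := not_lt.1 hk
    have h1 : (perm m u)⁻¹ k = e k := by rw [Equiv.Perm.inv_eq_iff_eq, hu' hk']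
    have h2 : Equiv.swap i (i + 1) k ≤ m := by
      rw [← perm_σ hi]
      exact perm_le _ hk'
    rw [map_mul, map_mul, map_inv, Equiv.Perm.mul_apply, Equiv.Perm.mul_apply, h1, ← permFin_apply,
      hσ' hi hk', hu' h2, perm_σ hi]

end BraidGroup

/-- For `n ≥ 3`, the quotient `B_{n+1}/Z(B_{n+1})` of the braid group on
`n+1` strands by its center is co-Hopfian: every injective endomorphism is surjective. -/
theorem braid_mod_center_coHopfian
    (n : ℕ) (hn : 3 ≤ n)
    (f : BraidGroup n ⧸ Subgroup.center (BraidGroup n) →*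
          BraidGroup n ⧸ Subgroup.center (BraidGroup n))
    (hf : Function.Injective f) :
    Function.Surjective f := by
  obtain ⟨Φ, hΦ⟩ := BraidGroup.exists_lift (by lia) f
  obtain ⟨u, hu⟩ := BraidGroup.exists_perm_conj_apply hn (BraidGroup.apply_mem_center_iff hf hΦ)
  obtain ⟨g, -, e, he, k, h⟩ :=
    BraidGroup.rigid hn ((MulAut.conj u).toMonoidHom.comp Φ) fun g => hu g
  let a : BraidGroup n ⧸ Subgroup.center (BraidGroup n) := (u⁻¹ * g : BraidGroup n)
  have hz : ((BraidGroup.z n ^ k : BraidGroup n) :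
      BraidGroup n ⧸ Subgroup.center (BraidGroup n)) = 1 :=
    (QuotientGroup.eq_one_iff _).2 ((BraidGroup.mem_center_iff (by lia)).2 ⟨k, rfl⟩)
  have hσ {i : ℕ} (hi : i < n) : a * (BraidGroup.σ n i : BraidGroup n) * a⁻¹ ∈ f.range := by
    have h1 : u * Φ (BraidGroup.σ n i) * u⁻¹ = _ := h i hi
    have h2 : Φ (BraidGroup.σ n i) =
        (u⁻¹ * g) * BraidGroup.σ n i ^ e * (u⁻¹ * g)⁻¹ * (u⁻¹ * BraidGroup.z n ^ k * u) := by
      rw [mul_inv_eq_iff_eq_mul, ← eq_inv_mul_iff_mul_eq] at h1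
      rw [h1]
      group
    have h3 : a * (BraidGroup.σ n i : BraidGroup n) ^ e * a⁻¹ = f (BraidGroup.σ n i) := by
      rw [← hΦ, h2, QuotientGroup.mk_mul, QuotientGroup.mk_mul _ _ u, QuotientGroup.mk_mul _ u⁻¹,
        hz, mul_one, QuotientGroup.mk_inv _ u, inv_mul_cancel, mul_one]
      rfl
    refine ⟨(BraidGroup.σ n i : BraidGroup n) ^ e, ?_⟩
    rw [map_zpow, ← h3, conj_zpow, ← zpow_mul]
    rcases he with rfl | rfl <;> simp
  intro y
  obtain ⟨b, hb⟩ := QuotientGroup.mk_surjective (a⁻¹ * y * a)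
  have h1 := BraidGroup.mem_of_σ_mem (S := (f.range.comap (MulAut.conj a).toMonoidHom).comap
    (QuotientGroup.mk' (Subgroup.center (BraidGroup n)))) (fun i hi => hσ hi) b
  have h2 : a * b * a⁻¹ ∈ f.range := h1
  rw [hb] at h2
  show y ∈ f.range
  convert h2 using 1
  group
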